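/- arXiv:1804.06684 — 2 statements merged into one kernel-verified Lean document; each statement's English description precedes it below -/
import Mathlib

section
/- Let G be a finite non-cyclic group. Then the following three statements are equivalent: (1) G is nilpotent; (2) G has an ES-partition for some subgroup S with S normal in G and S ≤ Z_i(G) for some natural number i; (3) every non-cyclic subgroup H of G has an ES-partition for some subgroup S of H. -/
/-- A strict `S`-partition of a group `G`: a finite collection of at least two proper
subgroups of `G` covering `G`, any two distinct members of which intersect exactly in `S`. -/
def IsStrictPartition {G : Type*} [Group G] (S : Subgroup G) (P : Finset (Subgroup G)) : Prop :=
  2 ≤ P.card ∧ (∀ H ∈ P, H ≠ ⊤) ∧ (∀ g : G, ∃ H ∈ P, g ∈ H) ∧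
    ∀ H ∈ P, ∀ K ∈ P, H ≠ K → H ⊓ K = S

/-- An `ES`-partition: a strict `S`-partition all of whose components have the same order. -/
def IsESPartition {G : Type*} [Group G] (S : Subgroup G) (P : Finset (Subgroup G)) : Prop :=
  IsStrictPartition S P ∧ ∀ H ∈ P, ∀ K ∈ P, Nat.card H = Nat.card K

namespace IsStrictPartition

variable {G : Type*} [Group G] {S : Subgroup G} {P : Finset (Subgroup G)}

theorem exists_ne (h : IsStrictPartition S P) (H : Subgroup G) : ∃ K ∈ P, K ≠ H :=
  Finset.exists_mem_ne h.1 H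

theorem le (h : IsStrictPartition S P) {H : Subgroup G} (hH : H ∈ P) : S ≤ H := by
  obtain ⟨K, hK, hKH⟩ := h.exists_ne H
  rw [← h.2.2.2 H hH K hK hKH.symm]
  exact inf_le_left

theorem mem_of_mem_of_mem (h : IsStrictPartition S P) {H K : Subgroup G} (hH : H ∈ P)
    (hK : K ∈ P) (hne : H ≠ K) {x : G} (hx : x ∈ H) (hx' : x ∈ K) : x ∈ S := by
  rw [← h.2.2.2 H hH K hK hne]
  exact ⟨hx, hx'⟩

theorem eq_of_mem (h : IsStrictPartition S P) {H K : Subgroup G} (hH : H ∈ P)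
    (hK : K ∈ P) {x : G} (hxS : x ∉ S) (hx : x ∈ H) (hx' : x ∈ K) : H = K := by
  by_contra hne
  exact hxS (h.mem_of_mem_of_mem hH hK hne hx hx')

end IsStrictPartition

theorem Nat.card_fixedBy_quotient_mul_card {G : Type*} [Group G] (H : Subgroup G) (x : G) :
    Nat.card H * Nat.card (MulAction.fixedBy (G ⧸ H) x) = Nat.card {g : G // g⁻¹ * x * g ∈ H} := by
  rw [← Nat.card_prod]
  refine (Nat.card_congr ?_).symm
  refine Equiv.trans (Equiv.subtypeEquivRight fun g => ?_)
    (QuotientGroup.preimageMkEquivSubgroupProdSet H (MulAction.fixedBy (G ⧸ H) x))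
  rw [Set.mem_preimage, MulAction.mem_fixedBy, MulAction.Quotient.smul_mk, eq_comm,
    QuotientGroup.eq, smul_eq_mul, mul_assoc]

namespace IsESPartition

variable {G : Type*} [Group G] [Finite G] {S : Subgroup G} {P : Finset (Subgroup G)}

theorem index_eq (h : IsESPartition S P) {H K : Subgroup G} (hH : H ∈ P) (hK : K ∈ P) :
    H.index = K.index := by
  have h1 := H.card_mul_index
  have h2 := K.card_mul_index
  rw [h.2 H hH K hK, ← h2] at h1
  exact Nat.eq_of_mul_eq_mul_left Nat.card_pos h1

theorem index_lt_card (h : IsESPartition S P) {H : Subgroup G} (hH : H ∈ P) :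
    H.index < P.card := by
  classical
  have : Fintype G := Fintype.ofFinite G
  have hfin : ∀ K : Subgroup G, ((K : Set G).toFinset).card = Nat.card K := fun K => by
    rw [Set.toFinset_card, ← Nat.card_eq_fintype_card]; rfl
  have hle : Nat.card S ≤ Nat.card H := Nat.card_le_card_of_injective _
    (Subgroup.inclusion_injective (h.1.le hH))
  have hsub : (Finset.univ : Finset G) ⊆
      (S : Set G).toFinset ∪ P.biUnion fun K => (K : Set G).toFinset \ (S : Set G).toFinset := by
    intro x _
    obtain ⟨K, hK, hx⟩ := h.1.2.2.1 x
    by_cases hxS : x ∈ S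
    · simp [hxS]
    · simp only [Finset.mem_union, Finset.mem_biUnion]
      exact Or.inr ⟨K, hK, by simp [hxS, hx]⟩
  have hcard : Nat.card G ≤ Nat.card S + P.card * (Nat.card H - Nat.card S) := by
    calc Nat.card G = (Finset.univ : Finset G).card := by simp
      _ ≤ _ := Finset.card_le_card hsub
      _ ≤ _ := Finset.card_union_le _ _
      _ ≤ _ := by
        rw [hfin]
        refine Nat.add_le_add_left (Finset.card_biUnion_le_card_mul _ _ _ fun K hK => ?_) _
        rw [Finset.card_sdiff_of_subset, hfin, hfin, h.2 K hK H hH]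
        simpa using h.1.le hK
  have hidx : 1 < H.index := H.one_lt_index_of_ne_top (h.1.2.1 H hH)
  have hS : 0 < Nat.card S := Nat.card_pos
  rw [← H.card_mul_index] at hcard
  by_contra hk
  push Not at hk
  obtain ⟨c, hc⟩ := Nat.exists_eq_add_of_le hle
  rw [hc] at hcard
  simp only [Nat.add_sub_cancel_left] at hcard
  nlinarith [Nat.mul_le_mul_right c hk]

theorem sum_card_fixedBy (h : IsESPartition (⊥ : Subgroup G) P) {H : Subgroup G} (hH : H ∈ P)
    {x : G} (hx : x ≠ 1) :
    ∑ K ∈ P, Nat.card (MulAction.fixedBy (G ⧸ K) x) = H.index := by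
  classical
  have : Fintype G := Fintype.ofFinite G
  refine Nat.eq_of_mul_eq_mul_left (Nat.card_pos : 0 < Nat.card H) ?_
  rw [H.card_mul_index, Finset.mul_sum]
  have : ∀ K ∈ P, Nat.card H * Nat.card (MulAction.fixedBy (G ⧸ K) x) =
      ((Finset.univ : Finset G).filter fun g => g⁻¹ * x * g ∈ K).card := fun K hK => by
    rw [h.2 H hH K hK, Nat.card_fixedBy_quotient_mul_card, Nat.card_eq_fintype_card,
      Fintype.card_subtype]
  rw [Finset.sum_congr rfl this, ← Finset.card_biUnion, Nat.card_eq_fintype_card,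
    ← Finset.card_univ]
  · congr 1
    ext g
    simpa using h.1.2.2.1 (g⁻¹ * x * g)
  · intro K hK L hL hne
    rw [Function.onFun, Finset.disjoint_left]
    intro g hg hg'
    simp only [Finset.mem_filter, Finset.mem_univ, true_and] at hg hg'
    refine hne (h.1.eq_of_mem hK hL ?_ hg hg')
    rw [Subgroup.mem_bot]
    contrapose! hx
    have := congrArg (fun z => g * z * g⁻¹) hx
    simpa [mul_assoc] using this

end IsESPartition

/-- If every element outside a normal subgroup `N` of prime index has prime order `p` and acts
without nontrivial fixed points on an abelian group of order coprime to `|N|`, then `N` acts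
trivially. -/
theorem MonoidHom.apply_eq_self_of_fixedPointFree {M V : Type*} [Group M] [Finite M] [CommGroup V]
    [Finite V] (φ : M →* MulAut V) {N : Subgroup M} [N.Normal] {p : ℕ} (hp : p.Prime)
    (hidx : N.index = p) (hpow : ∀ u ∉ N, u ^ p = 1) (hfix : ∀ u ∉ N, ∀ v, φ u v = v → v = 1)
    (hcop : (Nat.card V).Coprime (Nat.card N)) {w : M} (hw : w ∈ N) (v : V) : φ w v = v := by
  classical
  have : Fintype N := Fintype.ofFinite N
  have hne : N ≠ ⊤ := by
    rintro rfl
    rw [Subgroup.index_top] at hidx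
    exact hp.one_lt.ne hidx
  obtain ⟨y, hy⟩ : ∃ y, y ∉ N := by
    by_contra! h
    exact hne (eq_top_iff.2 fun x _ => h x)
  have huy : ∀ u : N, (u : M) * y ∉ N := fun u h => hy ((N.mul_mem_cancel_left u.2).1 h)
  -- the sum over each cyclic group generated by an element outside `N` is trivial
  have horb : ∀ u : N, ∏ j ∈ Finset.range p, φ ((u * y) ^ j) v = 1 := by
    intro u
    refine hfix _ (huy u) _ ?_
    rw [map_prod]
    have h1 : ∀ j, φ (u * y) (φ ((u * y) ^ j) v) = φ ((u * y) ^ (j + 1)) v := fun j => by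
      rw [pow_succ', map_mul, map_mul, MulAut.mul_apply, MulAut.mul_apply, map_mul,
        MulAut.mul_apply]
    simp_rw [h1]
    obtain ⟨k, rfl⟩ : ∃ k, p = k + 1 := ⟨p - 1, by have := hp.pos; omega⟩
    rw [Finset.prod_range_succ, Finset.prod_range_succ', hpow _ (huy u)]
    simp
  -- for `0 < j < p` the elements `(u * y) ^ j` run over a coset of `N`
  have hcoset : ∀ j, j ≠ 0 → j < p →
      φ w (∏ u : N, φ ((u * y) ^ j) v) = ∏ u : N, φ ((u * y) ^ j) v := by
    intro j hj0 hjp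
    have hmem : ∀ u : N, (u * y) ^ j * (y ^ j)⁻¹ ∈ N := fun u => by
      rw [← QuotientGroup.eq_one_iff]
      simp [(QuotientGroup.eq_one_iff _).2 u.2]
    let f : N → N := fun u => ⟨(u * y) ^ j * (y ^ j)⁻¹, hmem u⟩
    have hf : Function.Injective f := by
      intro u u' h
      have h1 : ((u : M) * y) ^ j = (u' * y) ^ j := by
        simpa [f] using h
      have hj : Nat.Coprime j p := Nat.Coprime.symm ((Nat.Prime.coprime_iff_not_dvd hp).2
        (Nat.not_dvd_of_pos_of_lt (Nat.pos_of_ne_zero hj0) hjp))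
      have key : ∀ a : M, a ^ p = 1 → a ^ (Nat.gcdA j p * j) = a := by
        intro a ha
        have h2 := Nat.gcd_eq_gcd_ab j p
        rw [hj.gcd_eq_one, Nat.cast_one] at h2
        have h3 : a ^ ((j : ℤ) * Nat.gcdA j p + p * Nat.gcdB j p) = a := by
          rw [← h2, zpow_one]
        rw [zpow_add, zpow_mul a (p : ℤ), zpow_natCast, ha, one_zpow, mul_one] at h3
        rwa [mul_comm]
      have h4 : (u : M) * y = u' * y := by
        rw [← key _ (hpow _ (huy u)), ← key _ (hpow _ (huy u')), mul_comm, zpow_mul, zpow_mul,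
          zpow_natCast, zpow_natCast, h1]
      exact Subtype.ext (mul_right_cancel h4)
    have hf' := Finite.injective_iff_bijective.1 hf
    have h5 : ∏ u : N, φ ((u * y) ^ j) v = ∏ u : N, φ (u * y ^ j) v := by
      refine Fintype.prod_bijective f hf' _ _ fun u => ?_
      simp [f]
    rw [h5, map_prod]
    refine Fintype.prod_equiv (Equiv.mulLeft (⟨w, hw⟩ : N)) _ _ fun u => ?_
    simp [mul_assoc]
  have htot :
      v ^ Nat.card N * ∏ j ∈ Finset.range (p - 1), ∏ u : N, φ ((u * y) ^ (j + 1)) v = 1 := by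
    have h1 : ∏ u : N, ∏ j ∈ Finset.range p, φ ((u * y) ^ j) v = 1 :=
      Finset.prod_eq_one fun u _ => horb u
    rw [Finset.prod_comm] at h1
    obtain ⟨k, rfl⟩ : ∃ k, p = k + 1 := ⟨p - 1, by have := hp.pos; omega⟩
    rw [Finset.prod_range_succ'] at h1
    simpa [mul_comm] using h1
  have hfixed : φ w (v ^ Nat.card N) = v ^ Nat.card N := by
    rw [mul_eq_one_iff_eq_inv.1 htot, map_inv, map_prod]
    congr 1
    refine Finset.prod_congr rfl fun j hj => hcoset _ (Nat.succ_ne_zero j) ?_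
    have := Finset.mem_range.1 hj
    omega
  rw [map_pow] at hfixed
  exact (powCoprime hcop).injective hfixed

theorem IsPGroup.index_le_of_fixedPointFree {R V : Type*} [Group R] [Finite R] [CommGroup V]
    [Finite V] [Nontrivial V] (φ : R →* MulAut V) {p q : ℕ} (hp : p.Prime) (hq : q.Prime)
    (hpq : p ≠ q) (hR : IsPGroup p R) (hV : IsPGroup q V) (N : Subgroup R)
    (hpow : ∀ u ∉ N, u ^ p = 1) (hfix : ∀ u ∉ N, ∀ v, φ u v = v → v = 1) : N.index ≤ p := by
  have : Fact p.Prime := ⟨hp⟩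
  have : Fact q.Prime := ⟨hq⟩
  by_contra! hlt
  obtain ⟨r, hr⟩ := IsPGroup.iff_card.1 hR
  obtain ⟨n, hn⟩ := IsPGroup.iff_card.1 (hR.to_subgroup N)
  obtain ⟨k, hk⟩ := hR.index N
  have hrk : r = n + k := by
    have := N.card_mul_index
    rw [hn, hk, hr, ← pow_add] at this
    exact (Nat.pow_right_injective hp.two_le this).symm
  have hk2 : 1 < k := by
    by_contra! h
    rw [hk] at hlt
    exact (Nat.pow_le_pow_right hp.pos h).not_gt (by simpa using hlt)
  obtain ⟨M, hM, hNM⟩ := Sylow.exists_subgroup_card_pow_prime_le p (n := n) (m := r - 1)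
    (hr ▸ pow_dvd_pow p (Nat.sub_le r 1)) N hn (by omega)
  have hMidx : M.index = p := by
    have h1 := M.card_mul_index
    obtain ⟨s, rfl⟩ : ∃ s, r = s + 1 := ⟨r - 1, by omega⟩
    rw [hM, hr, Nat.add_sub_cancel, pow_succ] at h1
    exact Nat.eq_of_mul_eq_mul_left (pow_pos hp.pos _) h1
  have hMn : M.Normal := by
    apply Subgroup.normal_of_index_eq_minFac_card
    rw [hMidx, hr, hp.pow_minFac (by omega)]
  have hne : ¬ M ≤ N := fun h => by
    have := le_antisymm h hNM
    rw [this] at hMidx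
    omega
  obtain ⟨y, hyM, hyN⟩ := SetLike.not_le_iff_exists.1 hne
  obtain ⟨v, hv⟩ := exists_ne (1 : V)
  refine hv (hfix y hyN v (φ.apply_eq_self_of_fixedPointFree hp hMidx (fun u hu => hpow u
    fun h => hu (hNM h)) (fun u hu => hfix u fun h => hu (hNM h)) ?_ hyM v))
  obtain ⟨a, ha⟩ := IsPGroup.iff_card.1 hV
  rw [ha, hM]
  exact Nat.Coprime.pow _ _ ((Nat.coprime_primes hq hp).2 hpq.symm)

/-- A Frattini argument: if `B` contains all elements of `q`-power order, the normalizer of a Sylow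
`q`-subgroup meets every coset of `B`. -/
theorem Sylow.exists_mem_normalizer_inv_mul_mem {C : Type*} [Group C] [Finite C] {q : ℕ}
    [Fact q.Prime] (Q : Sylow q C) {B : Subgroup C} (hB : ∀ x : C, ∀ n, x ^ q ^ n = 1 → x ∈ B)
    (c : C) : ∃ k ∈ Subgroup.normalizer (Q : Set C), k⁻¹ * c ∈ B := by
  have hle : Subgroup.normalClosure (Q : Set C) ≤ B := by
    refine (Subgroup.closure_le _).2 fun x hx => ?_
    obtain ⟨a, ha, hax⟩ := Group.mem_conjugatesOfSet_iff.1 hx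
    obtain ⟨b, rfl⟩ := isConj_iff.1 hax
    obtain ⟨n, hn⟩ := Q.2 ⟨a, ha⟩
    refine hB _ n ?_
    have : a ^ q ^ n = 1 := by simpa [Subtype.ext_iff] using hn
    rw [conj_pow, this]
    simp
  have htop := Q.normalizer_sup_eq_top' (N := Subgroup.normalClosure (Q : Set C))
    Subgroup.le_normalClosure
  have hc : c ∈ Subgroup.normalizer (Q : Set C) ⊔ Subgroup.normalClosure (Q : Set C) :=
    htop ▸ Subgroup.mem_top c
  obtain ⟨k, hk, n, hn, rfl⟩ := Subgroup.mem_sup_of_normal_right.1 hc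
  exact ⟨k, hk, by simpa using hle hn⟩

theorem Subgroup.normalizer_le_normalizer_inf_centralizer {C : Type*} [Group C] (Q : Subgroup C) :
    normalizer (Q : Set C) ≤ normalizer ((Q ⊓ centralizer (Q : Set C) : Subgroup C) : Set C) := by
  have key : ∀ g ∈ normalizer (Q : Set C), ∀ h ∈ Q ⊓ centralizer (Q : Set C),
      g * h * g⁻¹ ∈ Q ⊓ centralizer (Q : Set C) := by
    intro g hg h hh
    refine ⟨(mem_normalizer_iff.1 hg h).1 hh.1, mem_centralizer_iff.2 fun x hx => ?_⟩
    have h1 : g⁻¹ * x * g ∈ Q := by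
      rw [mem_normalizer_iff.1 hg]
      simpa [mul_assoc] using hx
    have h2 := mem_centralizer_iff.1 hh.2 _ h1
    have h3 := congrArg (fun z => g * z * g⁻¹) h2
    simpa [mul_assoc] using h3
  intro g hg
  refine mem_normalizer_iff.2 fun h => ⟨key g hg h, fun hh => ?_⟩
  have := key g⁻¹ (inv_mem hg) _ hh
  simpa [mul_assoc] using this

theorem IsPGroup.inf_centralizer_ne_bot {C : Type*} [Group C] [Finite C] {q : ℕ} [Fact q.Prime]
    {Q : Subgroup C} (hQ : IsPGroup q Q) (hne : Q ≠ ⊥) :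
    Q ⊓ Subgroup.centralizer (Q : Set C) ≠ ⊥ := by
  have : Nontrivial Q := (Subgroup.nontrivial_iff_ne_bot Q).2 hne
  have := hQ.center_nontrivial
  obtain ⟨⟨z, hz⟩, hz1⟩ := exists_ne (1 : Subgroup.center Q)
  intro h
  have hmem : (z : C) ∈ Q ⊓ Subgroup.centralizer (Q : Set C) := by
    refine ⟨z.2, Subgroup.mem_centralizer_iff.2 fun x hx => ?_⟩
    exact congrArg Subtype.val (Subgroup.mem_center_iff.1 hz ⟨x, hx⟩)
  rw [h, Subgroup.mem_bot] at hmem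
  exact hz1 (Subtype.ext (Subtype.ext hmem))

/-- If the elements outside `B` have order `p` and commute with no element of order `q`, where
`q ∣ |C|`, then `B` has index at most `p`. -/
theorem Subgroup.index_le_of_pow_eq_one_of_commute {C : Type*} [Group C] [Finite C]
    (B : Subgroup C) {p q : ℕ} (hp : p.Prime) (hq : q.Prime) (hpq : p ≠ q)
    (hpow : ∀ x ∉ B, x ^ p = 1) (hcomm : ∀ x ∉ B, ∀ u, u ^ q = 1 → x * u = u * x → u = 1)
    (hdvd : q ∣ Nat.card C) : B.index ≤ p := by
  have : Fact p.Prime := ⟨hp⟩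
  have : Fact q.Prime := ⟨hq⟩
  have hB : ∀ r : ℕ, r.Coprime p → ∀ x : C, ∀ n, x ^ r ^ n = 1 → x ∈ B := by
    intro r hr x n hx
    by_contra hxB
    have h1 : x = 1 := by
      have := Nat.dvd_gcd (orderOf_dvd_of_pow_eq_one hx) (orderOf_dvd_of_pow_eq_one (hpow x hxB))
      rwa [Nat.Coprime.gcd_eq_one (Nat.Coprime.pow_left n hr), Nat.dvd_one, orderOf_eq_one_iff]
        at this
    exact hxB (h1 ▸ B.one_mem)
  have hqB := hB q ((Nat.coprime_primes hq hp).2 hpq.symm)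
  obtain ⟨Q⟩ : Nonempty (Sylow q C) := inferInstance
  set K := normalizer (Q : Set C) with hK
  set V : Subgroup C := Q ⊓ centralizer (Q : Set C) with hV
  have hQne : (Q : Subgroup C) ≠ ⊥ := Q.ne_bot_of_dvd_card hdvd
  have hVne : Nontrivial V := (nontrivial_iff_ne_bot V).2 (Q.2.inf_centralizer_ne_bot hQne)
  have hVcomm : IsMulCommutative V := ⟨⟨fun a b => Subtype.ext
    (mem_centralizer_iff.1 b.2.2 _ a.2.1)⟩⟩
  let _ : CommGroup V := { (inferInstance : Group V) with mul_comm := hVcomm.is_comm.comm }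
  have hVq : IsPGroup q V := Q.2.to_le inf_le_left
  have hKV : K ≤ normalizer (V : Set C) := normalizer_le_normalizer_inf_centralizer _
  obtain ⟨R⟩ : Nonempty (Sylow p K) := inferInstance
  let φ : R →* MulAut V := (normalizerMonoidHom V).comp
    ((inclusion hKV).comp (R : Subgroup K).subtype)
  let N : Subgroup R := (B.subgroupOf K).subgroupOf R
  have hφ : ∀ (u : R) (v : V), ((φ u v : V) : C) = (u : K) * v * ((u : K) : C)⁻¹ := fun _ _ => rfl
  have hN : N.index ≤ p := by
    refine IsPGroup.index_le_of_fixedPointFree φ hp hq hpq R.2 hVq N ?_ ?_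
    · intro u hu
      have := hpow _ (show ((u : K) : C) ∉ B from hu)
      exact Subtype.ext (Subtype.ext (by simpa using this))
    · intro u hu v huv
      obtain ⟨n, hn⟩ := hVq v
      have huv' : ((u : K) : C) * v = v * ((u : K) : C) :=
        mul_inv_eq_iff_eq_mul.1 ((hφ u v).symm.trans (congrArg Subtype.val huv))
      have hn' : (v : C) ^ q ^ n = 1 := by simpa using congrArg Subtype.val hn
      have key : ∀ n, (v : C) ^ q ^ n = 1 → (v : C) = 1 := by
        intro n
        induction n with
        | zero => simp
        | succ n ih =>
          intro h
          refine ih (hcomm _ (show ((u : K) : C) ∉ B from hu) _ ?_ (Commute.pow_right huv' _))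
          rwa [← pow_mul, ← pow_succ]
      exact Subtype.ext (key n hn')
  have hidx : B.index ≤ (B.subgroupOf K).index := by
    refine Nat.card_le_card_of_surjective
      (Quotient.map' (fun k : K => (k : C)) ?_ : K ⧸ B.subgroupOf K → C ⧸ B) ?_
    · intro a b hab
      rw [QuotientGroup.leftRel_apply] at hab ⊢
      exact hab
    · intro c
      induction c using QuotientGroup.induction_on with
      | H c =>
        obtain ⟨k, hk, hkc⟩ := Q.exists_mem_normalizer_inv_mul_mem hqB c
        exact ⟨QuotientGroup.mk ⟨k, hk⟩, QuotientGroup.eq.2 hkc⟩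
  refine hidx.trans (le_trans (Nat.le_of_dvd (Nat.pos_of_ne_zero N.index_ne_zero_of_finite) ?_) hN)
  have hcop : (B.subgroupOf K).index.Coprime (R : Subgroup K).index := by
    refine Nat.Coprime.symm (Nat.coprime_of_dvd fun r hr hrR hrB => ?_)
    have : Fact r.Prime := ⟨hr⟩
    have hrp : r ≠ p := by
      rintro rfl
      exact R.not_dvd_index hrR
    obtain ⟨T⟩ : Nonempty (Sylow r K) := inferInstance
    have hT : (T : Subgroup K) ≤ B.subgroupOf K := fun x hx => by
      obtain ⟨n, hn⟩ := T.2 ⟨x, hx⟩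
      refine hB r ((Nat.coprime_primes hr hp).2 hrp) _ n ?_
      simpa [Subtype.ext_iff] using hn
    exact T.not_dvd_index (hrB.trans (index_dvd_of_le hT))
  refine hcop.dvd_of_dvd_mul_right ?_
  have h1 := relIndex_mul_index (inf_le_right : B.subgroupOf K ⊓ (R : Subgroup K) ≤ R)
  rw [inf_relIndex_right] at h1
  change (B.subgroupOf K).index ∣ (B.subgroupOf K).relIndex R * _
  rw [h1]
  exact index_dvd_of_le inf_le_left

theorem Subgroup.exists_mem_normalizer_of_lt {G : Type*} [Group G] {T L : Subgroup G}
    [Group.IsNilpotent L] (h : T < L) :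
    ∃ n ∈ L, n ∈ Subgroup.normalizer (T : Set G) ∧ n ∉ T := by
  have h1 : T.subgroupOf L < ⊤ := by
    rw [lt_top_iff_ne_top, Ne, Subgroup.subgroupOf_eq_top]
    exact h.not_ge
  obtain ⟨n, hn, hnT⟩ := SetLike.exists_of_lt (Group.normalizerCondition_of_isNilpotent _ h1)
  refine ⟨n, n.2, Subgroup.mem_normalizer_iff.2 fun x => ?_, hnT⟩
  constructor
  · intro hx
    exact (Subgroup.mem_normalizer_iff.1 hn ⟨x, h.le hx⟩).1 hx
  · intro hx
    have hxL : x ∈ L := by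
      have := L.mul_mem (L.mul_mem (L.inv_mem n.2) (h.le hx)) n.2
      simpa [mul_assoc] using this
    exact (Subgroup.mem_normalizer_iff.1 hn ⟨x, hxL⟩).2 hx

section PSubgroups

variable {G : Type*} [Group G] [Finite G] {p : ℕ} [Fact p.Prime]

theorem IsPGroup.exists_mem_normalizer_of_lt {T L : Subgroup G} (hL : IsPGroup p L) (h : T < L) :
    ∃ n ∈ L, n ∈ Subgroup.normalizer (T : Set G) ∧ n ∉ T :=
  have : Group.IsNilpotent L := hL.isNilpotent
  Subgroup.exists_mem_normalizer_of_lt h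

theorem IsPGroup.exists_orderOf_eq_mem_commute {A L : Subgroup G} (hL : IsPGroup p L)
    (hA : A ≠ ⊥) (hAL : A ≤ L) (hLA : L ≤ Subgroup.normalizer (A : Set G)) :
    ∃ x ∈ A, orderOf x = p ∧ ∀ l ∈ L, l * x = x * l := by
  let _ : MulAction L A := MulAction.compHom A
    ((Subgroup.normalizerMonoidHom A).comp (Subgroup.inclusion hLA))
  have hsmul : ∀ (l : L) (a : A), ((l • a : A) : G) = l * a * (l : G)⁻¹ := fun _ _ => rfl
  have hp : p ∣ Nat.card A := by
    have : Nontrivial A := (Subgroup.nontrivial_iff_ne_bot A).2 hA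
    obtain ⟨n, hn, h⟩ := (IsPGroup.nontrivial_iff_card (hL.to_le hAL)).1 this
    rw [h]
    exact dvd_pow_self p hn.ne'
  obtain ⟨b, hb, hb1⟩ := hL.exists_fixed_point_of_prime_dvd_card_of_fixed_point A hp (a := 1)
    fun l => Subtype.ext (by simp [hsmul])
  obtain ⟨k, hk⟩ := (IsPGroup.iff_orderOf.1 hL) ⟨b, hAL b.2⟩
  rw [Subgroup.orderOf_mk] at hk
  have hb1' : (b : G) ≠ 1 := fun h => hb1 (Subtype.ext h.symm)
  have hk0 : k ≠ 0 := by
    rintro rfl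
    exact hb1' (orderOf_eq_one_iff.1 (by simpa using hk))
  obtain ⟨j, rfl⟩ := Nat.exists_eq_succ_of_ne_zero hk0
  refine ⟨(b : G) ^ p ^ j, A.pow_mem b.2 _, ?_, fun l hl => ?_⟩
  · rw [orderOf_pow, hk, Nat.gcd_eq_right (pow_dvd_pow p j.le_succ), pow_succ,
      Nat.mul_div_cancel_left _ (pow_pos (Fact.out (p := p.Prime)).pos _)]
  · have h1 : l * b * l⁻¹ = (b : G) := by
      rw [← hsmul ⟨l, hl⟩ b, hb ⟨l, hl⟩]
    exact Commute.pow_right (mul_inv_eq_iff_eq_mul.1 h1) _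

theorem IsPGroup.card_le_of_le {A H : Subgroup G} (hA : IsPGroup p A) (h : A ≤ H) :
    Nat.card A ≤ p ^ (Nat.card H).factorization p := by
  obtain ⟨n, hn⟩ := IsPGroup.iff_card.1 hA
  rw [hn]
  refine Nat.pow_le_pow_right (Fact.out (p := p.Prime)).pos ?_
  rw [← (Fact.out (p := p.Prime)).pow_dvd_iff_le_factorization Nat.card_pos.ne', ← hn]
  exact Subgroup.card_dvd_of_le h

theorem IsPGroup.mul_card_le_of_lt {A B : Subgroup G} (hB : IsPGroup p B) (h : A < B) :
    p * Nat.card A ≤ Nat.card B := by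
  obtain ⟨n, hn⟩ := IsPGroup.iff_card.1 hB
  obtain ⟨k, hk⟩ := IsPGroup.iff_card.1 (hB.to_le h.le)
  have hlt : Nat.card A < Nat.card B := by
    by_contra! hle
    exact h.ne (Subgroup.eq_of_le_of_card_ge h.le hle)
  rw [hn, hk] at *
  have := (Nat.pow_lt_pow_iff_right (Fact.out (p := p.Prime)).one_lt).1 hlt
  rw [← pow_succ']
  exact Nat.pow_le_pow_right (Fact.out (p := p.Prime)).pos this

theorem Subgroup.exists_isPGroup_le_card (H : Subgroup G) (p : ℕ) [Fact p.Prime] :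
    ∃ T ≤ H, IsPGroup p T ∧ Nat.card T = p ^ (Nat.card H).factorization p := by
  obtain ⟨T⟩ : Nonempty (Sylow p H) := inferInstance
  refine ⟨(T : Subgroup H).map H.subtype, Subgroup.map_subtype_le _, T.2.map _, ?_⟩
  rw [Subgroup.card_map_of_injective H.subtype_injective, T.card_eq_multiplicity]

theorem IsPGroup.le_normalizer_of_card {A L : Subgroup G} (hL : IsPGroup p L) (hAL : A ≤ L)
    (hcard : Nat.card L ≤ p * Nat.card A) : L ≤ Subgroup.normalizer (A : Set G) := by
  rcases hAL.eq_or_lt with rfl | hlt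
  · exact Subgroup.le_normalizer
  have h1 := le_antisymm hcard (hL.mul_card_le_of_lt hlt)
  have h2 : (A.subgroupOf L).index = p := by
    have h3 := Subgroup.card_mul_index (A.subgroupOf L)
    rw [Nat.card_congr (Subgroup.subgroupOfEquivOfLe hAL).toEquiv, h1, mul_comm] at h3
    exact Nat.eq_of_mul_eq_mul_right Nat.card_pos h3
  have : (A.subgroupOf L).Normal := by
    apply Subgroup.normal_of_index_eq_minFac_card
    obtain ⟨n, hn⟩ := IsPGroup.iff_card.1 hL
    have hn0 : n ≠ 0 := by
      rintro rfl
      have := Subgroup.card_dvd_of_le hAL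
      have h4 : p ∣ Nat.card L := Dvd.intro _ h1.symm
      rw [hn, pow_zero] at h4
      exact (Fact.out (p := p.Prime)).one_lt.ne' (Nat.dvd_one.1 h4)
    rw [h2, hn, (Fact.out (p := p.Prime)).pow_minFac hn0]
  exact (Subgroup.normal_subgroupOf_iff_le_normalizer hAL).1 this

end PSubgroups

open scoped Pointwise

/-- `H` is isolated if an element outside `H` commuting with an element `x ≠ 1` of `H` satisfies
every equation `y ^ n = 1` satisfied by `x`. -/
def Subgroup.IsIsolated {G : Type*} [Group G] (H : Subgroup G) : Prop :=
  ∀ x ∈ H, x ≠ 1 → ∀ y, y ∉ H → x * y = y * x → ∀ n : ℕ, x ^ n = 1 → y ^ n = 1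

theorem IsStrictPartition.isIsolated {G : Type*} [Group G] {P : Finset (Subgroup G)}
    (h : IsStrictPartition (⊥ : Subgroup G) P) {H : Subgroup G} (hH : H ∈ P) : H.IsIsolated := by
  intro x hx hx1 y hy hxy n hn
  obtain ⟨K, hK, hyK⟩ := h.2.2.1 y
  obtain ⟨L, hL, hxyL⟩ := h.2.2.1 (x * y)
  have hLK : L ≠ K := by
    rintro rfl
    have hxL : x ∈ L := (L.mul_mem_cancel_right hyK).1 hxyL
    rw [h.eq_of_mem hH hL (by simpa using hx1) hx hxL] at hy
    exact hy hyK
  have h1 : (x * y) ^ n = y ^ n := by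
    rw [Commute.mul_pow hxy, hn, one_mul]
  have := h.mem_of_mem_of_mem hL hK hLK (x := y ^ n) (h1 ▸ L.pow_mem hxyL n) (K.pow_mem hyK n)
  simpa using this

namespace Subgroup

variable {G : Type*} [Group G]

theorem mem_conj_smul {H : Subgroup G} {g x : G} : x ∈ MulAut.conj g • H ↔ g⁻¹ * x * g ∈ H := by
  rw [mem_pointwise_smul_iff_inv_smul_mem, ← map_inv, MulAut.smul_def, MulAut.conj_apply, inv_inv]

theorem card_conj_smul (H : Subgroup G) (g : G) :
    Nat.card (MulAut.conj g • H : Subgroup G) = Nat.card H :=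
  Nat.card_congr (equivSMul (MulAut.conj g) H).toEquiv.symm

theorem IsIsolated.conj_smul {H : Subgroup G} (h : H.IsIsolated) (g : G) :
    (MulAut.conj g • H).IsIsolated := by
  intro x hx hx1 y hy hxy n hn
  rw [mem_conj_smul] at hx hy
  have hc : ∀ z : G, (g⁻¹ * z * g) ^ n = g⁻¹ * z ^ n * g := fun z => by
    have := conj_pow (i := n) (a := g⁻¹) (b := z)
    rwa [inv_inv] at this
  have := h _ hx (fun h1 => hx1 ?_) _ hy ?_ n (by rw [hc, hn]; simp)
  · rw [hc] at this
    have := congrArg (fun z => g * z * g⁻¹) this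
    simpa [mul_assoc] using this
  · have := congrArg (fun z => g * z * g⁻¹) h1
    simpa [mul_assoc] using this
  · have := congrArg (fun z => g⁻¹ * z * g) hxy
    simpa [mul_assoc] using this

variable [Finite G]

theorem IsIsolated.card_le {H H' : Subgroup G} (hH : H.IsIsolated) (hH' : H'.IsIsolated) {x : G}
    (hxH : x ∈ H) (hxH' : x ∈ H') {p q : ℕ} (hp : p.Prime) (hq : q.Prime) (hpq : p ≠ q)
    (hx : orderOf x = p) {u : G} (hu : orderOf u = q) (hxu : x * u = u * x) {L : Subgroup G}
    (hL : ∀ l ∈ L, l * x = x * l) : Nat.card L ≤ p * Nat.card (H ⊓ H' ⊓ L : Subgroup G) := by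
  have hx1 : x ≠ 1 := by
    rintro rfl
    exact hp.one_lt.ne (by simpa using hx)
  have hxp : x ^ p = 1 := hx ▸ pow_orderOf_eq_one x
  have hcop : ∀ z : G, z ^ p = 1 → z ^ q = 1 → z = 1 := fun z h1 h2 => by
    have := Nat.dvd_gcd (orderOf_dvd_of_pow_eq_one h1) (orderOf_dvd_of_pow_eq_one h2)
    rwa [(Nat.coprime_primes hp hq).2 hpq, Nat.dvd_one, orderOf_eq_one_iff] at this
  set C := centralizer ({x} : Set G) with hC
  have hmemC : ∀ z, z ∈ C ↔ z * x = x * z := fun z => by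
    rw [hC, mem_centralizer_singleton_iff]
  have hpow : ∀ y : G, y ∉ H ⊓ H' → x * y = y * x → y ^ p = 1 := by
    intro y hy hxy
    by_cases h1 : y ∈ H
    · exact hH' x hxH' hx1 y (fun h2 => hy ⟨h1, h2⟩) hxy p hxp
    · exact hH x hxH hx1 y h1 hxy p hxp
  have hidx : ((H ⊓ H').subgroupOf C).index ≤ p := by
    refine index_le_of_pow_eq_one_of_commute _ hp hq hpq ?_ ?_ ?_
    · intro y hy
      exact Subtype.ext (by simpa using hpow y hy ((hmemC _).1 y.2).symm)
    · intro y hy v hv hyv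
      have hv' : (v : G) ^ q = 1 := by simpa using congrArg Subtype.val hv
      have hyv' : (v : G) * y = y * v := (congrArg Subtype.val hyv).symm
      have hy' : (y : G) ∉ H ⊓ H' := hy
      have hyp := hpow y hy' ((hmemC _).1 y.2).symm
      by_contra hv1
      have hv1' : (v : G) ≠ 1 := fun h => hv1 (Subtype.ext h)
      have hvm : (v : G) ∈ H ⊓ H' := by
        by_contra hvm
        exact hv1' (hcop _ (hpow v hvm ((hmemC _).1 v.2).symm) hv')
      have hyq : (y : G) ^ q = 1 := by
        by_cases h1 : (y : G) ∈ H
        · exact hH' v hvm.2 hv1' y (fun h2 => hy' ⟨h1, h2⟩) hyv' q hv'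
        · exact hH v hvm.1 hv1' y h1 hyv' q hv'
      exact hy' (hcop _ hyp hyq ▸ one_mem _)
    · have : orderOf (⟨u, (hmemC u).2 hxu.symm⟩ : C) = q := by rw [orderOf_mk, hu]
      exact this ▸ _root_.orderOf_dvd_natCard _
  have hLC : L ≤ C := fun l hl => (hmemC l).2 (hL l hl)
  have h1 : (H ⊓ H').relIndex L ≤ p :=
    (relIndex_le_of_le_right hLC (index_ne_zero_of_finite)).trans hidx
  have h2 := card_mul_index ((H ⊓ H').subgroupOf L)
  have h3 : Nat.card ((H ⊓ H').subgroupOf L) = Nat.card (H ⊓ H' ⊓ L : Subgroup G) := by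
    rw [← inf_subgroupOf_right]
    exact Nat.card_congr (subgroupOfEquivOfLe inf_le_right).toEquiv
  rw [← h2, h3, mul_comm]
  exact Nat.mul_le_mul_right _ h1

end Subgroup

section

variable {G : Type*} [Group G] [Finite G]

theorem IsPGroup.of_forall_prime_orderOf {p : ℕ} [Fact p.Prime]
    {K : Subgroup G} (h : ∀ q, q.Prime → ∀ u ∈ K, orderOf u = q → q = p) : IsPGroup p K := by
  rw [IsPGroup.iff_orderOf]
  intro x
  rw [← Subgroup.orderOf_coe]
  refine ⟨(orderOf (x : G)).primeFactorsList.length, ?_⟩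
  refine Nat.eq_prime_pow_of_unique_prime_dvd (orderOf_pos _).ne' fun {q} hq hdvd => ?_
  refine h q hq ((x : G) ^ (orderOf (x : G) / q)) (K.pow_mem x.2 _) ?_
  rw [orderOf_pow_orderOf_div (orderOf_pos _).ne' hdvd]

variable {P : Finset (Subgroup G)}

theorem IsESPartition.exists_conj_smul_notMem (h : IsESPartition (⊥ : Subgroup G) P)
    {H : Subgroup G} (hH : H ∈ P) {t : G} (ht : t ≠ 1) :
    ∃ K ∈ P, ∀ g : G, t ∉ MulAut.conj g • K := by
  by_contra! hcon
  have h1 := h.sum_card_fixedBy hH ht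
  have h2 : ∀ K ∈ P, 1 ≤ Nat.card (MulAction.fixedBy (G ⧸ K) t) := by
    intro K hK
    obtain ⟨g, hg⟩ := hcon K hK
    rw [Subgroup.mem_conj_smul] at hg
    have : Nonempty (MulAction.fixedBy (G ⧸ K) t) := ⟨⟨g, by
      rw [MulAction.mem_fixedBy, MulAction.Quotient.smul_mk, eq_comm, QuotientGroup.eq, smul_eq_mul,
        ← mul_assoc]
      exact hg⟩⟩
    exact Nat.card_pos
  have h3 := Finset.sum_le_sum h2
  rw [h1] at h3
  simp only [Finset.sum_const, smul_eq_mul, mul_one] at h3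
  exact h3.not_gt (h.index_lt_card hH)

theorem IsESPartition.exists_isPGroup_centralizer (h : IsESPartition (⊥ : Subgroup G) P)
    {H : Subgroup G} (hH : H ∈ P) {p : ℕ} [Fact p.Prime] (hpH : p ^ 2 ∣ Nat.card H)
    (hpd : p ∣ H.index) :
    ∃ t ∈ H, orderOf t = p ∧ IsPGroup p (H ⊓ Subgroup.centralizer {t} : Subgroup G) ∧
      ∃ T ≤ H ⊓ Subgroup.centralizer {t},
        Nat.card T = p ^ (Nat.card H).factorization p := by
  have hp : p.Prime := Fact.out
  by_contra! hneg
  have hf : 2 ≤ (Nat.card H).factorization p :=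
    (hp.pow_dvd_iff_le_factorization Nat.card_pos.ne').1 hpH
  obtain ⟨T, hTH, hTp, hTcard⟩ := H.exists_isPGroup_le_card p
  have hHiso := h.1.isIsolated hH
  have hpT : p ^ 2 ≤ Nat.card T := hTcard ▸ Nat.pow_le_pow_right hp.pos hf
  -- the centralizers of suitable elements of `T` contain elements of order prime to `p`
  have hneg' : ∀ x ∈ T, orderOf x = p → (∀ t ∈ T, t * x = x * t) →
      ∃ q, q.Prime ∧ p ≠ q ∧ ∃ u, orderOf u = q ∧ x * u = u * x := by
    intro x hxT hx hcomm
    by_contra! hcon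
    refine hneg x (hTH hxT) hx
      (IsPGroup.of_forall_prime_orderOf fun q hq u hu huq => ?_) T ?_ hTcard
    · by_contra hqp
      refine hcon q hq (Ne.symm hqp) u huq ?_
      exact (Subgroup.mem_centralizer_singleton_iff.1 hu.2).symm
    · exact fun t ht => ⟨hTH ht, Subgroup.mem_centralizer_singleton_iff.2 (hcomm t ht)⟩
  obtain ⟨S, hTS⟩ := hTp.exists_le_sylow
  have hTltS : T < S := by
    refine lt_of_le_of_ne hTS fun heq => ?_
    have h1 := S.card_eq_multiplicity
    rw [← H.card_mul_index, Nat.factorization_mul Nat.card_pos.ne' H.index_ne_zero_of_finite] at h1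
    have h2 : Nat.card T = Nat.card S := by rw [heq]
    rw [← h2, hTcard] at h1
    have h3 := Nat.pow_right_injective hp.two_le h1
    have h4 := (hp.dvd_iff_one_le_factorization H.index_ne_zero_of_finite).1 hpd
    simp only [Finsupp.add_apply] at h3
    omega
  set L := Subgroup.normalizer (T : Set G) ⊓ (S : Subgroup G) with hL
  have hLp : IsPGroup p L := S.2.to_le inf_le_right
  have hTL : T ≤ L := le_inf Subgroup.le_normalizer hTS
  have hTne : T ≠ ⊥ := by
    rintro rfl
    rw [Subgroup.card_bot] at hpT
    have := Nat.one_lt_pow two_ne_zero hp.one_lt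
    omega
  -- subgroups of order `|T|` lying in a conjugate of a component
  have hinf : ∀ {H₁ T₁ : Subgroup G}, Nat.card H₁ = Nat.card H → T₁ ≤ H₁ → T₁ ≤ L →
      Nat.card T₁ = Nat.card T → H₁ ⊓ L = T₁ := by
    intro H₁ T₁ hH₁ hT₁H hT₁L hT₁
    refine (Subgroup.eq_of_le_of_card_ge (le_inf hT₁H hT₁L) ?_).symm
    rw [hT₁, hTcard, ← hH₁]
    exact (hLp.to_le inf_le_right).card_le_of_le inf_le_left
  have hHL : H ⊓ L = T := hinf rfl hTH hTL rfl
  have hLcard : Nat.card L ≤ p * Nat.card T := by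
    obtain ⟨x, hxT, hx, hxL⟩ := hLp.exists_orderOf_eq_mem_commute hTne hTL inf_le_left
    obtain ⟨q, hq, hpq, u, hu, hxu⟩ := hneg' x hxT hx fun t ht => hxL t (hTL ht)
    have := hHiso.card_le hHiso (hTH hxT) (hTH hxT) hp hq hpq hx hu hxu hxL
    rwa [inf_idem, hHL] at this
  have hTltL : T < L := by
    obtain ⟨n, hnS, hn, hnT⟩ := S.2.exists_mem_normalizer_of_lt hTltS
    exact lt_of_le_of_ne hTL fun heq => hnT (heq ▸ ⟨hn, hnS⟩)
  obtain ⟨H₁, T₁, hH₁iso, hH₁, hTH₁, hT₁L, hT₁card, hTT₁⟩ : ∃ H₁ T₁ : Subgroup G, H₁.IsIsolated ∧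
      Nat.card H₁ = Nat.card H ∧ T₁ ≤ H₁ ∧ T₁ ≤ L ∧ Nat.card T₁ = Nat.card T ∧ T₁ ≠ T := by
    rcases (inf_le_right : L ≤ S).eq_or_lt with hLS | hLS
    · by_contra! hcon
      obtain ⟨⟨t, ht⟩, ht0⟩ := Subgroup.ne_bot_iff_exists_ne_one.1 hTne
      have ht1 : t ≠ 1 := fun h1 => ht0 (Subtype.ext h1)
      obtain ⟨K, hK, htK⟩ := h.exists_conj_smul_notMem hH ht1
      obtain ⟨U, hUK, hUp, hUcard⟩ := K.exists_isPGroup_le_card p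
      obtain ⟨S', hUS'⟩ := hUp.exists_le_sylow
      obtain ⟨g, hg⟩ := MulAction.exists_smul_eq G S' S
      have hU : MulAut.conj g • U ≤ (S : Subgroup G) := by
        rw [← hg]
        exact Subgroup.pointwise_smul_le_pointwise_smul_iff.2 hUS'
      have := hcon (MulAut.conj g • K) (MulAut.conj g • U) ((h.1.isIsolated hK).conj_smul g)
        (by rw [Subgroup.card_conj_smul, h.2 K hK H hH])
        (Subgroup.pointwise_smul_le_pointwise_smul_iff.2 hUK) (hU.trans hLS.ge)
        (by rw [Subgroup.card_conj_smul, hUcard, hTcard, h.2 K hK H hH])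
      refine htK g ?_
      exact Subgroup.pointwise_smul_le_pointwise_smul_iff.2 hUK (this ▸ ht)
    · obtain ⟨n, hnS, hn, hnL⟩ := S.2.exists_mem_normalizer_of_lt hLS
      refine ⟨MulAut.conj n • H, MulAut.conj n • T, hHiso.conj_smul n, H.card_conj_smul n,
        Subgroup.pointwise_smul_le_pointwise_smul_iff.2 hTH, ?_, T.card_conj_smul n, fun heq => ?_⟩
      · intro x hx
        rw [Subgroup.mem_conj_smul] at hx
        have := (Subgroup.mem_normalizer_iff.1 hn _).1 (hTL hx)
        simpa [mul_assoc, hL] using this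
      · refine hnL ⟨Subgroup.mem_normalizer_iff.2 fun x => ?_, hnS⟩
        nth_rw 2 [← heq]
        rw [Subgroup.mem_conj_smul]
        simp [mul_assoc]
  have hH₁L : H₁ ⊓ L = T₁ := hinf hH₁ hTH₁ hT₁L hT₁card
  have hlt : T ⊓ T₁ < T := by
    refine lt_of_le_of_ne inf_le_left fun heq => hTT₁ ?_
    exact (Subgroup.eq_of_le_of_card_ge (inf_eq_left.1 heq) hT₁card.le).symm
  have hLN : L ≤ Subgroup.normalizer ((T ⊓ T₁ : Subgroup G) : Set G) := by
    intro l hl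
    have h1 : l ∈ Subgroup.normalizer (T₁ : Set G) :=
      hLp.le_normalizer_of_card hT₁L (hT₁card.symm ▸ hLcard) hl
    have h2 : l ∈ Subgroup.normalizer (T : Set G) := hl.1
    rw [Subgroup.mem_normalizer_iff] at h1 h2 ⊢
    intro x
    rw [Subgroup.mem_inf, Subgroup.mem_inf, h1, h2]
  have hne : T ⊓ T₁ ≠ ⊥ := by
    intro hbot
    have h1 : T.relIndex L ≤ p := by
      have := Subgroup.card_mul_index (T.subgroupOf L)
      rw [Nat.card_congr (Subgroup.subgroupOfEquivOfLe hTL).toEquiv] at this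
      rw [← this, mul_comm] at hLcard
      exact Nat.le_of_mul_le_mul_right hLcard Nat.card_pos
    have h2 : T.relIndex T₁ ≤ p :=
      (Subgroup.relIndex_le_of_le_right hT₁L Subgroup.index_ne_zero_of_finite).trans h1
    rw [← Subgroup.inf_relIndex_right, hbot, Subgroup.relIndex_bot_left, hT₁card] at h2
    nlinarith [hp.two_le]
  obtain ⟨x, hxT, hx, hxL⟩ := hLp.exists_orderOf_eq_mem_commute hne (hlt.le.trans hTL) hLN
  obtain ⟨q, hq, hpq, u, hu, hxu⟩ := hneg' x hxT.1 hx fun t ht => hxL t (hTL ht)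
  have hfin := hHiso.card_le hH₁iso (hTH hxT.1) (hTH₁ hxT.2) hp hq hpq hx hu hxu hxL
  have h1 : H ⊓ H₁ ⊓ L = T ⊓ T₁ := by
    rw [← hHL, ← hH₁L, ← inf_inf_distrib_right]
  rw [h1] at hfin
  have h2 := hTp.mul_card_le_of_lt hlt
  have h3 := hLp.mul_card_le_of_lt hTltL
  nlinarith [hp.two_le, (Nat.card_pos : 0 < Nat.card T)]

end

theorem IsPGroup.mem_zpowers_of_commute {K : Type*} [Group K] [Finite K] {p : ℕ} [Fact p.Prime]
    (hK : (Nat.card K).factorization p = 1) {z w : K} (hz : orderOf z = p) (hw : w ^ p = 1)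
    (hzw : z * w = w * z) : w ∈ Subgroup.zpowers z := by
  have h1 : IsPGroup p (Subgroup.zpowers z) :=
    IsPGroup.of_card (n := 1) (by rw [Nat.card_zpowers, hz, pow_one])
  have h2 : IsPGroup p (Subgroup.zpowers w) := by
    have hdvd : orderOf w ∣ p ^ 1 := by
      rw [pow_one]
      exact orderOf_dvd_of_pow_eq_one hw
    obtain ⟨k, -, hk⟩ := (Nat.dvd_prime_pow Fact.out).1 hdvd
    exact IsPGroup.of_card (n := k) (by rw [Nat.card_zpowers, hk])
  have hnorm : Subgroup.zpowers z ≤ Subgroup.normalizer (Subgroup.zpowers w : Set K) := by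
    rw [Subgroup.zpowers_le]
    refine Subgroup.centralizer_le_normalizer _ (Subgroup.mem_centralizer_iff.2 ?_)
    rintro _ ⟨k, rfl⟩
    exact (Commute.zpow_right hzw k).symm
  have h3 := (h1.to_sup_of_normal_right' h2 hnorm).card_le_of_le le_top
  rw [Nat.card_congr Subgroup.topEquiv.toEquiv, hK, pow_one] at h3
  have h4 : Subgroup.zpowers z = Subgroup.zpowers z ⊔ Subgroup.zpowers w :=
    Subgroup.eq_of_le_of_card_ge le_sup_left (by rwa [Nat.card_zpowers, hz])
  rw [h4]
  exact le_sup_right (a := Subgroup.zpowers z) (Subgroup.mem_zpowers w)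

theorem Nat.card_le_mul_ncard_dvd_orderOf {K : Type*} [Group K] [Finite K] {p : ℕ} [Fact p.Prime]
    (hK : (Nat.card K).factorization p = 1) :
    Nat.card K ≤ p * {x : K | p ∣ orderOf x}.ncard := by
  classical
  have hp : p.Prime := Fact.out
  have : Fintype K := Fintype.ofFinite K
  set n := Nat.card K / p with hn
  have hpK : p ∣ Nat.card K := (hp.dvd_iff_one_le_factorization Nat.card_pos.ne').2 hK.ge
  have hpn : Nat.card K = p * n := (Nat.mul_div_cancel' hpK).symm
  have hcop : n.Coprime p := by
    have := Nat.coprime_ordCompl hp (Nat.card_pos (α := K)).ne'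
    rw [hK, pow_one] at this
    exact this.symm
  obtain ⟨f, hfn, hfp⟩ := Nat.chineseRemainder hcop 0 1
  have hnf : n ∣ f := (Nat.modEq_zero_iff_dvd).1 hfn
  have hpow : ∀ u : K, u ^ p = 1 → u ^ f = u := by
    intro u hu
    have h1 : f ≡ 1 [MOD orderOf u] := hfp.of_dvd (orderOf_dvd_of_pow_eq_one hu)
    simpa using (pow_eq_pow_iff_modEq (x := u)).2 h1
  have hpow' : ∀ u : K, (u ^ f) ^ p = 1 := by
    intro u
    obtain ⟨k, rfl⟩ := hnf
    rw [← pow_mul, show n * k * p = p * n * k by ring, pow_mul, ← hpn, pow_card_eq_one', one_pow]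
  obtain ⟨z, hz⟩ := exists_prime_orderOf_dvd_card' p hpK
  have hzp : z ^ p = 1 := hz ▸ pow_orderOf_eq_one z
  set A : Finset K := Finset.univ.filter fun x => x ^ f = z with hA
  set C := Subgroup.centralizer ({z} : Set K) with hC
  have hAC : Nat.card C ≤ A.card * p := by
    have hsub : (C : Set K).toFinset ⊆
        (A ×ˢ ((Subgroup.zpowers z : Set K).toFinset)).image fun y => y.1 * y.2 := by
      intro c hc
      rw [Set.mem_toFinset, SetLike.mem_coe, hC, Subgroup.mem_centralizer_singleton_iff] at hc
      have hcz : z * c ^ f = c ^ f * z := Commute.pow_right (Commute.symm hc) f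
      have hmem := IsPGroup.mem_zpowers_of_commute hK hz (hpow' c) hcz
      refine Finset.mem_image.2 ⟨(c * (z * (c ^ f)⁻¹), c ^ f * z⁻¹), ?_, by group⟩
      rw [Finset.mem_product, hA, Finset.mem_filter, Set.mem_toFinset]
      refine ⟨⟨Finset.mem_univ _, ?_⟩, mul_mem hmem (inv_mem (Subgroup.mem_zpowers z))⟩
      have h1 : Commute c (z * (c ^ f)⁻¹) :=
        Commute.mul_right hc ((Commute.refl c).pow_right f).inv_right
      have h2 : Commute z (c ^ f)⁻¹ := Commute.inv_right hcz
      rw [h1.mul_pow, h2.mul_pow, hpow z hzp, inv_pow, hpow _ (hpow' c), h2.eq, mul_inv_cancel_left]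
    have h1 := (Finset.card_le_card hsub).trans Finset.card_image_le
    rw [Finset.card_product, Set.toFinset_card, Set.toFinset_card, ← Nat.card_eq_fintype_card,
      ← Nat.card_eq_fintype_card] at h1
    have h2 : Nat.card (Subgroup.zpowers z) = p := by rw [Nat.card_zpowers, hz]
    rw [← h2]
    exact h1
  have hKA : Nat.card K * A.card ≤ Nat.card C * {x : K | p ∣ orderOf x}.ncard := by
    have h1 := Finset.card_le_mul_card_image (f := fun y : K × K => y.1 * y.2 * y.1⁻¹)
      (Finset.univ ×ˢ A) (Nat.card C) ?_
    · rw [Finset.card_product, Finset.card_univ, ← Nat.card_eq_fintype_card] at h1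
      refine h1.trans (Nat.mul_le_mul_left _ ?_)
      rw [← Set.ncard_coe_finset]
      refine Set.ncard_le_ncard ?_
      intro w hw
      obtain ⟨⟨k, x⟩, hkx, rfl⟩ := Finset.mem_image.1 (Finset.mem_coe.1 hw)
      have hx : x ^ f = z := (Finset.mem_filter.1 (Finset.mem_product.1 hkx).2).2
      have h2 : orderOf z ∣ orderOf (k * x * k⁻¹) := by
        rw [← hx, ← MulAut.conj_apply, MulEquiv.orderOf_eq]
        exact orderOf_pow_dvd f
      exact hz ▸ h2
    · intro w hw
      obtain ⟨⟨k, x⟩, hkx, rfl⟩ := Finset.mem_image.1 hw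
      have hx : x ^ f = z := (Finset.mem_filter.1 (Finset.mem_product.1 hkx).2).2
      have h2 : Nat.card C = ((C : Set K).toFinset).card := by
        rw [Set.toFinset_card, ← Nat.card_eq_fintype_card]; rfl
      rw [h2]
      refine Finset.card_le_card_of_injOn (fun y => k⁻¹ * y.1) ?_ ?_
      · rintro ⟨k', x'⟩ hy
        rw [Finset.mem_coe, Finset.mem_filter, Finset.mem_product, hA, Finset.mem_filter] at hy
        obtain ⟨⟨-, -, hx'⟩, hy⟩ := hy
        have h3 := congrArg (fun y => k⁻¹ * y ^ f * k') hy
        simp only [conj_pow] at h3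
        simp only at hx'
        rw [hx, hx'] at h3
        simp only [Set.coe_toFinset, SetLike.mem_coe, hC, Subgroup.mem_centralizer_singleton_iff]
        simpa [mul_assoc] using h3
      · rintro ⟨k', x'⟩ hy ⟨k'', x''⟩ hy'' heq
        rw [Finset.mem_coe, Finset.mem_filter] at hy hy''
        have h3 : k' = k'' := by simpa using heq
        subst h3
        have h4 := hy.2.trans hy''.2.symm
        simp only at h4
        rw [mul_left_inj, mul_right_inj] at h4
        rw [h4]
  have hApos : 0 < A.card := Finset.card_pos.2 ⟨z, by simp [hA, hpow z hzp]⟩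
  by_contra! hlt
  have hC0 : 0 < Nat.card C := Nat.card_pos
  have h1 : Nat.card C * ({x : K | p ∣ orderOf x}.ncard * p) < Nat.card C * Nat.card K :=
    Nat.mul_lt_mul_of_pos_left (by rwa [mul_comm]) hC0
  have h2 := Nat.mul_le_mul_right p hKA
  have h3 := Nat.mul_le_mul_left (Nat.card K) hAC
  nlinarith

section

variable {G : Type*} [Group G] [Finite G]

theorem Subgroup.IsIsolated.dvd_sub_one {H : Subgroup G} (hH : H.IsIsolated) {p q : ℕ}
    (hp : p.Prime) (hq : q.Prime) (hpq : p ≠ q) (hHp : (Nat.card H).factorization p = 1)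
    (hHq : (Nat.card H).factorization q = 1) (hpd : p ∣ H.index) {a b : G} (ha : a ∈ H)
    (hap : orderOf a = p) (hbq : orderOf b = q) (hab : a * b = b * a) : p ∣ q - 1 := by
  have : Fact p.Prime := ⟨hp⟩
  have : Fact q.Prime := ⟨hq⟩
  have ha1 : a ≠ 1 := by
    rintro rfl
    exact hp.one_lt.ne (by simpa using hap)
  have hap' : a ^ p = 1 := hap ▸ pow_orderOf_eq_one a
  set A := zpowers a with hA
  have hAcard : Nat.card A = p := by rw [Nat.card_zpowers, hap]
  have hAp : IsPGroup p A := IsPGroup.of_card (n := 1) (by rw [hAcard, pow_one])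
  have hAH : A ≤ H := (zpowers_le).2 ha
  set C := centralizer ({a} : Set G) with hC
  have hmemC : ∀ z, z ∈ C ↔ z * a = a * z := fun z => by
    rw [hC, mem_centralizer_singleton_iff]
  obtain ⟨v, hvC, hvH⟩ : ∃ v ∈ C, v ∉ H := by
    obtain ⟨S, hAS⟩ := hAp.exists_le_sylow
    have hlt : A < S := by
      refine lt_of_le_of_ne hAS fun heq => ?_
      have h1 := S.card_eq_multiplicity
      rw [← H.card_mul_index, Nat.factorization_mul Nat.card_pos.ne' H.index_ne_zero_of_finite,
        Finsupp.add_apply, hHp] at h1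
      have h2 : Nat.card A = Nat.card S := by rw [heq]
      rw [← h2, hAcard] at h1
      have h3 := Nat.pow_right_injective hp.two_le ((pow_one p).trans h1)
      have h4 := (hp.dvd_iff_one_le_factorization H.index_ne_zero_of_finite).1 hpd
      omega
    obtain ⟨n, hnS, hn, hnA⟩ := S.2.exists_mem_normalizer_of_lt hlt
    set L := normalizer (A : Set G) ⊓ (S : Subgroup G) with hL
    have hLp : IsPGroup p L := S.2.to_le inf_le_right
    obtain ⟨x, hxA, hx, hxL⟩ := hLp.exists_orderOf_eq_mem_commute
      (by rw [hA, Ne, zpowers_eq_bot]; exact ha1) (le_inf le_normalizer hAS) inf_le_left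
    have hxA' : zpowers x = A :=
      eq_of_le_of_card_ge ((zpowers_le).2 hxA) (by rw [hAcard, Nat.card_zpowers, hx])
    have hax : a ∈ zpowers x := hxA' ▸ mem_zpowers a
    obtain ⟨k, rfl⟩ := hax
    refine ⟨n, (hmemC n).2 (Commute.zpow_right (hxL n ⟨hn, hnS⟩) k), fun hnH => hnA ?_⟩
    have h5 : A = H ⊓ (S : Subgroup G) := by
      refine eq_of_le_of_card_ge (le_inf hAH hAS) ?_
      refine ((S.2.to_le inf_le_right).card_le_of_le (inf_le_left : H ⊓ (S : Subgroup G) ≤ H)).trans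
        ?_
      rw [hHp, pow_one, hAcard]
    rw [h5]
    exact ⟨hnH, hnS⟩
  have hcop : ∀ z : G, ∀ n, z ^ p = 1 → z ^ q ^ n = 1 → z = 1 := fun z n h1 h2 => by
    have := Nat.dvd_gcd (orderOf_dvd_of_pow_eq_one h1) (orderOf_dvd_of_pow_eq_one h2)
    rwa [Nat.Coprime.pow_right n ((Nat.coprime_primes hp hq).2 hpq), Nat.dvd_one,
      orderOf_eq_one_iff] at this
  have hqH : ∀ x : C, ∀ n, x ^ q ^ n = 1 → x ∈ H.subgroupOf C := by
    intro x n hx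
    have hx' : (x : G) ^ q ^ n = 1 := by simpa using congrArg Subtype.val hx
    by_contra hxH
    have h1 : (x : G) ∉ H := hxH
    exact h1 (hcop _ n (hH a ha ha1 x h1 ((hmemC _).1 x.2).symm p hap') hx' ▸ H.one_mem)
  obtain ⟨Q⟩ : Nonempty (Sylow q C) := inferInstance
  obtain ⟨k, hk, hkv⟩ := Q.exists_mem_normalizer_inv_mul_mem hqH ⟨v, hvC⟩
  have hkH : (k : G) ∉ H := fun h => hvH ((H.mul_mem_cancel_left (H.inv_mem h)).1 hkv)
  have hkp : (k : G) ^ p = 1 := hH a ha ha1 k hkH ((hmemC _).1 k.2).symm p hap'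
  have hQcard : Nat.card Q = q := by
    have hb : b ∈ C := (hmemC b).2 hab.symm
    have h1 : q ∣ Nat.card C := by
      have : orderOf (⟨b, hb⟩ : C) = q := by rw [orderOf_mk, hbq]
      exact this ▸ _root_.orderOf_dvd_natCard _
    have h2 : q ∣ Nat.card Q := by
      have := Q.pow_dvd_card_of_pow_dvd_card (n := 1) (by rwa [pow_one])
      rwa [pow_one] at this
    refine le_antisymm ?_ (Nat.le_of_dvd Nat.card_pos h2)
    have h3 := (Q.2.map C.subtype).card_le_of_le (H := H) (by
      rintro _ ⟨x, hx, rfl⟩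
      obtain ⟨n, hn⟩ := Q.2 ⟨x, hx⟩
      exact hqH x n (by simpa [Subtype.ext_iff] using hn))
    rw [hHq, pow_one, card_map_of_injective C.subtype_injective] at h3
    exact h3
  have hkN : zpowers k ≤ normalizer (Q : Set C) := (zpowers_le).2 hk
  let _ : MulAction (zpowers k) (Q : Subgroup C) := MulAction.compHom (Q : Subgroup C)
    ((normalizerMonoidHom (Q : Subgroup C)).comp (inclusion hkN))
  have hsmul : ∀ (l : zpowers k) (u : (Q : Subgroup C)),
      ((l • u : (Q : Subgroup C)) : C) = l * u * (l : C)⁻¹ := fun _ _ => rfl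
  have hkpg : IsPGroup p (zpowers k) := by
    have hdvd : orderOf k ∣ p ^ 1 := by
      rw [pow_one]
      exact orderOf_dvd_of_pow_eq_one (Subtype.ext (by simpa using hkp))
    obtain ⟨n, -, hn⟩ := (Nat.dvd_prime_pow hp).1 hdvd
    exact IsPGroup.of_card (n := n) (by rw [Nat.card_zpowers, hn])
  have hmod := hkpg.card_modEq_card_fixedPoints (Q : Subgroup C)
  have hfix : Nat.card (MulAction.fixedPoints (zpowers k) (Q : Subgroup C)) = 1 := by
    rw [Nat.card_eq_one_iff_unique]
    refine ⟨⟨?_⟩, ⟨⟨1, fun l => Subtype.ext (by simp [hsmul])⟩⟩⟩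
    suffices h : ∀ u ∈ MulAction.fixedPoints (zpowers k) (Q : Subgroup C), u = 1 from
      fun u v => Subtype.ext ((h u u.2).trans (h v v.2).symm)
    intro u hu
    obtain ⟨n, hn⟩ := Q.2 u
    have hn' : ((u : C) : G) ^ q ^ n = 1 := by
      simpa using congrArg (fun x : (Q : Subgroup C) => ((x : C) : G)) hn
    have huH : ((u : C) : G) ∈ H := hqH u n (by simpa using congrArg Subtype.val hn)
    have huk : k * u = u * k := by
      have := hu ⟨k, mem_zpowers k⟩
      exact mul_inv_eq_iff_eq_mul.1 (congrArg Subtype.val this)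
    by_contra hu1
    have hu1' : ((u : C) : G) ≠ 1 := fun h => hu1 (Subtype.ext (Subtype.ext h))
    have := hH u huH hu1' k hkH (congrArg Subtype.val huk).symm _ hn'
    exact hkH (hcop _ n hkp this ▸ H.one_mem)
  rw [hfix] at hmod
  have hQ' : Nat.card (Q : Subgroup C) = q := hQcard
  rw [hQ'] at hmod
  exact (Nat.modEq_iff_dvd' hq.one_lt.le).1 hmod.symm

theorem Subgroup.IsIsolated.not_dvd_orderOf_of_dvd {H : Subgroup G} (hH : H.IsIsolated) {p q : ℕ}
    (hp : p.Prime) (hq : q.Prime) (hpq : p ≠ q) (hHp : (Nat.card H).factorization p = 1)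
    (hHq : (Nat.card H).factorization q = 1) (hpd : p ∣ H.index) (hqd : q ∣ H.index) {x : G}
    (hx : x ∈ H) (hpx : p ∣ orderOf x) : ¬ q ∣ orderOf x := by
  intro hqx
  have ha := orderOf_pow_orderOf_div (orderOf_pos x).ne' hpx
  have hb := orderOf_pow_orderOf_div (orderOf_pos x).ne' hqx
  have hab := Commute.pow_pow_self x (orderOf x / p) (orderOf x / q)
  have h1 := hH.dvd_sub_one hp hq hpq hHp hHq hpd (H.pow_mem hx _) ha hb hab
  have h2 := hH.dvd_sub_one hq hp hpq.symm hHq hHp hqd (H.pow_mem hx _) hb ha hab.symm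
  have h3 := Nat.le_of_dvd (Nat.sub_pos_of_lt hq.one_lt) h1
  have h4 := Nat.le_of_dvd (Nat.sub_pos_of_lt hp.one_lt) h2
  have := hp.one_lt
  have := hq.one_lt
  omega

end

section

variable {G : Type*} [Group G] [Finite G]

theorem Subgroup.exists_set_card_le_of_isPGroup_centralizer {H : Subgroup G} {p : ℕ}
    [Fact p.Prime] {t : G} (htH : t ∈ H) (ht : orderOf t = p)
    (hC : IsPGroup p (H ⊓ centralizer {t} : Subgroup G)) :
    ∃ s : Set H, Nat.card H ≤ p ^ (Nat.card H).factorization p * s.ncard ∧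
      ∀ x ∈ s, orderOf x = p := by
  refine ⟨MulAction.orbit (ConjAct H) (⟨t, htH⟩ : H), ?_, ?_⟩
  · rw [← MulAction.index_stabilizer]
    have h1 := (MulAction.stabilizer (ConjAct H) (⟨t, htH⟩ : H)).card_mul_index
    have h2 : Nat.card (ConjAct H) = Nat.card H := rfl
    rw [h2] at h1
    refine h1.ge.trans (Nat.mul_le_mul_right _ ?_)
    rw [← Subgroup.nat_card_centralizer_nat_card_stabilizer]
    rw [← Subgroup.card_map_of_injective H.subtype_injective]
    have hle : (centralizer {(⟨t, htH⟩ : H)}).map H.subtype ≤ H ⊓ centralizer {t} := by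
      rintro _ ⟨x, hx, rfl⟩
      rw [SetLike.mem_coe, mem_centralizer_singleton_iff] at hx
      exact ⟨x.2, mem_centralizer_singleton_iff.2 (congrArg Subtype.val hx)⟩
    exact (hC.to_le hle).card_le_of_le (map_subtype_le _)
  · rintro _ ⟨g, rfl⟩
    rw [← ht, ← Subgroup.orderOf_mk t htH]
    exact orderOf_injective (MulDistribMulAction.toMonoidEnd (ConjAct H) H g)
      (MulAction.injective g) _

namespace IsESPartition

variable {P : Finset (Subgroup G)}

theorem sum_ordCompl_le (h : IsESPartition (⊥ : Subgroup G) P)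
    {H : Subgroup G} (hH : H ∈ P) (hd : ∀ p ∈ (Nat.card H).primeFactors, p ∣ H.index) :
    ∑ p ∈ (Nat.card H).primeFactors, ordCompl[p] (Nat.card H) ≤ Nat.card H := by
  classical
  have hex : ∀ p, ∃ s : Set H, p ∈ (Nat.card H).primeFactors →
      ordCompl[p] (Nat.card H) ≤ s.ncard ∧
      ∀ x ∈ s, p ∣ orderOf x ∧ ((Nat.card H).factorization p = 1 ∨ orderOf x = p) := by
    intro p
    by_cases hpm : p ∈ (Nat.card H).primeFactors
    swap
    · exact ⟨∅, fun h => absurd h hpm⟩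
    have hp : p.Prime := Nat.prime_of_mem_primeFactors hpm
    have : Fact p.Prime := ⟨hp⟩
    have h0 := (hp.dvd_iff_one_le_factorization Nat.card_pos.ne').1
      (Nat.dvd_of_mem_primeFactors hpm)
    rcases h0.eq_or_lt with h1 | h1
    · refine ⟨{x : H | p ∣ orderOf x}, fun _ => ⟨?_, fun x hx => ⟨hx, Or.inl h1.symm⟩⟩⟩
      rw [← h1, pow_one]
      exact Nat.div_le_of_le_mul (Nat.card_le_mul_ncard_dvd_orderOf h1.symm)
    · obtain ⟨t, htH, ht, hC, -⟩ := h.exists_isPGroup_centralizer hH (p := p)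
        ((hp.pow_dvd_iff_le_factorization Nat.card_pos.ne').2 h1) (hd p hpm)
      obtain ⟨s, hs, hso⟩ := Subgroup.exists_set_card_le_of_isPGroup_centralizer htH ht hC
      exact ⟨s, fun _ => ⟨Nat.div_le_of_le_mul hs,
        fun x hx => ⟨(hso x hx).symm.dvd, Or.inr (hso x hx)⟩⟩⟩
  choose s hs using hex
  have hdisj : (((Nat.card H).primeFactors : Finset ℕ) : Set ℕ).PairwiseDisjoint
      fun p => (s p).toFinite.toFinset := by
    intro p hp q hq hpq
    rw [Function.onFun, Finset.disjoint_left]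
    intro x hxp hxq
    rw [Set.Finite.mem_toFinset] at hxp hxq
    have hp' := Nat.prime_of_mem_primeFactors hp
    have hq' := Nat.prime_of_mem_primeFactors hq
    obtain ⟨h1, h2⟩ := (hs p hp).2 x hxp
    obtain ⟨h3, h4⟩ := (hs q hq).2 x hxq
    rcases h2 with h2 | h2
    · rcases h4 with h4 | h4
      · rw [← Subgroup.orderOf_coe] at h1 h3
        exact (h.1.isIsolated hH).not_dvd_orderOf_of_dvd hp' hq' hpq h2 h4 (hd p hp) (hd q hq) x.2
          h1 h3
      · rw [h4] at h1
        exact hpq ((Nat.prime_dvd_prime_iff_eq hp' hq').1 h1)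
    · rw [h2] at h3
      exact hpq ((Nat.prime_dvd_prime_iff_eq hq' hp').1 h3).symm
  have : Fintype H := Fintype.ofFinite H
  calc ∑ p ∈ (Nat.card H).primeFactors, ordCompl[p] (Nat.card H)
      ≤ ∑ p ∈ (Nat.card H).primeFactors, (s p).toFinite.toFinset.card :=
        Finset.sum_le_sum fun p hp => (hs p hp).1.trans (Set.ncard_eq_toFinset_card _).le
    _ = ((Nat.card H).primeFactors.biUnion fun p => (s p).toFinite.toFinset).card :=
        (Finset.card_biUnion hdisj).symm
    _ ≤ Nat.card H := by
        rw [Nat.card_eq_fintype_card]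
        exact Finset.card_le_univ _

end IsESPartition

end

namespace MulAction

variable (Q : Type*) [Group Q] {X : Type*} [MulAction Q X]

theorem dvd_natCard_of_dvd_orbit [Finite X] {n : ℕ} (h : ∀ x : X, n ∣ (orbit Q x).ncard) :
    n ∣ Nat.card X := by
  classical
  have : Fintype X := Fintype.ofFinite X
  have : Fintype (orbitRel.Quotient Q X) := Fintype.ofFinite _
  rw [Nat.card_congr (selfEquivSigmaOrbits Q X), Nat.card_sigma]
  exact Finset.dvd_sum fun ω _ => h ω.out

theorem natCard_modEq_one_of_dvd_orbit [Finite X] {n : ℕ} {x₀ : X} (h₀ : orbit Q x₀ = {x₀})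
    (h : ∀ x : X, x ≠ x₀ → n ∣ (orbit Q x).ncard) : Nat.card X ≡ 1 [MOD n] := by
  classical
  have : Fintype X := Fintype.ofFinite X
  have : Fintype (orbitRel.Quotient Q X) := Fintype.ofFinite _
  rw [Nat.card_congr (selfEquivSigmaOrbits Q X), Nat.card_sigma, ← ZMod.natCast_eq_natCast_iff,
    Nat.cast_sum, Finset.sum_eq_single (Quotient.mk'' x₀ : orbitRel.Quotient Q X)]
  · have hx : (Quotient.mk'' x₀ : orbitRel.Quotient Q X).out ∈ orbit Q x₀ :=
      orbitRel_apply.1 (Quotient.mk_out (s := orbitRel Q X) x₀)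
    rw [orbit_eq_iff.2 hx, h₀]
    simp
  · intro ω _ hω
    rw [ZMod.natCast_eq_zero_iff]
    refine h ω.out fun hx => hω ?_
    rw [← hx]
    exact (Quotient.out_eq' ω).symm
  · simp

theorem ncard_orbit_mul_natCard_stabilizer (x : X) :
    (orbit Q x).ncard * Nat.card (stabilizer Q x) = Nat.card Q := by
  rw [← index_stabilizer, mul_comm, Subgroup.card_mul_index]

variable [Finite X]

theorem sum_natCard_stabilizer_orbit [Fintype X] (x₀ : X) [DecidablePred (· ∈ orbit Q x₀)] :
    ∑ x : X with x ∈ orbit Q x₀, Nat.card (stabilizer Q x) = Nat.card Q := by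
  have hO : (Finset.univ.filter (· ∈ orbit Q x₀)).card = (orbit Q x₀).ncard := by
    rw [← Set.ncard_coe_finset]
    simp
  have hpos : 0 < (orbit Q x₀).ncard :=
    (Set.ncard_pos (Set.toFinite _)).2 ⟨x₀, mem_orbit_self _⟩
  refine Nat.eq_of_mul_eq_mul_left hpos ?_
  rw [Finset.mul_sum, Finset.sum_congr rfl (g := fun _ => Nat.card Q), Finset.sum_const, hO,
    smul_eq_mul]
  intro x hx
  rw [← ncard_orbit_mul_natCard_stabilizer Q x, orbit_eq_iff.2 (Finset.mem_filter.1 hx).2]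

variable [Fintype Q]

theorem natCard_dvd_sum_fixedBy : Nat.card Q ∣ ∑ g : Q, Nat.card (fixedBy X g) := by
  have : Fintype X := Fintype.ofFinite X
  rw [← Nat.card_sigma, Nat.card_congr (sigmaFixedByEquivOrbitsProdGroup Q X), Nat.card_prod]
  exact dvd_mul_left _ _

theorem sum_natCard_fixedBy_eq_sum_natCard_stabilizer [Fintype X] :
    ∑ g : Q, Nat.card (fixedBy X g) = ∑ x : X, Nat.card (stabilizer Q x) := by
  rw [← Nat.card_sigma, ← Nat.card_sigma]
  refine Nat.card_congr ((Equiv.subtypeProdEquivSigmaSubtype _).symm.trans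
    (((Equiv.prodComm Q X).subtypeEquiv fun _ => Iff.rfl).trans
    (Equiv.subtypeProdEquivSigmaSubtype fun (b : X) (a : Q) => a ∈ stabilizer Q b)))

theorem natCard_add_natCard_le (x₀ : X) :
    Nat.card Q + Nat.card X ≤ ∑ g : Q, Nat.card (fixedBy X g) + (orbit Q x₀).ncard := by
  classical
  have : Fintype X := Fintype.ofFinite X
  have hO : (Finset.univ.filter (· ∈ orbit Q x₀)).card = (orbit Q x₀).ncard := by
    rw [← Set.ncard_coe_finset]
    simp
  have h1 : (Finset.univ.filter (· ∉ orbit Q x₀)).card ≤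
      ∑ x : X with x ∉ orbit Q x₀, Nat.card (stabilizer Q x) := by
    rw [Finset.card_eq_sum_ones]
    exact Finset.sum_le_sum fun x _ => Nat.card_pos
  have h2 := Finset.card_filter_add_card_filter_not (s := (Finset.univ : Finset X))
    (· ∈ orbit Q x₀)
  rw [Finset.card_univ, ← Nat.card_eq_fintype_card, hO] at h2
  rw [sum_natCard_fixedBy_eq_sum_natCard_stabilizer,
    ← Finset.sum_filter_add_sum_filter_not _ (· ∈ orbit Q x₀), sum_natCard_stabilizer_orbit]
  omega

theorem stabilizer_eq_bot_of_natCard_add_natCard_eq {x₀ : X}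
    (h : Nat.card Q + Nat.card X = ∑ g : Q, Nat.card (fixedBy X g) + (orbit Q x₀).ncard)
    {y : X} (hy : y ∉ orbit Q x₀) : stabilizer Q y = ⊥ := by
  classical
  have : Fintype X := Fintype.ofFinite X
  have hO : (Finset.univ.filter (· ∈ orbit Q x₀)).card = (orbit Q x₀).ncard := by
    rw [← Set.ncard_coe_finset]
    simp
  have h2 := Finset.card_filter_add_card_filter_not (s := (Finset.univ : Finset X))
    (· ∈ orbit Q x₀)
  rw [Finset.card_univ, ← Nat.card_eq_fintype_card, hO] at h2
  rw [sum_natCard_fixedBy_eq_sum_natCard_stabilizer,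
    ← Finset.sum_filter_add_sum_filter_not _ (· ∈ orbit Q x₀), sum_natCard_stabilizer_orbit] at h
  by_contra hbot
  have h1 : (Finset.univ.filter (· ∉ orbit Q x₀)).card <
      ∑ x : X with x ∉ orbit Q x₀, Nat.card (stabilizer Q x) := by
    rw [Finset.card_eq_sum_ones]
    exact Finset.sum_lt_sum (fun x _ => Nat.card_pos) ⟨y, by simpa using hy,
      Subgroup.one_lt_card_iff_ne_bot _ |>.2 hbot⟩
  omega

end MulAction

namespace IsPGroup

variable {Q : Type*} [Group Q] {X : Type*} [MulAction Q X] {p : ℕ} [Fact p.Prime]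

theorem exists_ncard_orbit_le [Finite X] [Nonempty X] (hQ : IsPGroup p Q) :
    ∃ x : X, (MulAction.orbit Q x).ncard ≤ ordProj[p] (Nat.card X) := by
  have hp : p.Prime := Fact.out
  by_contra! hcon
  have h : p ^ ((Nat.card X).factorization p + 1) ∣ Nat.card X := by
    refine MulAction.dvd_natCard_of_dvd_orbit Q fun x => ?_
    have h1 := hcon x
    obtain ⟨n, hn⟩ := hQ.card_orbit x
    rw [Nat.card_coe_set_eq] at hn
    rw [hn] at h1 ⊢
    exact pow_dvd_pow p ((Nat.pow_lt_pow_iff_right hp.one_lt).1 h1)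
  have := (hp.pow_dvd_iff_le_factorization Nat.card_pos.ne').1 h
  omega

end IsPGroup

theorem Finset.two_mul_card_filter_gt_of_sum_eq {ι : Type*} {s : Finset ι} {o : ι → ℕ}
    {m a b : ℕ} (hm : 2 ≤ m) (hb : 0 < b) (hle : ∀ i ∈ s, m + b ≤ o i * m + 1)
    (hsum : m * ∑ i ∈ s, o i + b = s.card * b + m * (a * b)) (hs : a * b < s.card) :
    b ≡ 1 [MOD m] ∧ s.card < 2 * (s.filter fun i => o i * m + 1 = m + b).card := by
  have hsum' : ∑ i ∈ s, (o i * m + 1) + b = s.card * b + m * (a * b) + s.card := by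
    rw [Finset.sum_add_distrib, ← Finset.sum_mul, Finset.sum_const, smul_eq_mul, mul_one, ← hsum]
    ring
  have hmab : m * (a * b) + m ≤ m * s.card := by nlinarith
  obtain ⟨j, hj, hjm⟩ : ∃ j ∈ s, o j * m + 1 = m + b := by
    by_contra! hne
    have h1 : ∑ i ∈ s, (m + b + 1) ≤ ∑ i ∈ s, (o i * m + 1) :=
      Finset.sum_le_sum fun i hi => lt_of_le_of_ne (hle i hi) (hne i hi).symm
    rw [Finset.sum_const, smul_eq_mul] at h1
    nlinarith
  have hmod : b ≡ 1 [MOD m] := by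
    have h1 : m + b ≡ 0 * m + 1 [MOD m] := by
      rw [← hjm]
      exact Nat.ModEq.add_right 1 ((Nat.modEq_zero_iff_dvd.2 (dvd_mul_left _ _)).trans
        (Nat.modEq_zero_iff_dvd.2 (dvd_mul_left _ _)).symm)
    simpa using h1
  refine ⟨hmod, ?_⟩
  have hbad : ∀ i ∈ s, o i * m + 1 ≠ m + b → 2 * m + b ≤ o i * m + 1 := by
    intro i hi hne
    have h1 : o i * m + 1 + m = m + b + m * (1 + o i - o j) := by
      have h2 : o j < o i := by
        have := lt_of_le_of_ne (hle i hi) hne.symm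
        rw [← hjm] at this
        exact lt_of_mul_lt_mul_right (Nat.lt_of_add_lt_add_right this) (Nat.zero_le m)
      obtain ⟨c, hc⟩ := Nat.exists_eq_add_of_lt h2
      rw [hc, show 1 + (o j + c + 1) - o j = c + 2 by omega, ← hjm]
      ring
    have h2 : o j < o i := by
      have := lt_of_le_of_ne (hle i hi) hne.symm
      rw [← hjm] at this
      exact lt_of_mul_lt_mul_right (Nat.lt_of_add_lt_add_right this) (Nat.zero_le m)
    nlinarith
  have h1 := Finset.sum_filter_add_sum_filter_not s (fun i => o i * m + 1 = m + b)
    (fun i => o i * m + 1)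
  have h2 : (s.filter fun i => o i * m + 1 = m + b).card * (m + b) ≤
      ∑ i ∈ s with o i * m + 1 = m + b, (o i * m + 1) := by
    rw [← smul_eq_mul, ← Finset.sum_const]
    exact Finset.sum_le_sum fun i hi => (Finset.mem_filter.1 hi).2.ge
  have h3 : (s.filter fun i => ¬ o i * m + 1 = m + b).card * (2 * m + b) ≤
      ∑ i ∈ s with ¬ o i * m + 1 = m + b, (o i * m + 1) := by
    rw [← smul_eq_mul, ← Finset.sum_const]
    exact Finset.sum_le_sum fun i hi => hbad i (Finset.mem_filter.1 hi).1 (Finset.mem_filter.1 hi).2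
  have h4 := Finset.card_filter_add_card_filter_not (s := s) (fun i => o i * m + 1 = m + b)
  set γ := (s.filter fun i => o i * m + 1 = m + b).card
  set δ := (s.filter fun i => ¬ o i * m + 1 = m + b).card
  rw [← h4] at hsum' hmab ⊢
  by_contra! hcon
  have h5 : γ ≤ δ := by omega
  nlinarith

namespace Subgroup

variable {G : Type*} [Group G] {X : Type*} [MulAction G X]

/-- The points of `X` fixed by some nontrivial element of the subgroup `Q`. -/
def singularPoints (Q : Subgroup G) (X : Type*) [MulAction G X] : Set X :=
  {x | ∃ g ∈ Q, g ≠ 1 ∧ g • x = x}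

variable [Finite X] {Q : Subgroup G}

theorem inv_smul_mem_singularPoints {g : G} {x : X} (hx : Q.singularPoints X = MulAction.orbit Q x)
    (hlt : (Q.singularPoints X).ncard < Nat.card (Q ⊓ MulAut.conj g • Q : Subgroup G)) {y : X}
    (hy : y ∈ Q.singularPoints X) : g⁻¹ • y ∈ Q.singularPoints X := by
  set D := Q ⊓ MulAut.conj g • Q
  have hDQ : D ≤ Q := inf_le_left
  have h1 : MulAction.orbit D y ⊆ Q.singularPoints X := by
    rintro _ ⟨u, rfl⟩
    rw [hx] at hy ⊢
    rw [← MulAction.orbit_eq_iff.2 hy]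
    exact ⟨⟨u, hDQ u.2⟩, rfl⟩
  have h2 := Set.ncard_le_ncard h1 (Set.toFinite _)
  have h4 := MulAction.ncard_orbit_mul_natCard_stabilizer D y
  have h5 : MulAction.stabilizer D y ≠ ⊥ := by
    intro hbot
    rw [hbot, card_bot, mul_one] at h4
    omega
  obtain ⟨⟨u, hu⟩, hu1⟩ := ne_bot_iff_exists_ne_one.1 h5
  have huy : (u : G) • y = y := hu
  refine ⟨g⁻¹ * u * g, mem_conj_smul.1 u.2.2, fun h6 => hu1 ?_, ?_⟩
  · refine Subtype.ext (Subtype.ext ?_)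
    have := congrArg (fun z => g * z * g⁻¹) h6
    simpa [mul_assoc] using this
  · rw [mul_smul, mul_smul, smul_inv_smul, huy]

variable [Fintype Q] {p : ℕ} [Fact p.Prime]

theorem singularPoints_eq_orbit [Nonempty X] (hQ : IsPGroup p Q)
    (hlt : ordProj[p] (Nat.card X) < Nat.card Q)
    (h : ∑ g : Q, Nat.card (MulAction.fixedBy X g) + ordProj[p] (Nat.card X) =
      Nat.card Q + Nat.card X) :
    ∃ x : X, Q.singularPoints X = MulAction.orbit Q x ∧
      (Q.singularPoints X).ncard = ordProj[p] (Nat.card X) := by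
  obtain ⟨x, hx⟩ := hQ.exists_ncard_orbit_le (X := X)
  have h1 := MulAction.natCard_add_natCard_le Q x
  have h2 : (MulAction.orbit Q x).ncard = ordProj[p] (Nat.card X) := by omega
  have h3 : Q.singularPoints X = MulAction.orbit Q x := by
    ext y
    constructor
    · rintro ⟨g, hg, hg1, hgy⟩
      by_contra hy
      have h4 := MulAction.stabilizer_eq_bot_of_natCard_add_natCard_eq Q (x₀ := x)
        (by rw [h2, h]) hy
      have h5 : (⟨g, hg⟩ : Q) ∈ MulAction.stabilizer Q y := hgy
      rw [h4, mem_bot] at h5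
      exact hg1 (congrArg Subtype.val h5)
    · intro hy
      have h4 := MulAction.ncard_orbit_mul_natCard_stabilizer Q y
      rw [MulAction.orbit_eq_iff.2 hy, h2] at h4
      have h5 : MulAction.stabilizer Q y ≠ ⊥ := by
        intro hbot
        rw [hbot, card_bot, mul_one] at h4
        omega
      obtain ⟨⟨g, hg⟩, hg1⟩ := ne_bot_iff_exists_ne_one.1 h5
      exact ⟨g, g.2, fun h6 => hg1 (Subtype.ext (Subtype.ext h6)), hg⟩
  exact ⟨x, h3, h3 ▸ h2⟩

end Subgroup

theorem IsPGroup.zpowers_of_orderOf {G : Type*} [Group G] {p : ℕ} {y : G} (hy : orderOf y = p) :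
    IsPGroup p (Subgroup.zpowers y) :=
  IsPGroup.of_card (n := 1) (by rw [Nat.card_zpowers, hy, pow_one])

namespace MulAction

variable {G : Type*} [Group G] {X : Type*} [MulAction G X] {r : ℕ} [Fact r.Prime]
  {y : G}

theorem natCard_fixedBy_modEq [Finite X] (hy : orderOf y = r) :
    Nat.card X ≡ Nat.card (fixedBy X y) [MOD r] := by
  have h := (IsPGroup.zpowers_of_orderOf hy).card_modEq_card_fixedPoints X
  have h1 : fixedPoints (Subgroup.zpowers y) X = fixedBy X y := by
    ext x
    constructor
    · exact fun hx => hx ⟨y, Subgroup.mem_zpowers y⟩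
    · rintro hx ⟨z, hz⟩
      have h2 : Subgroup.zpowers y ≤ stabilizer G x := (Subgroup.zpowers_le).2 hx
      exact h2 hz
  rwa [h1] at h

theorem exists_mem_smul_eq_of_not_dvd (hy : orderOf y = r) {s : Set X} (hs : y ∈ stabilizer G s)
    (hr : ¬ r ∣ s.ncard) : ∃ x ∈ s, y • x = x := by
  have hz : Subgroup.zpowers y ≤ stabilizer G s := (Subgroup.zpowers_le).2 hs
  let t : SubMulAction (Subgroup.zpowers y) X :=
    { carrier := s
      smul_mem' := fun z x hx => by
        have h1 : (z : G) • s = s := hz z.2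
        rw [← h1]
        exact Set.smul_mem_smul_set hx }
  have h := (IsPGroup.zpowers_of_orderOf hy).nonempty_fixed_point_of_prime_not_dvd_card t hr
  obtain ⟨x, hx⟩ := h
  exact ⟨x, x.2, congrArg Subtype.val (hx ⟨y, Subgroup.mem_zpowers y⟩)⟩

end MulAction

namespace IsESPartition

variable {G : Type*} [Group G] [Finite G] {P : Finset (Subgroup G)}

theorem dvd_index (h : IsESPartition (⊥ : Subgroup G) P) {H : Subgroup G} (hH : H ∈ P) {r : ℕ}
    (hr : r.Prime) (hrG : r ∣ Nat.card G) : r ∣ H.index := by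
  have : Fact r.Prime := ⟨hr⟩
  obtain ⟨y, hy⟩ := exists_prime_orderOf_dvd_card' r hrG
  have hy1 : y ≠ 1 := by
    rintro rfl
    exact hr.one_lt.ne (by simpa using hy)
  by_contra hd
  have h1 : ∀ K ∈ P, 1 ≤ Nat.card (MulAction.fixedBy (G ⧸ K) y) := by
    intro K hK
    rw [Nat.one_le_iff_ne_zero]
    intro h0
    have h2 := MulAction.natCard_fixedBy_modEq (X := G ⧸ K) hy
    rw [h0, Nat.modEq_zero_iff_dvd] at h2
    rw [h.index_eq hH hK] at hd
    exact hd h2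
  have h3 := Finset.sum_le_sum h1
  rw [h.sum_card_fixedBy hH hy1] at h3
  simp only [Finset.sum_const, smul_eq_mul, mul_one] at h3
  exact h3.not_gt (h.index_lt_card hH)

theorem dvd_card (h : IsESPartition (⊥ : Subgroup G) P) {H : Subgroup G} (hH : H ∈ P) {r : ℕ}
    (hr : r.Prime) (hrG : r ∣ Nat.card G) : r ∣ Nat.card H := by
  have : Fact r.Prime := ⟨hr⟩
  obtain ⟨y, hy⟩ := exists_prime_orderOf_dvd_card' r hrG
  obtain ⟨K, hK, hyK⟩ := h.1.2.2.1 y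
  rw [h.2 H hH K hK, ← hy]
  exact Subgroup.orderOf_dvd_natCard K hyK

theorem sum_sum_card_fixedBy (h : IsESPartition (⊥ : Subgroup G) P) {H : Subgroup G} (hH : H ∈ P)
    (Q : Subgroup G) [Fintype Q] :
    ∑ K ∈ P, ∑ g : Q, Nat.card (MulAction.fixedBy (G ⧸ K) g) + H.index =
      P.card * H.index + Nat.card Q * H.index := by
  classical
  have h1 : ∑ K ∈ P, Nat.card (MulAction.fixedBy (G ⧸ K) (1 : Q)) = P.card * H.index := by
    rw [Finset.sum_congr rfl (g := fun _ => H.index), Finset.sum_const, smul_eq_mul]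
    intro K hK
    rw [MulAction.fixedBy_one_eq_univ, Nat.card_congr (Equiv.Set.univ _), h.index_eq hH hK]
    rfl
  have h2 : (Finset.univ.erase (1 : Q)).card + 1 = Nat.card Q := by
    rw [Finset.card_erase_add_one (Finset.mem_univ _), Finset.card_univ, Nat.card_eq_fintype_card]
  have h3 : ∑ g ∈ Finset.univ.erase (1 : Q), ∑ K ∈ P, Nat.card (MulAction.fixedBy (G ⧸ K) g) =
      ∑ g ∈ Finset.univ.erase (1 : Q), H.index :=
    Finset.sum_congr rfl fun g hg => h.sum_card_fixedBy hH (x := (g : G)) (by simpa using hg)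
  rw [Finset.sum_comm, ← Finset.add_sum_erase _ _ (Finset.mem_univ (1 : Q)), h1, h3,
    Finset.sum_const, smul_eq_mul, ← h2]
  ring

end IsESPartition

theorem Sylow.natCard_eq_ordProj_mul_ordProj_index {G : Type*} [Group G] [Finite G]
    {p : ℕ} [Fact p.Prime] (Q : Sylow p G) (H : Subgroup G) :
    Nat.card Q = ordProj[p] (Nat.card H) * ordProj[p] H.index := by
  rw [Q.card_eq_multiplicity, ← H.card_mul_index,
    Nat.factorization_mul Nat.card_pos.ne' H.index_ne_zero_of_finite, Finsupp.add_apply, pow_add]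

namespace IsESPartition

variable {G : Type*} [Group G] [Finite G] {P : Finset (Subgroup G)}

theorem ordCompl_index_modEq_one (h : IsESPartition (⊥ : Subgroup G) P) {H : Subgroup G}
    (hH : H ∈ P) {p : ℕ} [Fact p.Prime] (hpG : p ∣ Nat.card G) (Q : Sylow p G) [Fintype Q] :
    ordCompl[p] H.index ≡ 1 [MOD ordProj[p] (Nat.card H)] ∧
    P.card < 2 * (P.filter fun K => ∑ g : Q, Nat.card (MulAction.fixedBy (G ⧸ K) g) +
      ordProj[p] H.index = Nat.card Q + H.index).card := by
  have hp : p.Prime := Fact.out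
  have hg := Q.natCard_eq_ordProj_mul_ordProj_index H
  have hd := Nat.ordProj_mul_ordCompl_eq_self H.index p
  have hlt := h.index_lt_card hH
  have hsum := h.sum_sum_card_fixedBy hH (Q : Subgroup G)
  have hm : 2 ≤ ordProj[p] (Nat.card H) := by
    have h1 := (hp.dvd_iff_one_le_factorization Nat.card_pos.ne').1 (h.dvd_card hH hp hpG)
    exact hp.two_le.trans (Nat.le_self_pow (by omega) p)
  have ha : 0 < ordProj[p] H.index := Nat.ordProj_pos _ _
  have hb : 0 < ordCompl[p] H.index := Nat.ordCompl_pos _ H.index_ne_zero_of_finite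
  have hle : ∀ K ∈ P, Nat.card Q + H.index ≤
      ∑ g : Q, Nat.card (MulAction.fixedBy (G ⧸ K) g) + ordProj[p] H.index := by
    intro K hK
    obtain ⟨x, hx⟩ := Q.2.exists_ncard_orbit_le (X := G ⧸ K)
    have h1 := MulAction.natCard_add_natCard_le Q x
    have h2 : Nat.card (G ⧸ K) = H.index := h.index_eq hK hH
    rw [h2] at h1 hx
    omega
  choose o ho using fun K : Subgroup G => MulAction.natCard_dvd_sum_fixedBy Q (X := G ⧸ K)
  have hQ : Nat.card (Q : Subgroup G) = Nat.card Q := rfl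
  simp only [ho] at hsum hle ⊢
  rw [hQ] at hsum
  set g := Nat.card Q
  set m := ordProj[p] (Nat.card H)
  set a := ordProj[p] H.index
  set b := ordCompl[p] H.index
  rw [hg, ← hd] at hsum
  simp only [hg, ← hd] at hle ⊢
  have hiff : ∀ K, m * a * o K + a = m * a + a * b ↔ o K * m + 1 = m + b := fun K =>
    ⟨fun h => Nat.eq_of_mul_eq_mul_left ha (by linarith), fun h => by
      have : a * (o K * m + 1) = a * (m + b) := by rw [h]
      linarith⟩
  simp only [hiff]
  refine Finset.two_mul_card_filter_gt_of_sum_eq (a := a) hm hb (fun K hK => ?_) ?_ (hd ▸ hlt)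
  · refine Nat.le_of_mul_le_mul_left ?_ ha
    have := hle K hK
    linarith
  · refine Nat.eq_of_mul_eq_mul_left ha ?_
    rw [← Finset.mul_sum] at hsum
    linarith

theorem ordCompl_card_modEq_one (h : IsESPartition (⊥ : Subgroup G) P) {H : Subgroup G}
    (hH : H ∈ P) {p : ℕ} [Fact p.Prime] (hpG : p ∣ Nat.card G) :
    ordCompl[p] (Nat.card H) ≡ 1 [MOD ordProj[p] (Nat.card H)] := by
  classical
  have hp : p.Prime := Fact.out
  obtain ⟨Q⟩ : Nonempty (Sylow p G) := inferInstance
  have : Fintype Q := Fintype.ofFinite Q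
  obtain ⟨hmod, hgood⟩ := h.ordCompl_index_modEq_one hH hpG Q
  have hg := Q.natCard_eq_ordProj_mul_ordProj_index H
  have hm : 2 ≤ ordProj[p] (Nat.card H) := by
    have h1 := (hp.dvd_iff_one_le_factorization Nat.card_pos.ne').1 (h.dvd_card hH hp hpG)
    exact hp.two_le.trans (Nat.le_self_pow (by omega) p)
  have ha : 0 < ordProj[p] H.index := Nat.ordProj_pos _ _
  have hlt : ordProj[p] H.index < Nat.card Q := by
    rw [hg]
    nlinarith
  set A := P.filter fun K => ∑ g : Q, Nat.card (MulAction.fixedBy (G ⧸ K) g) +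
      ordProj[p] H.index = Nat.card Q + H.index with hA
  have horb : ∀ K ∈ A, ∃ x : G ⧸ K, (Q : Subgroup G).singularPoints (G ⧸ K) = MulAction.orbit Q x ∧
      ((Q : Subgroup G).singularPoints (G ⧸ K)).ncard = ordProj[p] H.index := by
    intro K hK
    obtain ⟨hKP, hK⟩ := Finset.mem_filter.1 hK
    have h2 : Nat.card (G ⧸ K) = H.index := h.index_eq hKP hH
    have h3 := Subgroup.singularPoints_eq_orbit (Q := (Q : Subgroup G)) (X := G ⧸ K) Q.2
      (by rw [h2]; exact hlt) (by rw [h2]; exact hK)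
    rwa [h2] at h3
  set L : Subgroup G := ⨅ K ∈ A, MulAction.stabilizer G ((Q : Subgroup G).singularPoints (G ⧸ K))
    with hL
  have hmemL : ∀ g : G, ordProj[p] H.index < Nat.card (Q ⊓ MulAut.conj g • Q : Subgroup G) →
      g ∈ L := by
    intro g hg
    simp only [hL, Subgroup.mem_iInf]
    intro K hK
    obtain ⟨x, hx, hx'⟩ := horb K hK
    rw [← inv_mem_iff, MulAction.mem_stabilizer_iff]
    refine Set.eq_of_subset_of_ncard_le ?_ (Set.ncard_smul_set _ _).ge (Set.toFinite _)
    rintro _ ⟨y, hy, rfl⟩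
    exact Subgroup.inv_smul_mem_singularPoints hx (hx' ▸ hg) hy
  have hLp : IsPGroup p L := by
    refine IsPGroup.of_forall_prime_orderOf fun r hr y hy hyr => ?_
    by_contra hrp
    have : Fact r.Prime := ⟨hr⟩
    have hy1 : y ≠ 1 := by
      rintro rfl
      exact hr.one_lt.ne (by simpa using hyr)
    have hrG : r ∣ Nat.card G := hyr ▸ _root_.orderOf_dvd_natCard _
    have h1 : ∀ K ∈ A, 2 ≤ Nat.card (MulAction.fixedBy (G ⧸ K) y) := by
      intro K hK
      simp only [hL, Subgroup.mem_iInf] at hy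
      obtain ⟨x, hx, hx'⟩ := horb K hK
      obtain ⟨z, -, hz⟩ := MulAction.exists_mem_smul_eq_of_not_dvd hyr (hy K hK) (by
        rw [hx']
        exact fun hdvd => hrp ((Nat.prime_dvd_prime_iff_eq hr hp).1 (hr.dvd_of_dvd_pow hdvd)))
      have h2 := MulAction.natCard_fixedBy_modEq (X := G ⧸ K) hyr
      have h3 : r ∣ Nat.card (MulAction.fixedBy (G ⧸ K) y) :=
        (Nat.ModEq.dvd_iff h2 dvd_rfl).1 (h.dvd_index (Finset.mem_filter.1 hK).1 hr hrG)
      have : Nonempty (MulAction.fixedBy (G ⧸ K) y) := ⟨⟨z, hz⟩⟩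
      exact hr.two_le.trans (Nat.le_of_dvd Nat.card_pos h3)
    have h2 := Finset.sum_le_sum h1
    have h3 := Finset.sum_le_sum_of_subset (s := A)
      (f := fun K => Nat.card (MulAction.fixedBy (G ⧸ K) y))
      (Finset.filter_subset _ _ : A ⊆ P)
    rw [h.sum_card_fixedBy hH hy1] at h3
    simp only [Finset.sum_const, smul_eq_mul] at h2
    have := h.index_lt_card hH
    omega
  have hQL : (Q : Subgroup G) ≤ L := by
    intro g hg
    refine hmemL g ?_
    rw [Subgroup.conj_smul_eq_self_of_mem hg, inf_idem]
    exact hlt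
  have hLQ : L = Q := Q.3 hLp hQL
  have hmod' : Nat.card (G ⧸ (Q : Subgroup G)) ≡ 1 [MOD ordProj[p] (Nat.card H)] := by
    refine MulAction.natCard_modEq_one_of_dvd_orbit Q (x₀ := ((1 : G) : G ⧸ (Q : Subgroup G)))
      ?_ fun x hx => ?_
    · ext x
      rw [Set.mem_singleton_iff]
      constructor
      · rintro ⟨q, rfl⟩
        exact QuotientGroup.eq.2 (by simp)
      · rintro rfl
        exact MulAction.mem_orbit_self _
    · induction x using QuotientGroup.induction_on with
      | H g =>
      have hgQ : g ∉ (Q : Subgroup G) := fun hgQ => hx (QuotientGroup.eq.2 (by simpa using hgQ))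
      have h1 : Nat.card (Q ⊓ MulAut.conj g • Q : Subgroup G) ≤ ordProj[p] H.index := by
        by_contra! hcon
        exact hgQ (hLQ ▸ hmemL g hcon)
      have h2 : Nat.card (MulAction.stabilizer Q (g : G ⧸ (Q : Subgroup G))) ≤
          Nat.card (Q ⊓ MulAut.conj g • Q : Subgroup G) := by
        rw [← Subgroup.card_map_of_injective (Q : Subgroup G).subtype_injective]
        refine Subgroup.card_le_of_le ?_
        rintro _ ⟨q, hq, rfl⟩
        refine ⟨q.2, Subgroup.mem_conj_smul.2 ?_⟩
        have h3 : ((q * g : G) : G ⧸ (Q : Subgroup G)) = g := hq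
        rw [eq_comm, QuotientGroup.eq] at h3
        rwa [mul_assoc]
      have h3 := MulAction.ncard_orbit_mul_natCard_stabilizer Q (g : G ⧸ (Q : Subgroup G))
      obtain ⟨n, hn⟩ := Q.2.card_orbit (g : G ⧸ (Q : Subgroup G))
      rw [Nat.card_coe_set_eq] at hn
      rw [hn] at h3 ⊢
      refine pow_dvd_pow p ?_
      rw [← Nat.pow_le_pow_iff_right hp.one_lt]
      have h4 : Nat.card (Q : Subgroup G) = Nat.card Q := rfl
      rw [h4, hg] at h3
      refine Nat.le_of_mul_le_mul_right ?_ ha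
      rw [← h3]
      exact Nat.mul_le_mul_left _ (h2.trans h1)
  have hindex :
      Nat.card (G ⧸ (Q : Subgroup G)) = ordCompl[p] (Nat.card H) * ordCompl[p] H.index := by
    refine Nat.eq_of_mul_eq_mul_left (Nat.card_pos : 0 < Nat.card Q) ?_
    calc Nat.card Q * Nat.card (G ⧸ (Q : Subgroup G)) = Nat.card H * H.index :=
          (Subgroup.card_mul_index (Q : Subgroup G)).trans H.card_mul_index.symm
      _ = (ordProj[p] (Nat.card H) * ordCompl[p] (Nat.card H)) *
          (ordProj[p] H.index * ordCompl[p] H.index) := by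
        rw [Nat.ordProj_mul_ordCompl_eq_self, Nat.ordProj_mul_ordCompl_eq_self]
      _ = _ := by
        rw [hg]
        ring
  rw [hindex] at hmod'
  simpa using (Nat.ModEq.mul_left (ordCompl[p] (Nat.card H)) hmod).symm.trans hmod'

end IsESPartition

theorem Nat.sum_ordCompl_modEq_one {m : ℕ}
    (h : ∀ p ∈ m.primeFactors, ordCompl[p] m ≡ 1 [MOD ordProj[p] m]) {p : ℕ}
    (hp : p ∈ m.primeFactors) : ∑ q ∈ m.primeFactors, ordCompl[q] m ≡ 1 [MOD ordProj[p] m] := by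
  rw [← ZMod.natCast_eq_natCast_iff, Nat.cast_sum, Finset.sum_eq_single p]
  · exact (ZMod.natCast_eq_natCast_iff _ _ _).2 (h p hp)
  · intro q hq hqp
    rw [ZMod.natCast_eq_zero_iff]
    have hcop : Nat.Coprime (ordProj[p] m) (ordProj[q] m) :=
      Nat.coprime_pow_primes _ _ (Nat.prime_of_mem_primeFactors hp)
        (Nat.prime_of_mem_primeFactors hq) hqp.symm
    refine hcop.dvd_of_dvd_mul_left ?_
    rw [Nat.ordProj_mul_ordCompl_eq_self]
    exact Nat.ordProj_dvd m p
  · exact fun h => absurd hp h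

theorem Nat.card_primeFactors_le_one_of_sum_ordCompl_le {m : ℕ} (hm : m ≠ 0)
    (h : ∀ p ∈ m.primeFactors, ordCompl[p] m ≡ 1 [MOD ordProj[p] m])
    (hle : ∑ q ∈ m.primeFactors, ordCompl[q] m ≤ m) : m.primeFactors.card ≤ 1 := by
  have hcard : m.primeFactors.card ≤ ∑ q ∈ m.primeFactors, ordCompl[q] m := by
    rw [Finset.card_eq_sum_ones]
    exact Finset.sum_le_sum fun q _ => Nat.ordCompl_pos q hm
  set T := ∑ q ∈ m.primeFactors, ordCompl[q] m with hT
  have hdvd : m ∣ T - 1 := by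
    rw [Nat.dvd_iff_prime_pow_dvd_dvd]
    intro p k hp hpk
    rcases Nat.eq_zero_or_pos k with rfl | hk
    · simp
    have hpm : p ∈ m.primeFactors :=
      Nat.mem_primeFactors.2 ⟨hp, (dvd_pow_self p hk.ne').trans hpk, hm⟩
    have h1 : 1 ≤ T := (Finset.card_pos.2 ⟨p, hpm⟩).trans_le hcard
    have h2 := (Nat.modEq_iff_dvd' h1).1 (Nat.sum_ordCompl_modEq_one h hpm).symm
    exact (pow_dvd_pow p ((hp.pow_dvd_iff_le_factorization hm).1 hpk)).trans h2
  have := Nat.eq_zero_of_dvd_of_lt hdvd (by omega)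
  omega

theorem IsESPartition.isNilpotent_of_bot {G : Type*} [Group G] [Finite G]
    {P : Finset (Subgroup G)} (h : IsESPartition (⊥ : Subgroup G) P) : Group.IsNilpotent G := by
  obtain ⟨H, hH, hHbot⟩ := h.1.exists_ne ⊥
  have hm : Nat.card H ≠ 0 := Nat.card_pos.ne'
  have hdvdG : Nat.card H ∣ Nat.card G := H.card_subgroup_dvd_card
  have hle := h.sum_ordCompl_le hH fun p hp => h.dvd_index hH (Nat.prime_of_mem_primeFactors hp)
    ((Nat.dvd_of_mem_primeFactors hp).trans hdvdG)
  have hcard := Nat.card_primeFactors_le_one_of_sum_ordCompl_le hm (fun p hp => by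
    have : Fact p.Prime := ⟨Nat.prime_of_mem_primeFactors hp⟩
    exact h.ordCompl_card_modEq_one hH ((Nat.dvd_of_mem_primeFactors hp).trans hdvdG)) hle
  obtain ⟨p, hp, hpH⟩ := Nat.exists_prime_and_dvd
    ((Subgroup.one_lt_card_iff_ne_bot H).2 hHbot).ne'
  have : Fact p.Prime := ⟨hp⟩
  have hG : IsPGroup p (⊤ : Subgroup G) := by
    refine IsPGroup.of_forall_prime_orderOf fun q hq u _ hu => ?_
    have hqH := h.dvd_card hH hq (hu ▸ orderOf_dvd_natCard u)
    exact Finset.card_le_one.1 hcard q (Nat.mem_primeFactors.2 ⟨hq, hqH, hm⟩) p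
      (Nat.mem_primeFactors.2 ⟨hp, hpH, hm⟩)
  exact (hG.of_equiv Subgroup.topEquiv).isNilpotent

namespace IsESPartition

variable {G : Type*} [Group G] [Finite G] {S : Subgroup G} {P : Finset (Subgroup G)}

theorem map_quotientMk [S.Normal] [DecidableEq (Subgroup (G ⧸ S))] (h : IsESPartition S P) :
    IsESPartition (⊥ : Subgroup (G ⧸ S)) (P.image (Subgroup.map (QuotientGroup.mk' S))) := by
  have hsurj := QuotientGroup.mk'_surjective S
  have hcomap : ∀ H ∈ P, (H.map (QuotientGroup.mk' S)).comap (QuotientGroup.mk' S) = H := by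
    intro H hH
    rw [Subgroup.comap_map_eq, QuotientGroup.ker_mk', sup_eq_left]
    exact h.1.le hH
  have hindex : ∀ H ∈ P, (H.map (QuotientGroup.mk' S)).index = H.index := fun H hH =>
    H.index_map_eq hsurj (by rw [QuotientGroup.ker_mk']; exact h.1.le hH)
  refine ⟨⟨?_, ?_, ?_, ?_⟩, ?_⟩
  · rw [Finset.card_image_of_injOn]
    · exact h.1.1
    · intro H hH K hK hHK
      rw [← hcomap H hH, ← hcomap K hK]
      exact congrArg _ hHK
  · simp only [Finset.forall_mem_image]
    intro H hH htop
    refine h.1.2.1 H hH ?_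
    rw [← hcomap H hH, htop, Subgroup.comap_top]
  · intro g
    obtain ⟨x, rfl⟩ := hsurj g
    obtain ⟨H, hH, hx⟩ := h.1.2.2.1 x
    exact ⟨_, Finset.mem_image_of_mem _ hH, Subgroup.mem_map_of_mem _ hx⟩
  · simp only [Finset.forall_mem_image]
    intro H hH K hK hne
    rw [eq_bot_iff]
    intro g hg
    obtain ⟨x, rfl⟩ := hsurj g
    have hxH : x ∈ H := hcomap H hH ▸ hg.1
    have hxK : x ∈ K := hcomap K hK ▸ hg.2
    have hxS : x ∈ S := h.1.mem_of_mem_of_mem hH hK (fun e => hne (e ▸ rfl)) hxH hxK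
    exact Subgroup.mem_bot.2 ((QuotientGroup.eq_one_iff x).2 hxS)
  · simp only [Finset.forall_mem_image]
    intro H hH K hK
    have h1 := (H.map (QuotientGroup.mk' S)).card_mul_index
    have h2 := (K.map (QuotientGroup.mk' S)).card_mul_index
    rw [hindex H hH] at h1
    rw [hindex K hK, ← h.index_eq hH hK, ← h1] at h2
    exact (Nat.eq_of_mul_eq_mul_right (Nat.pos_of_ne_zero H.index_ne_zero_of_finite) h2).symm

end IsESPartition

theorem Group.isNilpotent_of_lowerCentralSeries_le_upperCentralSeries {G : Type*} [Group G]
    (i : ℕ) : ∀ n : ℕ, (⊤ : Subgroup G).lowerCentralSeries n ≤ Subgroup.upperCentralSeries G i →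
      Group.IsNilpotent G := by
  induction i with
  | zero =>
    intro n hn
    refine Subgroup.nilpotent_iff_lowerCentralSeries.2 ⟨n, ?_⟩
    rwa [Subgroup.upperCentralSeries_zero, le_bot_iff] at hn
  | succ i ih =>
    intro n hn
    refine ih (n + 1) ?_
    rw [Subgroup.lowerCentralSeries_succ, Subgroup.commutator_le]
    intro x hx y _
    exact Subgroup.mem_upperCentralSeries_succ_iff.1 (hn hx) y

theorem Group.isNilpotent_of_quotient_of_le_upperCentralSeries {G : Type*} [Group G]
    {S : Subgroup G} [S.Normal] [Group.IsNilpotent (G ⧸ S)] {i : ℕ}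
    (hS : S ≤ Subgroup.upperCentralSeries G i) : Group.IsNilpotent G := by
  obtain ⟨n, hn⟩ := Subgroup.nilpotent_iff_lowerCentralSeries.1 ‹Group.IsNilpotent (G ⧸ S)›
  refine Group.isNilpotent_of_lowerCentralSeries_le_upperCentralSeries i n (le_trans ?_ hS)
  have h1 : ((⊤ : Subgroup G).lowerCentralSeries n).map (QuotientGroup.mk' S) ≤
      (⊤ : Subgroup (G ⧸ S)).lowerCentralSeries n :=
    (Subgroup.map_lowerCentralSeries ⊤ (QuotientGroup.mk' S) n).trans_le
      (Subgroup.lowerCentralSeries_mono n le_top)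
  rw [hn, le_bot_iff, Subgroup.map_eq_bot_iff, QuotientGroup.ker_mk'] at h1
  exact h1

namespace Subgroup

variable {G : Type*} [Group G] [Finite G]

theorem eq_of_le_of_index_eq {A B : Subgroup G} (hle : A ≤ B) (h : A.index = B.index) :
    A = B := by
  have h1 := relIndex_mul_index hle
  rw [h] at h1
  exact hle.antisymm (relIndex_eq_one.1
    (Nat.eq_of_mul_eq_mul_right (Nat.pos_of_ne_zero B.index_ne_zero_of_finite) (by omega)))

theorem index_prime_of_isCoatom {M : Subgroup G} [M.Normal] (hM : IsCoatom M) :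
    M.index.Prime := by
  obtain ⟨q, hq, hqM⟩ := Nat.exists_prime_and_dvd (n := M.index) (by
    rw [Ne, index_eq_one]
    exact hM.1)
  have : Fact q.Prime := ⟨hq⟩
  obtain ⟨x, hx⟩ := exists_prime_orderOf_dvd_card' (G := G ⧸ M) q hqM
  have h1 : (zpowers x).comap (QuotientGroup.mk' M) = ⊤ := by
    refine hM.2 _ (lt_of_le_of_ne ?_ fun heq => ?_)
    · intro y hy
      have : QuotientGroup.mk' M y = 1 := (QuotientGroup.eq_one_iff y).2 hy
      rw [mem_comap, this]
      exact one_mem _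
    · obtain ⟨y, rfl⟩ := QuotientGroup.mk'_surjective M x
      have hy : y ∈ M := heq ▸ (mem_zpowers (QuotientGroup.mk' M y))
      rw [QuotientGroup.mk'_apply, (QuotientGroup.eq_one_iff y).2 hy, orderOf_one] at hx
      exact hq.one_lt.ne hx
  have h2 : zpowers x = ⊤ :=
    comap_injective (QuotientGroup.mk'_surjective M) (h1.trans (comap_top _).symm)
  have h3 : Nat.card (zpowers x) = M.index := by rw [h2, card_top]; rfl
  rw [← h3, Nat.card_zpowers, hx]
  exact hq

end Subgroup

theorem Group.exists_isCoatom_index_eq {G : Type*} [Group G] [Finite G] (hG : ¬ IsCyclic G)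
    (hnormal : ∀ M : Subgroup G, IsCoatom M → M.Normal) :
    ∃ M N : Subgroup G, IsCoatom M ∧ IsCoatom N ∧ M ≠ N ∧ M.index = N.index := by
  by_contra! hcon
  let f : G → ℕ := fun g => {M : Subgroup G | IsCoatom M ∧ g ∈ M}.ncard
  obtain ⟨g, hg⟩ := Finite.exists_min f
  refine hG ⟨g, fun x => ?_⟩
  suffices h : Subgroup.zpowers g = ⊤ from
    Subgroup.mem_zpowers_iff.1 (h ▸ Subgroup.mem_top x)
  rcases eq_top_or_exists_le_coatom (Subgroup.zpowers g) with htop | ⟨M, hM, hgM⟩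
  · exact htop
  exfalso
  rw [Subgroup.zpowers_le] at hgM
  have := hnormal M hM
  have hp := Subgroup.index_prime_of_isCoatom hM
  obtain ⟨x, hx⟩ : ∃ x, x ∉ M := by
    by_contra! h
    exact hM.1 ((Subgroup.eq_top_iff' M).2 h)
  set n := ordCompl[M.index] (Nat.card G) with hn
  have hxn : x ^ n ∉ M := by
    intro h1
    have h2 := M.pow_index_mem x
    have h3 : M.index.Coprime n := Nat.coprime_ordCompl hp Nat.card_pos.ne'
    have h4 : (x : G ⧸ M) ^ n = 1 := (QuotientGroup.eq_one_iff (x ^ n)).2 h1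
    have h5 : (x : G ⧸ M) ^ M.index = 1 := (QuotientGroup.eq_one_iff (x ^ M.index)).2 h2
    have h6 := Nat.dvd_gcd (orderOf_dvd_of_pow_eq_one h5) (orderOf_dvd_of_pow_eq_one h4)
    rw [h3, Nat.dvd_one, orderOf_eq_one_iff] at h6
    exact hx ((QuotientGroup.eq_one_iff x).1 h6)
  refine (hg (g * x ^ n)).not_gt (Set.ncard_lt_ncard ?_ (Set.toFinite _))
  rw [Set.ssubset_iff_exists]
  refine ⟨?_, M, ⟨hM, hgM⟩, fun h => hxn ((M.mul_mem_cancel_left hgM).1 h.2)⟩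
  rintro N ⟨hN, hgN⟩
  have := hnormal N hN
  have hq := Subgroup.index_prime_of_isCoatom hN
  have hNM : M ≠ N := by
    rintro rfl
    exact hxn ((M.mul_mem_cancel_left hgM).1 hgN)
  have hqn : N.index ∣ n := by
    have h1 : N.index ∣ ordProj[M.index] (Nat.card G) * n := by
      rw [Nat.ordProj_mul_ordCompl_eq_self]
      exact N.index_dvd_card
    refine Nat.Coprime.dvd_of_dvd_mul_left (Nat.Coprime.pow_right _ ?_) h1
    exact (Nat.coprime_primes hq hp).2 (hcon M N hM hN hNM).symm
  obtain ⟨c, hc⟩ := hqn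
  refine ⟨hN, (N.mul_mem_cancel_right ?_).1 hgN⟩
  rw [hc, pow_mul]
  exact N.pow_mem (N.pow_index_mem x) c

theorem Subgroup.exists_isESPartition_of_index_prime {G : Type*} [Group G] [Finite G]
    {M N : Subgroup G} [M.Normal] [N.Normal] (hM : IsCoatom M) (hp : M.index.Prime) (hMN : M ≠ N)
    (hN : N.index = M.index) : ∃ P : Finset (Subgroup G), IsESPartition (M ⊓ N) P := by
  classical
  have : Fintype (Subgroup G) := Fintype.ofFinite _
  set p := M.index with hpdef
  have hpos : 0 < p := hp.pos
  have hNM : ¬ N ≤ M := fun hle => hMN (eq_of_le_of_index_eq hle hN).symm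
  have hindex : (M ⊓ N).index = p * p := by
    rw [← relIndex_mul_index (inf_le_right : M ⊓ N ≤ N), inf_relIndex_right, hN,
      ← relIndex_sup_right]
    rw [hM.2 _ (right_lt_sup.2 hNM), relIndex_top_right]
  have hsplit : ∀ K : Subgroup G, M ⊓ N ≤ K → K.index ∣ p * p := fun K hK =>
    hindex ▸ index_dvd_of_le hK
  refine ⟨Finset.univ.filter fun H => M ⊓ N ≤ H ∧ H.index = p, ⟨?_, ?_, ?_, ?_⟩, ?_⟩
  · refine Finset.one_lt_card.2 ⟨M, ?_, N, ?_, hMN⟩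
    · simp [hpdef]
    · simp [hN]
  · intro H hH htop
    rw [Finset.mem_filter] at hH
    rw [htop, index_top] at hH
    exact hp.one_lt.ne hH.2.2
  · intro x
    by_cases hx : x ∈ M ⊓ N
    · exact ⟨M, by simp [hpdef], hx.1⟩
    refine ⟨(zpowers (x : G ⧸ M ⊓ N)).comap (QuotientGroup.mk' _), ?_, mem_zpowers _⟩
    rw [Finset.mem_filter]
    refine ⟨Finset.mem_univ _, ?_, ?_⟩
    · intro y hy
      rw [mem_comap, QuotientGroup.mk'_apply, (QuotientGroup.eq_one_iff y).2 hy]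
      exact one_mem _
    · rw [index_comap_of_surjective _ (QuotientGroup.mk'_surjective _)]
      have h1 : orderOf (x : G ⧸ M ⊓ N) = p := by
        have : Fact p.Prime := ⟨hp⟩
        refine orderOf_eq_prime ?_ fun h => hx ((QuotientGroup.eq_one_iff x).1 h)
        exact (QuotientGroup.eq_one_iff (x ^ p)).2 ⟨M.pow_index_mem x, hN ▸ N.pow_index_mem x⟩
      have h2 := (zpowers (x : G ⧸ M ⊓ N)).card_mul_index
      rw [Nat.card_zpowers, h1] at h2
      exact Nat.eq_of_mul_eq_mul_left hpos (h2.trans hindex)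
  · intro H hH K hK hHK
    obtain ⟨-, hH, hHp⟩ := Finset.mem_filter.1 hH
    obtain ⟨-, hK, hKp⟩ := Finset.mem_filter.1 hK
    refine (eq_of_le_of_index_eq (le_inf hH hK) ?_).symm
    rw [hindex]
    have h1 := relIndex_mul_index (inf_le_left : H ⊓ K ≤ H)
    have h2 := hsplit (H ⊓ K) (le_inf hH hK)
    rw [← h1, hHp] at h2 ⊢
    have h3 := Nat.dvd_of_mul_dvd_mul_right hpos h2
    rcases (Nat.dvd_prime hp).1 h3 with h4 | h4
    · rw [relIndex_eq_one] at h4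
      exact absurd (eq_of_le_of_index_eq (h4.trans inf_le_right) (hHp.trans hKp.symm)) hHK
    · rw [h4]
  · intro H hH K hK
    rw [Finset.mem_filter] at hH hK
    have h1 := H.card_mul_index
    have h2 := K.card_mul_index
    rw [hH.2.2] at h1
    rw [hK.2.2, ← h1] at h2
    exact (Nat.eq_of_mul_eq_mul_right hpos h2).symm

theorem Group.IsNilpotent.exists_isESPartition {G : Type*} [Group G] [Finite G]
    [Group.IsNilpotent G] (hG : ¬ IsCyclic G) :
    ∃ (S : Subgroup G) (P : Finset (Subgroup G)), S.Normal ∧ IsESPartition S P := by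
  have hnormal : ∀ M : Subgroup G, IsCoatom M → M.Normal := fun M hM =>
    Subgroup.NormalizerCondition.normal_of_coatom _ Group.normalizerCondition_of_isNilpotent hM
  obtain ⟨M, N, hM, hN, hMN, hindex⟩ := Group.exists_isCoatom_index_eq hG hnormal
  have := hnormal M hM
  have := hnormal N hN
  obtain ⟨P, hP⟩ := Subgroup.exists_isESPartition_of_index_prime hM
    (Subgroup.index_prime_of_isCoatom hM) hMN hindex.symm
  exact ⟨M ⊓ N, P, inferInstance, hP⟩

theorem Group.isNilpotent_iff_forall_sylow_normal {G : Type*} [Group G] [Finite G] :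
    Group.IsNilpotent G ↔
      ∀ (p : ℕ) (_ : Fact p.Prime) (P : Sylow p G), (P : Subgroup G).Normal :=
  Group.isNilpotent_of_finite_tfae.out 0 3

theorem Sylow.le_normalizer_of_isNilpotent {G : Type*} [Group G] [Finite G] {p : ℕ}
    [Fact p.Prime] (Q : Sylow p G) {H : Subgroup G} [Group.IsNilpotent H]
    (hQ : (Q : Subgroup G) ≤ H) : H ≤ Subgroup.normalizer (Q : Set G) := by
  have h1 := Group.isNilpotent_iff_forall_sylow_normal.1 ‹Group.IsNilpotent H› p ‹_› (Q.subtype hQ)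
  exact (Subgroup.normal_subgroupOf_iff_le_normalizer hQ).1 h1

theorem Subgroup.exists_sylow_le_of_not_dvd_index {G : Type*} [Group G] [Finite G] {p : ℕ}
    [Fact p.Prime] {H : Subgroup G} (hp : ¬ p ∣ H.index) :
    ∃ Q : Sylow p G, (Q : Subgroup G) ≤ H := by
  obtain ⟨T, hTH, -, hT⟩ := H.exists_isPGroup_le_card p
  refine ⟨Sylow.ofCard T ?_, hTH⟩
  rw [hT, ← H.card_mul_index, Nat.factorization_mul Nat.card_pos.ne' H.index_ne_zero_of_finite,
    Finsupp.add_apply, Nat.factorization_eq_zero_of_not_dvd hp, add_zero]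

theorem Group.IsNilpotent.commute_of_isPGroup {G : Type*} [Group G] [Finite G]
    [Group.IsNilpotent G] {p q : ℕ} [Fact p.Prime] [Fact q.Prime] (hpq : p ≠ q)
    {A B : Subgroup G} (hA : IsPGroup p A) (hB : IsPGroup q B) {x y : G} (hx : x ∈ A)
    (hy : y ∈ B) : Commute x y := by
  have h := Group.isNilpotent_iff_forall_sylow_normal.1 ‹Group.IsNilpotent G›
  obtain ⟨A', hA'⟩ := hA.exists_le_sylow
  obtain ⟨B', hB'⟩ := hB.exists_le_sylow
  exact Subgroup.commute_of_normal_of_disjoint _ _ (h p ‹_› A') (h q ‹_› B')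
    (IsPGroup.disjoint_of_ne p q hpq _ _ A'.2 B'.2) x y (hA' hx) (hB' hy)

/-- If `p` does not divide the index of a component, then the components share a Sylow
`p`-subgroup, since there are more components than Sylow `p`-subgroups. -/
theorem IsESPartition.sylow_normal {G : Type*} [Group G] [Finite G] {S : Subgroup G}
    {P : Finset (Subgroup G)} (h : IsESPartition S P)
    (hnil : ∀ H ∈ P, Group.IsNilpotent H) {H : Subgroup G} (hH : H ∈ P) {p : ℕ} [Fact p.Prime]
    (hp : ¬ p ∣ H.index) (Q : Sylow p G) : (Q : Subgroup G).Normal := by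
  classical
  have : Fintype (Sylow p G) := Fintype.ofFinite _
  have hex : ∀ K : Subgroup G, ∃ R : Sylow p G, K ∈ P → (R : Subgroup G) ≤ K := fun K => by
    by_cases hK : K ∈ P
    · rw [h.index_eq hH hK] at hp
      obtain ⟨R, hR⟩ := K.exists_sylow_le_of_not_dvd_index hp
      exact ⟨R, fun _ => hR⟩
    · exact ⟨Q, fun h => absurd h hK⟩
  choose f hf using hex
  have hcard : (Finset.univ : Finset (Sylow p G)).card < P.card := by
    refine lt_of_le_of_lt ?_ (h.index_lt_card hH)
    rw [Finset.card_univ, ← Nat.card_eq_fintype_card, (f H).card_eq_index_normalizer]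
    have := hnil H hH
    exact Nat.le_of_dvd (Nat.pos_of_ne_zero H.index_ne_zero_of_finite)
      (Subgroup.index_dvd_of_le ((f H).le_normalizer_of_isNilpotent (hf H hH)))
  obtain ⟨K, hK, L, hL, hKL, heq⟩ := Finset.exists_ne_map_eq_of_card_lt_of_maps_to hcard
    (f := f) fun _ _ => Finset.mem_univ _
  have hS : (f K : Subgroup G) ≤ S := by
    rw [← h.1.2.2.2 K hK L hL hKL]
    exact le_inf (hf K hK) (heq ▸ hf L hL)
  have hnormal : ((f K : Sylow p G) : Subgroup G).Normal := by
    rw [← Subgroup.normalizer_eq_top_iff, Subgroup.eq_top_iff']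
    intro x
    obtain ⟨M, hM, hx⟩ := h.1.2.2.1 x
    have := hnil M hM
    exact (f K).le_normalizer_of_isNilpotent (hS.trans (h.1.le hM)) hx
  have := (f K).unique_of_normal hnormal
  rwa [Subsingleton.elim Q (f K)]

theorem MulAction.sum_natCard_fixedBy_quotient {G : Type*} [Group G] [Fintype G]
    (M : Subgroup G) : ∑ x : G, Nat.card (fixedBy (G ⧸ M) x) = Nat.card G := by
  classical
  have : Fintype (G ⧸ M) := Fintype.ofFinite _
  have : Unique (Quotient (orbitRel G (G ⧸ M))) :=
    @Unique.mk' _ ⟨⟦(1 : G)⟧⟩ (pretransitive_iff_subsingleton_quotient G (G ⧸ M) |>.1 inferInstance)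
  rw [← Nat.card_sigma, Nat.card_congr (sigmaFixedByEquivOrbitsProdGroup G (G ⧸ M)), Nat.card_prod,
    Nat.card_unique, one_mul]

theorem MulAction.sum_erase_natCard_fixedBy_quotient {G : Type*} [Group G] [Fintype G]
    [DecidableEq G] (M : Subgroup G) :
    M.index + ∑ x ∈ Finset.univ.erase (1 : G), Nat.card (fixedBy (G ⧸ M) x) = Nat.card G := by
  rw [← sum_natCard_fixedBy_quotient M, ← Finset.add_sum_erase _ _ (Finset.mem_univ (1 : G)),
    fixedBy_one_eq_univ, Nat.card_congr (Equiv.Set.univ _), Subgroup.index]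

namespace Subgroup

variable {G : Type*} [Group G]

theorem mk_mem_fixedBy_iff {M : Subgroup G} {x g : G} :
    (g : G ⧸ M) ∈ MulAction.fixedBy (G ⧸ M) x ↔ x ∈ MulAut.conj g • M := by
  rw [mem_conj_smul, MulAction.mem_fixedBy, MulAction.Quotient.smul_coe, eq_comm, QuotientGroup.eq,
    smul_eq_mul, mul_assoc]

theorem isCoatom_conj_smul {M : Subgroup G} (hM : IsCoatom M) (g : G) :
    IsCoatom (MulAut.conj g • M) :=
  ((MulAut.conj g).mapSubgroup.isCoatom_iff M).2 hM

variable [Finite G] [IsSimpleGroup G]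

theorem eq_of_isCoatom_of_inf_ne_bot (hnil : ∀ H : Subgroup G, H ≠ ⊤ → Group.IsNilpotent H)
    {M₁ M₂ : Subgroup G} (h₁ : IsCoatom M₁) (h₂ : IsCoatom M₂) (h : M₁ ⊓ M₂ ≠ ⊥) : M₁ = M₂ := by
  induction hD : M₁ ⊓ M₂ using WellFoundedGT.induction generalizing M₁ M₂ with
  | ind D ih =>
    subst hD
    by_contra hne
    have hlt : ∀ {M M' : Subgroup G}, IsCoatom M → IsCoatom M' → M ≠ M' → M ⊓ M' < M :=
      fun hM hM' hne =>
        inf_lt_left.2 fun hle => hne ((hM.le_iff.1 hle).resolve_left hM'.1).symm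
    have hN : normalizer ((M₁ ⊓ M₂ : Subgroup G) : Set G) ≠ ⊤ := by
      rw [Ne, normalizer_eq_top_iff]
      intro hnormal
      rcases hnormal.eq_bot_or_eq_top with h' | h'
      · exact h h'
      · exact h₁.1 (eq_top_iff.2 (h' ▸ inf_le_left))
    obtain ⟨M₃, h₃, hNM⟩ := (eq_top_or_exists_le_coatom _).resolve_left hN
    have key : ∀ M, IsCoatom M → M₁ ⊓ M₂ < M → M = M₃ := fun M hM hDM => by
      have := hnil M hM.1
      obtain ⟨n, hnM, hn, hnD⟩ := exists_mem_normalizer_of_lt hDM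
      have hlt' : M₁ ⊓ M₂ < M ⊓ M₃ :=
        lt_of_le_of_ne (le_inf hDM.le (le_normalizer.trans hNM)) fun heq =>
          hnD (heq ▸ mem_inf.2 ⟨hnM, hNM hn⟩)
      exact ih _ hlt' hM h₃ (ne_bot_of_gt hlt') rfl
    exact hne ((key M₁ h₁ (hlt h₁ h₂ hne)).trans
      (key M₂ h₂ (inf_comm M₁ M₂ ▸ hlt h₂ h₁ (Ne.symm hne))).symm)

theorem exists_isCoatom_normal_of_isSimpleGroup
    (hnil : ∀ H : Subgroup G, H ≠ ⊤ → Group.IsNilpotent H) :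
    ∃ M : Subgroup G, IsCoatom M ∧ M.Normal := by
  classical
  by_contra! hcon
  have : Fintype G := Fintype.ofFinite G
  have hself : ∀ M : Subgroup G, IsCoatom M → normalizer (M : Set G) = M := fun M hM =>
    (hM.le_iff.1 le_normalizer).resolve_left fun h => hcon M hM (normalizer_eq_top_iff.1 h)
  have hTI : ∀ M M' : Subgroup G, IsCoatom M → IsCoatom M' → ∀ x : G, x ≠ 1 →
      ∀ a b : G, (a : G ⧸ M) ∈ MulAction.fixedBy (G ⧸ M) x →
      (b : G ⧸ M') ∈ MulAction.fixedBy (G ⧸ M') x →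
      MulAut.conj a • M = MulAut.conj b • M' := fun M M' hM hM' x hx a b ha hb =>
    eq_of_isCoatom_of_inf_ne_bot hnil (isCoatom_conj_smul hM a) (isCoatom_conj_smul hM' b)
      fun h => hx (mem_bot.1 (h ▸ mem_inf.2 ⟨mk_mem_fixedBy_iff.1 ha, mk_mem_fixedBy_iff.1 hb⟩))
  have hle : ∀ M : Subgroup G, IsCoatom M → ∀ x : G, x ≠ 1 →
      Nat.card (MulAction.fixedBy (G ⧸ M) x) ≤ 1 := fun M hM x hx => by
    rw [Finite.card_le_one_iff_subsingleton]
    refine ⟨?_⟩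
    rintro ⟨⟨a⟩, ha⟩ ⟨⟨b⟩, hb⟩
    refine Subtype.ext (QuotientGroup.eq.2 ?_)
    have h1 := hTI M M hM hM x hx a b ha hb
    rw [← hself M hM, mem_normalizer_iff]
    intro y
    have h2 : b * y * b⁻¹ ∈ MulAut.conj b • M ↔ y ∈ M := by
      rw [mem_conj_smul]
      simp [mul_assoc]
    rw [← h2, ← h1, mem_conj_smul]
    simp [mul_assoc]
  have hindex : ∀ M : Subgroup G, IsCoatom M → 2 * M.index ≤ Nat.card G := fun M hM => by
    rw [← M.card_mul_index]
    refine Nat.mul_le_mul_right _ ((one_lt_card_iff_ne_bot M).2 ?_)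
    rintro rfl
    exact hcon _ hM inferInstance
  have hcard : (Finset.univ.erase (1 : G)).card + 1 = Nat.card G := by
    rw [Finset.card_erase_add_one (Finset.mem_univ _), Finset.card_univ, Nat.card_eq_fintype_card]
  obtain ⟨M, hM, -⟩ := (eq_top_or_exists_le_coatom (⊥ : Subgroup G)).resolve_left bot_ne_top
  have hsum := MulAction.sum_erase_natCard_fixedBy_quotient M
  obtain ⟨x, hx1, hx⟩ : ∃ x : G, x ≠ 1 ∧ Nat.card (MulAction.fixedBy (G ⧸ M) x) = 0 := by
    by_contra! h
    have h1 := Finset.card_nsmul_le_sum (Finset.univ.erase (1 : G))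
      (fun x => Nat.card (MulAction.fixedBy (G ⧸ M) x)) 1 fun x hx =>
        Nat.pos_of_ne_zero (h x (Finset.ne_of_mem_erase hx))
    have h2 := M.one_lt_index_of_ne_top hM.1
    rw [smul_eq_mul, mul_one] at h1
    omega
  have hxtop : zpowers x ≠ ⊤ := fun h => hcon M hM ⟨fun n hn g => by
    obtain ⟨i, rfl⟩ := mem_zpowers_iff.1 (h ▸ mem_top n)
    obtain ⟨j, rfl⟩ := mem_zpowers_iff.1 (h ▸ mem_top g)
    rwa [(Commute.zpow_zpow_self x j i).eq, mul_inv_cancel_right]⟩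
  obtain ⟨M', hM', hxM'⟩ := (eq_top_or_exists_le_coatom _).resolve_left hxtop
  rw [zpowers_le] at hxM'
  have hsum' := MulAction.sum_erase_natCard_fixedBy_quotient M'
  have h1 : ∑ y ∈ Finset.univ.erase (1 : G), (Nat.card (MulAction.fixedBy (G ⧸ M) y) +
      Nat.card (MulAction.fixedBy (G ⧸ M') y)) ≤ (Finset.univ.erase (1 : G)).card • 1 := by
    refine Finset.sum_le_card_nsmul _ _ _ fun y hy => ?_
    have hy1 := Finset.ne_of_mem_erase hy
    have h2 := hle M hM y hy1
    have h3 := hle M' hM' y hy1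
    by_contra! hlt
    have h4 : 0 < Nat.card (MulAction.fixedBy (G ⧸ M) y) := by omega
    have h5 : 0 < Nat.card (MulAction.fixedBy (G ⧸ M') y) := by omega
    obtain ⟨⟨⟨a⟩, ha⟩⟩ := (Nat.card_pos_iff.1 h4).1
    obtain ⟨⟨⟨b⟩, hb⟩⟩ := (Nat.card_pos_iff.1 h5).1
    have h6 := hTI M M' hM hM' y hy1 a b ha hb
    have h7 : b * x * b⁻¹ ∈ MulAut.conj a • M := by
      rw [h6, mem_conj_smul]
      simpa [mul_assoc] using hxM'
    have h8 : ((b⁻¹ * a : G) : G ⧸ M) ∈ MulAction.fixedBy (G ⧸ M) x := by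
      rw [mk_mem_fixedBy_iff, mem_conj_smul]
      rw [mem_conj_smul] at h7
      simpa [mul_assoc] using h7
    have : Nonempty (MulAction.fixedBy (G ⧸ M) x) := ⟨⟨_, h8⟩⟩
    exact Nat.card_pos.ne' hx
  rw [Finset.sum_add_distrib, smul_eq_mul, mul_one] at h1
  have := hindex M hM
  have := hindex M' hM'
  omega

end Subgroup

theorem Subgroup.exists_isCoatom_normal {G : Type*} [Group G] [Finite G] [Nontrivial G]
    (hnil : ∀ H : Subgroup G, H ≠ ⊤ → Group.IsNilpotent H) :
    ∃ M : Subgroup G, IsCoatom M ∧ M.Normal := by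
  obtain ⟨N, ⟨hN, hNtop⟩, hmax⟩ := (Set.toFinite {N : Subgroup G | N.Normal ∧ N ≠ ⊤}).exists_maximal
    ⟨⊥, inferInstance, bot_ne_top⟩
  have hsurj := QuotientGroup.mk'_surjective N
  have : Nontrivial (G ⧸ N) := QuotientGroup.nontrivial_iff.2 hNtop
  have : IsSimpleGroup (G ⧸ N) := ⟨fun K hK => by
    rw [or_iff_not_imp_right]
    intro hKtop
    have h1 : K.comap (QuotientGroup.mk' N) ≤ N := hmax ⟨inferInstance, fun h => hKtop
      (comap_injective hsurj (h.trans (comap_top _).symm))⟩ (by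
        conv_lhs => rw [← QuotientGroup.ker_mk' N]
        exact ker_le_comap _ _)
    rw [← map_comap_eq_self_of_surjective hsurj K, map_eq_bot_iff, QuotientGroup.ker_mk']
    exact h1⟩
  obtain ⟨M, hM, hnormal⟩ := exists_isCoatom_normal_of_isSimpleGroup (G := G ⧸ N) fun H hH => by
    have := hnil (H.comap (QuotientGroup.mk' N)) fun h =>
      hH (comap_injective hsurj (h.trans (comap_top _).symm))
    exact Group.nilpotent_of_surjective ((QuotientGroup.mk' N).subgroupComap H)
      ((QuotientGroup.mk' N).subgroupComap_surjective_of_surjective H hsurj)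
  exact ⟨M.comap (QuotientGroup.mk' N), isCoatom_comap_of_surjective hsurj hM, inferInstance⟩

/-- A finite group with an `ES`-partition all of whose proper subgroups are nilpotent is
nilpotent. -/
theorem IsESPartition.isNilpotent_of_forall_ne_top {G : Type*} [Group G] [Finite G]
    {S : Subgroup G} {P : Finset (Subgroup G)} (h : IsESPartition S P)
    (hnil : ∀ H : Subgroup G, H ≠ ⊤ → Group.IsNilpotent H) : Group.IsNilpotent G := by
  classical
  obtain ⟨H₀, hH₀, -⟩ := h.1.2.2.1 1
  have : Nontrivial G := by
    by_contra hcon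
    rw [not_nontrivial_iff_subsingleton] at hcon
    exact h.1.2.1 H₀ hH₀ (Subsingleton.elim _ _)
  obtain ⟨N, hN, hnormal⟩ := Subgroup.exists_isCoatom_normal hnil
  have hp := Subgroup.index_prime_of_isCoatom hN
  set p := N.index with hpN
  have : Fact p.Prime := ⟨hp⟩
  have hnilN := hnil N hN.1
  have hne : ∀ (q : ℕ) (_ : Fact q.Prime), q ≠ p → ∀ Q : Sylow q G, (Q : Subgroup G).Normal := by
    intro q hq hqp Q
    obtain ⟨R, hR⟩ := Subgroup.exists_sylow_le_of_not_dvd_index (H := N)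
      fun hdvd => hqp ((Nat.prime_dvd_prime_iff_eq hq.out hp).1 hdvd)
    have h1 := (R.subtype hR).characteristic_of_normal
      (Group.isNilpotent_iff_forall_sylow_normal.1 hnilN q hq _)
    have h2 : (((R.subtype hR : Sylow q N) : Subgroup N).map N.subtype).Normal := inferInstance
    rw [Sylow.coe_subtype, Subgroup.map_subgroupOf_eq_of_le hR] at h2
    have := R.unique_of_normal h2
    rwa [Subsingleton.elim Q R]
  refine Group.isNilpotent_iff_forall_sylow_normal.2 fun q hq Q => ?_
  rcases ne_or_eq q p with hqp | rfl
  · exact hne q hq hqp Q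
  by_cases hdvd : ∃ H ∈ P, ¬ p ∣ H.index
  · obtain ⟨H, hH, hpH⟩ := hdvd
    exact h.sylow_normal (fun K hK => hnil K (h.1.2.1 K hK)) hH hpH Q
  push Not at hdvd
  rw [← Subgroup.normalizer_eq_top_iff, ← Subgroup.index_eq_one]
  by_contra hindex
  obtain ⟨r, hr, hrQ⟩ := Nat.exists_prime_and_dvd hindex
  have : Fact r.Prime := ⟨hr⟩
  obtain rfl | hrp := eq_or_ne r p
  · exact Q.not_dvd_index (hrQ.trans (Subgroup.index_dvd_of_le Subgroup.le_normalizer))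
  obtain ⟨R⟩ : Nonempty (Sylow r G) := inferInstance
  have hRn := hne r this hrp R
  suffices hcomm : ∀ x ∈ Q, ∀ y ∈ R, Commute x y by
    refine R.not_dvd_index (hrQ.trans (Subgroup.index_dvd_of_le fun y hy => ?_))
    exact Subgroup.centralizer_le_normalizer _
      (Subgroup.mem_centralizer_iff.2 fun x hx => (hcomm x hx y hy).eq)
  intro x hx y hy
  have hK : Subgroup.zpowers x ⊔ R ≠ ⊤ := fun htop => by
    obtain ⟨H, hH, hxH⟩ := h.1.2.2.1 x
    have h1 : (R : Subgroup G).index ∣ Nat.card (Subgroup.zpowers x) := by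
      rw [← Subgroup.relIndex_top_right, ← htop, Subgroup.relIndex_sup_right]
      exact Subgroup.relIndex_dvd_card _ _
    obtain ⟨k, hk⟩ := h1
    have h2 : p ∣ Nat.card R := by
      refine (hdvd H hH).trans
        ((Subgroup.index_dvd_of_le (Subgroup.zpowers_le.2 hxH)).trans ⟨k, ?_⟩)
      have h3 := (Subgroup.zpowers x).card_mul_index
      rw [hk, ← (R : Subgroup G).card_mul_index] at h3
      refine Nat.eq_of_mul_eq_mul_left
        (Nat.pos_of_ne_zero (R : Subgroup G).index_ne_zero_of_finite) ?_
      linarith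
    rw [R.card_eq_multiplicity] at h2
    exact hrp ((Nat.prime_dvd_prime_iff_eq hp hr).1 (hp.dvd_of_dvd_pow h2)).symm
  have := hnil _ hK
  have hxQ : IsPGroup p (Subgroup.zpowers x) := Q.2.to_le (Subgroup.zpowers_le.2 hx)
  have h1 := Group.IsNilpotent.commute_of_isPGroup (G := (Subgroup.zpowers x ⊔ R : Subgroup G))
    (Ne.symm hrp) (hxQ.comap_subtype) (R.2.comap_subtype)
    (x := ⟨x, Subgroup.mem_sup_left (Subgroup.mem_zpowers x)⟩)
    (y := ⟨y, Subgroup.mem_sup_right hy⟩) (Subgroup.mem_zpowers x) hy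
  exact congrArg Subtype.val h1

theorem Group.isNilpotent_of_forall_exists_isESPartition {G : Type*} [Group G] [Finite G]
    (h : ∀ H : Subgroup G, ¬ IsCyclic H →
      ∃ (S : Subgroup H) (P : Finset (Subgroup H)), IsESPartition S P) :
    Group.IsNilpotent G := by
  suffices hH : ∀ H : Subgroup G, Group.IsNilpotent H by
    have := hH ⊤
    exact Group.nilpotent_of_mulEquiv Subgroup.topEquiv
  intro H
  induction H using WellFoundedLT.induction with
  | ind H ih =>
    by_cases hcyc : IsCyclic H
    · let _ : CommGroup H := IsCyclic.commGroup
      infer_instance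
    · obtain ⟨S, P, hP⟩ := h H hcyc
      refine hP.isNilpotent_of_forall_ne_top fun K hK => ?_
      have hlt : K.map H.subtype < H := by
        refine lt_of_le_of_ne (Subgroup.map_subtype_le K) fun heq => hK ?_
        rw [← Subgroup.map_subtype_inj, heq, ← MonoidHom.range_eq_map, Subgroup.range_subtype]
      have := ih _ hlt
      exact Group.nilpotent_of_mulEquiv (K.equivMapOfInjective _ H.subtype_injective).symm

theorem nilpotent_tfae_ESPartition {G : Type*} [Group G] [Finite G] (hG : ¬ IsCyclic G) :
    (Group.IsNilpotent G ↔
      ∃ (S : Subgroup G) (P : Finset (Subgroup G)),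
        S.Normal ∧ (∃ i : ℕ, S ≤ upperCentralSeries G i) ∧ IsESPartition S P) ∧
    (Group.IsNilpotent G ↔
      ∀ H : Subgroup G, ¬ IsCyclic H →
        ∃ (S : Subgroup H) (P : Finset (Subgroup H)), IsESPartition S P) := by
  classical
  refine ⟨⟨fun h => ?_, ?_⟩, ⟨fun h H hH => ?_, Group.isNilpotent_of_forall_exists_isESPartition⟩⟩
  · obtain ⟨S, P, hS, hP⟩ := Group.IsNilpotent.exists_isESPartition hG
    obtain ⟨i, hi⟩ := Group.IsNilpotent.nilpotent G
    exact ⟨S, P, hS, ⟨i, le_top.trans_eq hi.symm⟩, hP⟩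
  · rintro ⟨S, P, hS, ⟨i, hi⟩, hP⟩
    have := hP.map_quotientMk.isNilpotent_of_bot
    exact Group.isNilpotent_of_quotient_of_le_upperCentralSeries hi
  · obtain ⟨S, P, -, hP⟩ := Group.IsNilpotent.exists_isESPartition hH
    exact ⟨S, P, hP⟩
end

section
/- Let G be a finite group that has an ES-partition for a subgroup S such that S is normal in G and S ≤ Z_i(G) for some natural number i. Then G is nilpotent. -/
/-- Let `S₀` act coprimely on a commutative group `W`, and let `y` normalize `S₀`. If every element
of the coset `y * S₀` has `p`-th power `1` and acts without nontrivial fixed points, then `S₀` acts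
trivially. -/
theorem MulAut.eq_one_of_coset_fixedPointFree {T W : Type*} [Group T] [CommGroup W]
    (φ : T →* MulAut W) {p : ℕ} (hp : p.Prime) (S₀ : Subgroup T) [Finite S₀] (y : T)
    (hy : y ∈ Subgroup.normalizer (S₀ : Set T)) (hpow : ∀ s ∈ S₀, (y * s) ^ p = 1)
    (hfix : ∀ s ∈ S₀, ∀ w, φ (y * s) w = w → w = 1)
    (hcop : (Nat.card S₀).Coprime (Nat.card W)) (s : T) (hs : s ∈ S₀) : φ s = 1 := by
  classical
  have := Fintype.ofFinite S₀
  -- powers of an element of the coset multiply to a fixed point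
  have hprod : ∀ s ∈ S₀, ∀ w, ∏ i ∈ Finset.range p, φ ((y * s) ^ i) w = 1 := by
    intro s hs w
    apply hfix s hs
    rw [map_prod]
    simp only [← MulAut.mul_apply, ← map_mul, ← pow_succ']
    have h1 := Finset.prod_range_succ' (fun i => φ ((y * s) ^ i) w) p
    have h2 := Finset.prod_range_succ (fun i => φ ((y * s) ^ i) w) p
    rw [h2, hpow s hs, pow_zero] at h1
    exact (mul_right_cancel h1).symm
  let E : W →* W :=
    { toFun := fun w => ∏ s : S₀, φ s w
      map_one' := by simp
      map_mul' := by intro a b; simp [Finset.prod_mul_distrib] }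
  have hE : ∀ w, E w = ∏ s : S₀, φ s w := fun _ => rfl
  have hswap : ∀ i, 0 < i → i < p → ∀ w, ∏ s : S₀, φ ((y * s) ^ i) w = E (φ (y ^ i) w) := by
    intro i hi hip w
    have hmem : ∀ s : S₀, (y * s) ^ i * (y ^ i)⁻¹ ∈ S₀ := by
      intro s
      clear hi hip
      induction i with
      | zero => simp
      | succ i ih =>
        have : (y * s) ^ (i + 1) * (y ^ (i + 1))⁻¹ =
            y * (s * ((y * s) ^ i * (y ^ i)⁻¹)) * y⁻¹ := by
          rw [pow_succ', pow_succ']; group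
        rw [this]
        exact (Subgroup.mem_normalizer_iff.1 hy _).1 (S₀.mul_mem s.2 ih)
    let f : S₀ → S₀ := fun s => ⟨_, hmem s⟩
    have hinj : Function.Injective f := by
      intro a b hab
      have h1 : (y * (a : T)) ^ i = (y * b) ^ i := by
        simpa [f] using hab
      have hc : i.Coprime p := by
        rw [Nat.coprime_comm, hp.coprime_iff_not_dvd]
        exact Nat.not_dvd_of_pos_of_lt hi hip
      obtain ⟨j, hj⟩ := Nat.exists_mul_mod_eq_one_of_coprime hc hp.one_lt
      have key : ∀ c : T, c ^ p = 1 → (c ^ i) ^ j = c := by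
        intro c hc
        rw [← pow_mul, pow_eq_pow_mod _ hc, hj.2, pow_one]
      have h3 := key _ (hpow a a.2)
      rw [h1, key _ (hpow b b.2)] at h3
      exact Subtype.ext (mul_left_cancel h3).symm
    have hbij := Finite.injective_iff_bijective.1 hinj
    rw [hE, ← Function.Bijective.prod_comp hbij (fun s : S₀ => φ s (φ (y ^ i) w))]
    refine Finset.prod_congr rfl fun s _ => ?_
    simp only [f, ← MulAut.mul_apply, ← map_mul, inv_mul_cancel_right]
  have hEw : ∀ w, E w = w ^ Nat.card S₀ := by
    intro w
    have h0 : ∏ i ∈ Finset.range p, ∏ s : S₀, φ ((y * s) ^ i) w = 1 := by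
      rw [Finset.prod_comm]
      exact Finset.prod_eq_one fun s _ => hprod s s.2 w
    have h1 : ∏ i ∈ Finset.range p, E (φ (y ^ i) w) = 1 := by
      have := hprod 1 S₀.one_mem w
      rw [mul_one] at this
      rw [← map_prod, this, map_one]
    obtain ⟨r, rfl⟩ := Nat.exists_eq_succ_of_ne_zero hp.ne_zero
    rw [Finset.prod_range_succ'] at h0 h1
    rw [Finset.prod_congr rfl fun i hi => hswap (i + 1) i.succ_pos
      (by have := Finset.mem_range.1 hi; omega) w] at h0
    have := h0.trans h1.symm
    simpa using (mul_left_cancel this).symm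
  ext w
  have h1 : φ s (E w) = E w := by
    rw [hE, map_prod]
    simp only [← MulAut.mul_apply, ← map_mul]
    exact Fintype.prod_equiv (Equiv.mulLeft ⟨s, hs⟩) _ _ (fun x => by simp)
  rw [hEw, map_pow] at h1
  exact (Nat.Coprime.pow_left_bijective (G := W) hcop.symm).1 h1

/-- A `p`-group cannot act coprimely on a nontrivial commutative group in such a way that all
elements outside a subgroup of index at least `p ^ 2` have order `p` and no nontrivial fixed
points. -/
theorem subsingleton_of_isPGroup_fixedPointFree {S W : Type*} [Group S] [Finite S] [CommGroup W]
    (φ : S →* MulAut W) {p : ℕ} [Fact p.Prime] (hS : IsPGroup p S) (S₀ : Subgroup S)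
    (hcard : p ^ 2 * Nat.card S₀ ∣ Nat.card S) (hpow : ∀ s ∉ S₀, s ^ p = 1)
    (hfix : ∀ s ∉ S₀, ∀ w, φ s w = w → w = 1) (hcop : p.Coprime (Nat.card W)) :
    Subsingleton W := by
  have hp : p.Prime := Fact.out
  obtain ⟨a, ha⟩ := IsPGroup.iff_card.1 (hS.to_subgroup S₀)
  have hpos : 0 < Nat.card S := Nat.card_pos
  obtain ⟨T, hT, hle⟩ := Sylow.exists_subgroup_card_pow_succ
    ((Dvd.intro_left p (by rw [ha]; ring)).trans hcard) ha
  have hTtop : T < ⊤ := by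
    refine lt_top_iff_ne_top.2 fun h => ?_
    rw [h, Subgroup.card_top] at hT
    rw [hT, ha, ← pow_add] at hcard
    have := (Nat.pow_dvd_pow_iff_le_right hp.one_lt).1 hcard
    omega
  obtain ⟨y, hy, hyT⟩ := SetLike.exists_of_lt
    (Group.normalizerCondition_of_isNilpotent (h := hS.isNilpotent) T hTtop)
  have hlt : ¬ T ≤ S₀ := by
    intro h
    have := Subgroup.card_le_of_le h
    rw [hT, ha] at this
    exact absurd ((Nat.pow_le_pow_iff_right hp.one_lt).1 this) (by omega)
  obtain ⟨t, htT, ht⟩ := SetLike.not_le_iff_exists.1 hlt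
  have hys : ∀ s ∈ T, y * s ∉ S₀ := fun s hs h => hyT ((T.mul_mem_cancel_right hs).1 (hle h))
  have h1 := MulAut.eq_one_of_coset_fixedPointFree φ hp T y hy (fun s hs => hpow _ (hys s hs))
    (fun s hs => hfix _ (hys s hs)) (by rw [hT]; exact hcop.pow_left _) t htT
  have h2 : ∀ w : W, w = 1 := fun w => hfix t ht w (by rw [h1]; rfl)
  exact ⟨fun a b => (h2 a).trans (h2 b).symm⟩

namespace Subgroup

/-- A subgroup `A` is isolated if it contains every element commuting with some nontrivial element
of `A` of a different order. -/
def IsIsolated_s1 {G : Type*} [Group G] (A : Subgroup G) : Prop :=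
  ∀ u ∈ A, u ≠ 1 → ∀ v, Commute u v → orderOf u ≠ orderOf v → v ∈ A

section Isolated

variable {G : Type*} [Group G] {A : Subgroup G}

theorem IsIsolated_s1.subgroupOf (hA : A.IsIsolated_s1) (N : Subgroup G) :
    (A.subgroupOf N).IsIsolated_s1 := by
  intro u hu hu1 v huv ho
  exact hA u hu (by simpa using hu1) v (huv.map N.subtype)
    (by rwa [Subgroup.orderOf_coe, Subgroup.orderOf_coe])

variable [Finite G]

theorem IsIsolated_s1.mem_of_pow_mem (hA : A.IsIsolated_s1) {v : G} {n : ℕ} (hv : v ^ n ∈ A)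
    (hv1 : v ^ n ≠ 1) : v ∈ A := by
  by_cases ho : orderOf (v ^ n) = orderOf v
  · have h : zpowers (v ^ n) = zpowers v :=
      eq_of_le_of_card_ge (by simp)
        (by rw [Nat.card_zpowers, Nat.card_zpowers, ho])
    have h2 : zpowers (v ^ n) ≤ A := by simpa using hv
    exact h2 (h ▸ mem_zpowers v)
  · exact hA _ hv hv1 v ((Commute.refl v).pow_left n) ho

variable {p q : ℕ} [Fact p.Prime] [Fact q.Prime]

/-- A `p`-element normalizing but not contained in an isolated subgroup of order divisible by `p`
has order `p`. -/
theorem IsIsolated_s1.orderOf_eq_prime [A.Normal] (hA : A.IsIsolated_s1) (hp : p ∣ Nat.card A) {s : G}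
    (hs : s ∉ A) {k : ℕ} (hk : orderOf s = p ^ k) : orderOf s = p := by
  have hZ : IsPGroup p (zpowers s) := IsPGroup.of_card (n := k) (by rw [Nat.card_zpowers, hk])
  let _ : MulAction (zpowers s) A :=
    MulAction.compHom A ((MulAut.conjNormal (H := A)).comp (zpowers s).subtype)
  have hsmul : ∀ (g : zpowers s) (a : A), ((g • a : A) : G) = g * a * (g : G)⁻¹ := fun _ _ => rfl
  obtain ⟨b, hb, hb1⟩ := hZ.exists_fixed_point_of_prime_dvd_card_of_fixed_point A hp
    (a := 1) (fun g => Subtype.ext (by simp [hsmul]))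
  have hcomm : Commute (b : G) s := by
    have := congrArg Subtype.val (hb ⟨s, mem_zpowers s⟩)
    rw [hsmul] at this
    exact (mul_inv_eq_iff_eq_mul.1 this).symm
  have hb1' : (b : G) ≠ 1 := by simpa using hb1.symm
  have hob : orderOf (b : G) = orderOf s := by
    by_contra h
    exact hs (hA b b.2 hb1' s hcomm h)
  by_cases hsp : s ^ p = 1
  · exact _root_.orderOf_eq_prime hsp (fun h => hs (h ▸ A.one_mem))
  · exfalso
    have hk0 : orderOf s ≠ 0 := orderOf_ne_zero_iff.2 (isOfFinOrder_of_finite s)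
    have hpd : p ∣ orderOf s := by
      rw [hk]
      refine dvd_pow_self p (fun h0 => hs ?_)
      rw [h0, pow_zero, orderOf_eq_one_iff] at hk
      exact hk ▸ A.one_mem
    have hne : orderOf (b : G) ≠ orderOf (s ^ p) := by
      rw [hob, orderOf_pow_of_dvd (Fact.out : p.Prime).ne_zero hpd]
      exact (Nat.div_lt_self (Nat.pos_of_ne_zero hk0) (Fact.out : p.Prime).one_lt).ne'
    exact hs (hA.mem_of_pow_mem (hA b b.2 hb1' _ (hcomm.pow_right p) hne) hsp)

theorem IsIsolated_s1.ne_commute [A.Normal] (hA : A.IsIsolated_s1) (hpq : p ≠ q)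
    (hp : p ∣ Nat.card A) {s : G} (hs : s ∉ A) {k : ℕ} (hk : orderOf s = p ^ k) {u : G}
    (hu : u ∈ A) (hu1 : u ≠ 1) {j : ℕ} (hj : orderOf u = q ^ j) : ¬ Commute u s := by
  intro h
  refine hs (hA u hu hu1 s h ?_)
  rw [hA.orderOf_eq_prime hp hs hk, hj]
  intro h
  have h2 : p ∣ q ^ j := h ▸ dvd_rfl
  exact hpq ((Nat.prime_dvd_prime_iff_eq Fact.out Fact.out).1
    ((Fact.out : p.Prime).dvd_of_dvd_pow h2))

/-- A consequence of the Frattini argument: if `p ^ k` divides the index of a normal subgroup `A`,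
then some `p`-subgroup that meets `A` in index at least `p ^ k` normalizes a given Sylow subgroup
of `A`. -/
theorem exists_isPGroup_le_normalizer_sylow [A.Normal] (Q : Sylow q A) {k : ℕ}
    (hk : p ^ k ∣ A.index) : ∃ S : Subgroup G, IsPGroup p S ∧
      S ≤ normalizer ((Q : Subgroup A).map A.subtype : Set G) ∧
      p ^ k * Nat.card (A.subgroupOf S) ∣ Nat.card S := by
  set M := normalizer ((Q : Subgroup A).map A.subtype : Set G) with hM
  have hsup : M ⊔ A = ⊤ := Sylow.normalizer_sup_eq_top Q
  have hrel : A.relIndex M = A.index := by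
    rw [← relIndex_sup_right, hsup, relIndex_top_right]
  have hcardM : Nat.card (A.subgroupOf M) * A.index = Nat.card M := by
    rw [← hrel]; exact card_mul_index _
  let S : Sylow p M := default
  have hSp : IsPGroup p ((S : Subgroup M).map M.subtype) := S.2.map _
  have hScard : Nat.card ((S : Subgroup M).map M.subtype) = Nat.card S :=
    card_map_of_injective M.subtype_injective
  refine ⟨_, hSp, map_subtype_le _, ?_⟩
  obtain ⟨a, ha⟩ := IsPGroup.iff_card.1
    (hSp.to_subgroup (A.subgroupOf ((S : Subgroup M).map M.subtype)))
  rw [hScard, ha, ← pow_add]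
  refine S.pow_dvd_card_of_pow_dvd_card ?_
  rw [pow_add, mul_comm, ← hcardM]
  refine mul_dvd_mul ?_ hk
  rw [← ha]
  have h1 : ∀ K : Subgroup G, Nat.card (A.subgroupOf K) = Nat.card (A ⊓ K : Subgroup G) := by
    intro K
    rw [← inf_subgroupOf_right]
    exact Nat.card_congr (subgroupOfEquivOfLe inf_le_right).toEquiv
  rw [h1, h1]
  exact card_dvd_of_le (inf_le_inf_left A (map_subtype_le _))

theorem IsIsolated_s1.not_sq_dvd_index [A.Normal] (hA : A.IsIsolated_s1) (hpq : p ≠ q)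
    (hp : p ∣ Nat.card A) (hq : q ∣ Nat.card A) : ¬ p ^ 2 ∣ A.index := by
  intro h
  let Q : Sylow q A := default
  obtain ⟨S, hS, hSQ, hcard⟩ := exists_isPGroup_le_normalizer_sylow Q h
  set Q' := (Q : Subgroup A).map A.subtype with hQ'
  have hQA : Q' ≤ A := map_subtype_le _
  have hQp : IsPGroup q Q' := Q.2.map _
  have hQnt : Nontrivial Q' := by
    have hqQ : q ∣ Nat.card Q := Q.dvd_card_of_dvd_card hq
    rw [← Finite.one_lt_card_iff_nontrivial, hQ', card_map_of_injective A.subtype_injective]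
    exact (Fact.out : q.Prime).one_lt.trans_le (Nat.le_of_dvd Nat.card_pos hqQ)
  let _ : CommGroup (center Q') :=
    { (inferInstance : Group (center Q')) with mul_comm := fun a b => Subtype.ext (b.2.comm a).symm }
  let ψ : MulAut Q' →* MulAut (center Q') :=
    { toFun := centerCongr
      map_one' := rfl
      map_mul' := fun _ _ => rfl }
  let φ : S →* MulAut (center Q') := (ψ.comp (normalizerMonoidHom Q')).comp (inclusion hSQ)
  have hφ : ∀ (s : S) (w : center Q'), (((φ s w : center Q') : Q') : G) = s * w * (s : G)⁻¹ :=
    fun _ _ => rfl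
  have := hQp.center_nontrivial
  refine not_subsingleton (center Q') (subsingleton_of_isPGroup_fixedPointFree φ hS
    (A.subgroupOf S) hcard ?_ ?_ ?_)
  · intro s hs
    obtain ⟨k, hk⟩ := IsPGroup.iff_orderOf.1 hS s
    rw [← Subgroup.orderOf_coe] at hk
    ext
    rw [coe_pow, coe_one, ← hA.orderOf_eq_prime hp hs hk]
    exact pow_orderOf_eq_one _
  · intro s hs w hw
    by_contra hw1
    obtain ⟨k, hk⟩ := IsPGroup.iff_orderOf.1 hS s
    obtain ⟨j, hj⟩ := IsPGroup.iff_orderOf.1 hQp w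
    rw [← Subgroup.orderOf_coe] at hk hj
    refine hA.ne_commute hpq hp hs hk (hQA (w : Q').2) (by simpa using hw1) hj ?_
    have := congrArg (fun x : center Q' => ((x : Q') : G)) hw
    simp only [hφ] at this
    exact (mul_inv_eq_iff_eq_mul.1 this).symm
  · obtain ⟨j, hj⟩ := IsPGroup.iff_card.1 (hQp.to_subgroup (center Q'))
    rw [hj]
    exact ((Nat.coprime_primes Fact.out Fact.out).2 hpq).pow_right j

theorem IsIsolated_s1.modEq_one [A.Normal] (hA : A.IsIsolated_s1) (hpq : p ≠ q)
    (hp : p ∣ Nat.card A) (hq : q ∣ Nat.card A) (hpi : p ∣ A.index)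
    (hq2 : ¬ q ^ 2 ∣ Nat.card A) : q ≡ 1 [MOD p] := by
  let Q : Sylow q A := default
  obtain ⟨S, hS, hSQ, hcard⟩ := exists_isPGroup_le_normalizer_sylow (k := 1) Q (by simpa using hpi)
  set Q' := (Q : Subgroup A).map A.subtype with hQ'
  have hQA : Q' ≤ A := map_subtype_le _
  have hQp : IsPGroup q Q' := Q.2.map _
  have hQcard : Nat.card Q' = q := by
    rw [hQ', card_map_of_injective A.subtype_injective]
    have hqQ : q ∣ Nat.card Q := Q.dvd_card_of_dvd_card hq
    obtain ⟨j, hj⟩ := IsPGroup.iff_card.1 Q.2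
    change Nat.card Q = _ at hj
    have : j < 2 := by
      by_contra! h
      exact hq2 (((pow_dvd_pow q h).trans hj.symm.dvd).trans (card_subgroup_dvd_card _))
    interval_cases j
    · rw [hj, pow_zero] at hqQ
      exact absurd hqQ (Fact.out : q.Prime).not_dvd_one
    · simpa using hj
  have hSA : ¬ S ≤ A := by
    intro hle
    rw [subgroupOf_eq_top.2 hle, card_top, pow_one] at hcard
    have := Nat.le_of_dvd Nat.card_pos hcard
    have h2 := (Fact.out : p.Prime).two_le
    have h3 : 0 < Nat.card S := Nat.card_pos
    nlinarith
  obtain ⟨s, hsS, hsA⟩ := SetLike.not_le_iff_exists.1 hSA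
  obtain ⟨k, hk⟩ := IsPGroup.iff_orderOf.1 hS ⟨s, hsS⟩
  rw [← Subgroup.orderOf_coe] at hk
  have hZ : IsPGroup p (zpowers s) := IsPGroup.of_card (n := k) (by rw [Nat.card_zpowers, hk])
  have hZle : zpowers s ≤ normalizer (Q' : Set G) := by simpa using hSQ hsS
  let _ : MulAction (zpowers s) Q' :=
    MulAction.compHom Q' ((normalizerMonoidHom Q').comp (inclusion hZle))
  have hsmul : ∀ (g : zpowers s) (a : Q'), ((g • a : Q') : G) = g * a * (g : G)⁻¹ :=
    fun _ _ => rfl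
  have hmod := hZ.card_modEq_card_fixedPoints Q'
  have hfix : MulAction.fixedPoints (zpowers s) Q' = {1} := by
    ext b
    simp only [Set.mem_singleton_iff]
    constructor
    · intro hb
      by_contra hb1
      obtain ⟨j, hj⟩ := IsPGroup.iff_orderOf.1 hQp b
      rw [← Subgroup.orderOf_coe] at hj
      refine hA.ne_commute hpq hp hsA hk (hQA b.2) (by simpa using hb1) hj ?_
      have := congrArg Subtype.val (hb ⟨s, mem_zpowers s⟩)
      rw [hsmul] at this
      exact (mul_inv_eq_iff_eq_mul.1 this).symm
    · rintro rfl g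
      exact Subtype.ext (by simp [hsmul])
  rwa [hfix, hQcard, Nat.card_unique] at hmod

end Isolated

end Subgroup

namespace Subgroup

theorem card_mul_card_le_of_disjoint {G : Type*} [Group G] [Finite G] {H K R : Subgroup G}
    (hH : H ≤ R) (hK : K ≤ R) (hd : Disjoint H K) : Nat.card H * Nat.card K ≤ Nat.card R := by
  rw [← Nat.card_prod]
  refine Nat.card_le_card_of_injective
    (fun x : H × K => (⟨x.1 * x.2, R.mul_mem (hH x.1.2) (hK x.2.2)⟩ : R)) fun x y hxy => ?_
  exact mul_injective_of_disjoint hd (congrArg Subtype.val hxy)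

end Subgroup

namespace IsStrictPartition

variable {G : Type*} [Group G] {P : Finset (Subgroup G)}

theorem eq_of_mem_s1 (hP : IsStrictPartition ⊥ P) {H K : Subgroup G} (hH : H ∈ P) (hK : K ∈ P)
    {g : G} (hg : g ≠ 1) (hgH : g ∈ H) (hgK : g ∈ K) : H = K := by
  by_contra h
  have : g ∈ H ⊓ K := ⟨hgH, hgK⟩
  rw [hP.2.2.2 H hH K hK h, Subgroup.mem_bot] at this
  exact hg this

open Classical in
theorem card_eq_sum (hP : IsStrictPartition ⊥ P) {α : Type*} (s : Finset α) (f : α → G)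
    (hf : ∀ a ∈ s, f a ≠ 1) : s.card = ∑ K ∈ P, (s.filter fun a => f a ∈ K).card := by
  rw [← Finset.card_biUnion]
  · congr 1
    ext a
    simp only [Finset.mem_biUnion, Finset.mem_filter]
    constructor
    · intro ha
      obtain ⟨H, hH, hg⟩ := hP.2.2.1 (f a)
      exact ⟨H, hH, ha, hg⟩
    · rintro ⟨H, -, ha, -⟩
      exact ha
  · intro H hH K hK hne
    rw [Function.onFun, Finset.disjoint_left]
    intro a ha hb
    rw [Finset.mem_filter] at ha hb
    exact hne (hP.eq_of_mem_s1 hH hK (hf a ha.1) ha.2 hb.2)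

/-- Commuting elements of different orders lie in the same component. -/
theorem mem_of_commute [Finite G] (hP : IsStrictPartition ⊥ P) {K : Subgroup G} (hK : K ∈ P)
    {u v : G} (hu1 : u ≠ 1) (huv : Commute u v) (ho : orderOf u ≠ orderOf v) (hu : u ∈ K) :
    v ∈ K := by
  obtain ⟨M, hM, huvM⟩ := hP.2.2.1 (u * v)
  rcases lt_or_gt_of_ne ho with h | h
  · obtain ⟨L, hL, hvL⟩ := hP.2.2.1 v
    have h1 : (u * v) ^ orderOf u = v ^ orderOf u := by
      rw [huv.mul_pow, pow_orderOf_eq_one, one_mul]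
    have h2 : v ^ orderOf u ≠ 1 := pow_ne_one_of_lt_orderOf (orderOf_pos u).ne' h
    have hLM : L = M :=
      hP.eq_of_mem_s1 hL hM h2 (L.pow_mem hvL _) (h1 ▸ M.pow_mem huvM _)
    subst hLM
    rw [hP.eq_of_mem_s1 hK hL hu1 hu ((L.mul_mem_cancel_right hvL).1 huvM)]
    exact hvL
  · have h1 : (u * v) ^ orderOf v = u ^ orderOf v := by
      rw [huv.mul_pow, pow_orderOf_eq_one, mul_one]
    have h2 : u ^ orderOf v ≠ 1 := pow_ne_one_of_lt_orderOf (orderOf_pos v).ne' h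
    have hKM : K = M :=
      hP.eq_of_mem_s1 hK hM h2 (K.pow_mem hu _) (h1 ▸ M.pow_mem huvM _)
    subst hKM
    exact (K.mul_mem_cancel_left hu).1 huvM

end IsStrictPartition

/-- The intersection of all conjugates of members of `P` containing `x`. -/
def Subgroup.conjCell {G : Type*} [Group G] (P : Finset (Subgroup G)) (x : G) : Subgroup G :=
  ⨅ g : G, ⨅ K ∈ P, ⨅ _ : g * x * g⁻¹ ∈ K, K.comap (MulAut.conj g).toMonoidHom

namespace Subgroup

section ConjCell

variable {G : Type*} [Group G] {P : Finset (Subgroup G)} {x y : G}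

theorem mem_conjCell :
    y ∈ conjCell P x ↔ ∀ g, ∀ K ∈ P, g * x * g⁻¹ ∈ K → g * y * g⁻¹ ∈ K := by
  simp [conjCell, mem_iInf]

theorem self_mem_conjCell : x ∈ conjCell P x := mem_conjCell.2 fun _ _ _ h => h

theorem conjCell_le {K : Subgroup G} (hK : K ∈ P) (hx : x ∈ K) : conjCell P x ≤ K := by
  intro y hy
  simpa using mem_conjCell.1 hy 1 K hK (by simpa using hx)

theorem conjCell_mono (h : y ∈ conjCell P x) : conjCell P y ≤ conjCell P x := fun _ hz =>
  mem_conjCell.2 fun g K hK hx => mem_conjCell.1 hz g K hK (mem_conjCell.1 h g K hK hx)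

theorem conj_mem_conjCell_iff (g : G) :
    g * y * g⁻¹ ∈ conjCell P (g * x * g⁻¹) ↔ y ∈ conjCell P x := by
  simp only [mem_conjCell]
  constructor
  · intro h k K hK hx
    have := h (k * g⁻¹) K hK
    simp only [mul_assoc, mul_inv_rev, inv_inv, inv_mul_cancel_left] at this hx ⊢
    exact this hx
  · intro h k K hK hx
    have := h (k * g) K hK
    simp only [mul_assoc, mul_inv_rev] at this hx ⊢
    exact this hx

theorem conjCell_eq (hP : IsStrictPartition ⊥ P) (hy : y ∈ conjCell P x) (hy1 : y ≠ 1) :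
    conjCell P y = conjCell P x := by
  refine le_antisymm (conjCell_mono hy) (conjCell_mono (mem_conjCell.2 fun g K hK hyK => ?_))
  obtain ⟨L, hL, hxL⟩ := hP.2.2.1 (g * x * g⁻¹)
  rwa [hP.eq_of_mem_s1 hK hL (by simpa [conj_eq_one_iff] using hy1) hyK (mem_conjCell.1 hy g L hL hxL)]

theorem mem_normalizer_conjCell (hP : IsStrictPartition ⊥ P) {g u : G} (hu : u ∈ conjCell P x)
    (hu1 : u ≠ 1) (hgu : g * u * g⁻¹ ∈ conjCell P x) :
    g ∈ normalizer (conjCell P x : Set G) := by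
  rw [mem_normalizer_iff]
  intro h
  rw [← conjCell_eq hP hgu (by simpa [conj_eq_one_iff] using hu1), conj_mem_conjCell_iff,
    conjCell_eq hP hu hu1, conjCell_eq hP hgu (by simpa [conj_eq_one_iff] using hu1)]

theorem isIsolated_conjCell [Finite G] (hP : IsStrictPartition ⊥ P) (x : G) :
    (conjCell P x).IsIsolated_s1 := by
  intro u hu hu1 v huv ho
  rw [mem_conjCell] at hu ⊢
  intro g K hK hx
  refine hP.mem_of_commute hK (u := g * u * g⁻¹) (by simpa [conj_eq_one_iff] using hu1) ?_ ?_
    (hu g K hK hx)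
  · exact huv.map (MulAut.conj g)
  · rw [← MulAut.conj_apply, ← MulAut.conj_apply, MulEquiv.orderOf_eq, MulEquiv.orderOf_eq]
    exact ho

end ConjCell

end Subgroup

namespace IsESPartition

variable {G : Type*} [Group G] {P : Finset (Subgroup G)}

theorem nonempty (hP : IsESPartition ⊥ P) : P.Nonempty :=
  Finset.card_pos.1 (by have := hP.1.1; omega)

variable [Finite G]

theorem card_add_card (hP : IsESPartition ⊥ P) {H : Subgroup G} (hH : H ∈ P) :
    Nat.card G + P.card = P.card * Nat.card H + 1 := by
  classical
  have := Fintype.ofFinite G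
  have h := hP.1.card_eq_sum (Finset.univ.erase (1 : G)) id (by simp)
  have h2 : ∀ K ∈ P, ((Finset.univ.erase (1 : G)).filter fun a => id a ∈ K).card + 1 =
      Nat.card H := by
    intro K hK
    rw [← hP.2 K hK H hH, Finset.filter_erase, Finset.card_erase_add_one (by simp [K.one_mem]),
      Nat.card_eq_fintype_card]
    exact (Fintype.card_subtype _).symm
  have h3 := Finset.sum_congr rfl h2
  rw [Finset.sum_add_distrib, ← h, Finset.sum_const, Finset.sum_const, smul_eq_mul, smul_eq_mul,
    mul_one, Finset.card_erase_of_mem (Finset.mem_univ _), Finset.card_univ,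
    ← Nat.card_eq_fintype_card] at h3
  have : 0 < Nat.card G := Nat.card_pos
  omega

theorem exists_forall_conj_notMem (hP : IsESPartition ⊥ P) {z : G} (hz : z ≠ 1) :
    ∃ K ∈ P, ∀ g, g * z * g⁻¹ ∉ K := by
  classical
  have := Fintype.ofFinite G
  by_contra! hcon
  obtain ⟨H, hH⟩ := hP.nonempty
  have h := hP.1.card_eq_sum (Finset.univ : Finset G) (fun g => g * z * g⁻¹)
    (fun g _ => by simpa [conj_eq_one_iff] using hz)
  have h2 : ∀ K ∈ P, Nat.card H ≤ (Finset.univ.filter fun g : G => g * z * g⁻¹ ∈ K).card := by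
    intro K hK
    obtain ⟨g, hg⟩ := hcon K hK
    rw [← hP.2 K hK H hH, ← Fintype.card_subtype, ← Nat.card_eq_fintype_card]
    refine Nat.card_le_card_of_injective
      (fun k : K => (⟨k * g, ?_⟩ : {g : G // g * z * g⁻¹ ∈ K})) fun a b hab => ?_
    · have := K.mul_mem (K.mul_mem k.2 hg) (K.inv_mem k.2)
      simpa [mul_assoc] using this
    · exact Subtype.ext (mul_right_cancel (congrArg Subtype.val hab))
  have h3 := Finset.card_nsmul_le_sum _ _ _ h2
  rw [← h, Finset.card_univ, ← Nat.card_eq_fintype_card, smul_eq_mul] at h3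
  have := hP.card_add_card hH
  have := hP.1.1
  omega

end IsESPartition

namespace Subgroup

/-- A subgroup of order `p ^ k`, where `p ^ (k + 1)` does not divide the order of the group,
contains a conjugate of every `p`-subgroup. -/
theorem _root_.IsPGroup.exists_map_conj_le {G : Type*} [Group G] [Finite G] {p k : ℕ}
    [Fact p.Prime] {T R : Subgroup G} (hT : IsPGroup p T) (hR : Nat.card R = p ^ k)
    (hG : ¬ p ^ (k + 1) ∣ Nat.card G) : ∃ g : G, T.map (MulAut.conj g).toMonoidHom ≤ R := by
  obtain ⟨S', hS'⟩ := hT.exists_le_sylow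
  obtain ⟨S, hS⟩ := (IsPGroup.of_card hR).exists_le_sylow
  have hRS : R = S := by
    refine eq_of_le_of_card_ge hS ?_
    obtain ⟨s, hs⟩ := IsPGroup.iff_card.1 S.2
    change Nat.card (S : Subgroup G) = _ at hs
    rw [hR, hs]
    refine Nat.pow_le_pow_right (Fact.out : p.Prime).pos ?_
    by_contra! hlt
    exact hG ((pow_dvd_pow p hlt).trans (hs ▸ card_subgroup_dvd_card (S : Subgroup G)))
  obtain ⟨g, hg⟩ := MulAction.exists_smul_eq G S' S
  refine ⟨g, ?_⟩
  rintro _ ⟨u, hu, rfl⟩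
  rw [hRS, ← hg]
  exact smul_mem_pointwise_smul u (MulAut.conj g) _ (hS' hu)

/-- A subgroup `A` of a finite group `G`, containing no Sylow `p`-subgroup of `G`, with the property
that an element conjugating a nontrivial element of `A` into `A` normalizes `A`, has index divisible
by `p` in its normalizer. -/
theorem dvd_relIndex_normalizer {G : Type*} [Group G] [Finite G] {A : Subgroup G} {p : ℕ}
    [Fact p.Prime] (hA : ∀ g, ∀ u ∈ A, u ≠ 1 → g * u * g⁻¹ ∈ A → g ∈ normalizer (A : Set G))
    (hp : p ∣ Nat.card A) (hG : ∀ k, p ^ k ∣ Nat.card A → p ^ (k + 1) ∣ Nat.card G) :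
    p ∣ A.relIndex (normalizer (A : Set G)) := by
  let Q : Sylow p A := default
  obtain ⟨k, hk⟩ := IsPGroup.iff_card.1 Q.2
  change Nat.card (Q : Subgroup A) = _ at hk
  have hR : Nat.card ((Q : Subgroup A).map A.subtype) = p ^ k := by
    rw [card_map_of_injective A.subtype_injective, hk]
  have h1 := Sylow.prime_pow_dvd_card_normalizer
    (hG k (hk ▸ card_subgroup_dvd_card (Q : Subgroup A))) hR
  have hQ : p ∣ p ^ k := hk ▸ Q.dvd_card_of_dvd_card hp
  have hnt : (Q : Subgroup A).map A.subtype ≠ ⊥ := by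
    intro h
    rw [h, card_bot] at hR
    rw [← hR] at hQ
    exact (Fact.out : p.Prime).not_dvd_one hQ
  obtain ⟨u, hu, hu1⟩ := bot_or_exists_ne_one _ |>.resolve_left hnt
  have hle : normalizer (((Q : Subgroup A).map A.subtype : Subgroup G) : Set G) ≤
      normalizer (A : Set G) := fun g hg =>
    hA g u (map_subtype_le _ hu) hu1
      (map_subtype_le _ ((mem_normalizer_iff.1 hg _).1 hu))
  have h2 := h1.trans (card_dvd_of_le hle)
  rw [← card_mul_index (A.subgroupOf (normalizer (A : Set G)))] at h2
  by_contra hnd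
  have h3 := (Nat.Coprime.pow_left (k + 1)
    (((Fact.out : p.Prime).coprime_iff_not_dvd).2 hnd)).dvd_of_dvd_mul_right h2
  rw [Nat.card_congr (subgroupOfEquivOfLe A.le_normalizer).toEquiv] at h3
  have h4 := Q.pow_dvd_card_of_pow_dvd_card h3
  rw [hk] at h4
  exact absurd ((Nat.pow_dvd_pow_iff_le_right (Fact.out : p.Prime).one_lt).1 h4) (by omega)

end Subgroup

namespace IsESPartition

variable {G : Type*} [Group G] [Finite G] {P : Finset (Subgroup G)}

theorem coprime_card (hP : IsESPartition ⊥ P) : P.card.Coprime (Nat.card G) := by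
  refine Nat.coprime_of_dvd fun r hr hrP hrG => hr.not_dvd_one ?_
  obtain ⟨H, hH⟩ := hP.nonempty
  refine (Nat.dvd_add_right (hrP.mul_right (Nat.card H))).1 ?_
  rw [← hP.card_add_card hH]
  exact dvd_add hrG hrP

theorem card_mul_card_le (hP : IsESPartition ⊥ P) {H : Subgroup G} (hH : H ∈ P) :
    Nat.card H * Nat.card H ≤ Nat.card G := by
  obtain ⟨K, hK, hKH⟩ := Finset.exists_mem_ne hP.1.1 H
  nth_rw 2 [← hP.2 K hK H hH]
  rw [← Subgroup.card_top (G := G)]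
  exact Subgroup.card_mul_card_le_of_disjoint le_top le_top
    (disjoint_iff.2 (hP.1.2.2.2 H hH K hK hKH.symm))

/-- No component contains a nontrivial Sylow subgroup of `G`. -/
theorem pow_succ_dvd_card (hP : IsESPartition ⊥ P) {p : ℕ} [Fact p.Prime] (hp : p ∣ Nat.card G)
    {K : Subgroup G} (hK : K ∈ P) {k : ℕ} (hk : p ^ k ∣ Nat.card K) :
    p ^ (k + 1) ∣ Nat.card G := by
  obtain ⟨z, hz⟩ := exists_prime_orderOf_dvd_card' p hp
  obtain ⟨H, hH, hzH⟩ := hP.exists_forall_conj_notMem (z := z) (by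
    rintro rfl
    rw [orderOf_one] at hz
    exact (Fact.out : p.Prime).one_lt.ne hz)
  by_contra hnd
  rw [hP.2 K hK H hH] at hk
  obtain ⟨T, hT⟩ := Sylow.exists_subgroup_card_pow_prime p hk
  have hTc : Nat.card (T.map H.subtype) = p ^ k := by
    rw [Subgroup.card_map_of_injective H.subtype_injective, hT]
  have hZ : IsPGroup p (Subgroup.zpowers z) :=
    IsPGroup.of_card (n := 1) (by rw [Nat.card_zpowers, hz, pow_one])
  obtain ⟨g, hg⟩ := hZ.exists_map_conj_le hTc hnd
  exact hzH g (Subgroup.map_subtype_le T (hg ⟨z, Subgroup.mem_zpowers z, rfl⟩))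

theorem not_sq_dvd_card_conjCell (hP : IsESPartition ⊥ P) {x : G} (hx : x ≠ 1) {p q : ℕ}
    [Fact p.Prime] [Fact q.Prime] (hpq : p ≠ q) (hp : p ∣ Nat.card (Subgroup.conjCell P x))
    (hq : q ∣ Nat.card (Subgroup.conjCell P x)) :
    ¬ p ^ 2 ∣ Nat.card (Subgroup.conjCell P x) := by
  set A := Subgroup.conjCell P x with hA
  have hp1 := (Fact.out : p.Prime).one_lt
  obtain ⟨K₀, hK₀, hxK₀⟩ := hP.1.2.2.1 x
  have hAK : Nat.card A ∣ Nat.card K₀ :=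
    Subgroup.card_dvd_of_le (Subgroup.conjCell_le hK₀ hxK₀)
  set N := Subgroup.normalizer (A : Set G) with hN
  have hAN : A ≤ N := A.le_normalizer
  have hcard : Nat.card (A.subgroupOf N) = Nat.card A :=
    Nat.card_congr (Subgroup.subgroupOfEquivOfLe hAN).toEquiv
  have he := ((Subgroup.isIsolated_conjCell hP.1 x).subgroupOf N).not_sq_dvd_index hpq
    (hcard.symm ▸ hp) (hcard.symm ▸ hq)
  let Q₀ : Sylow p A := default
  obtain ⟨k, hk⟩ := IsPGroup.iff_card.1 Q₀.2
  change Nat.card (Q₀ : Subgroup A) = _ at hk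
  set Q := (Q₀ : Subgroup A).map A.subtype with hQ
  have hQA : Q ≤ A := Subgroup.map_subtype_le _
  have hQc : Nat.card Q = p ^ k := by
    rw [hQ, Subgroup.card_map_of_injective A.subtype_injective, hk]
  have hkA : ∀ j, p ^ j ∣ Nat.card A → j ≤ k := fun j hj => by
    have := Q₀.pow_dvd_card_of_pow_dvd_card hj
    rw [hk] at this
    exact (Nat.pow_dvd_pow_iff_le_right hp1).1 this
  intro hsq
  have hk2 : 2 ≤ k := hkA 2 hsq
  have hkdvd : p ^ k ∣ Nat.card A := hQc ▸ Subgroup.card_dvd_of_le hQA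
  have hpG : p ∣ Nat.card G := hp.trans A.card_subgroup_dvd_card
  obtain ⟨R, hRc, hQR⟩ := Sylow.exists_subgroup_card_pow_succ
    (hP.pow_succ_dvd_card hpG hK₀ (hkdvd.trans hAK)) hQc
  by_cases hG : p ^ (k + 2) ∣ Nat.card G
  · have h1 := Sylow.prime_pow_dvd_card_normalizer hG hRc
    have h2 : ¬ Subgroup.normalizer (R : Set G) ≤ N := by
      intro hle
      have h3 := h1.trans (Subgroup.card_dvd_of_le hle)
      rw [← Subgroup.card_mul_index (A.subgroupOf N), hcard] at h3
      obtain ⟨c, hc⟩ := hkdvd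
      have hpc : ¬ p ∣ c := fun ⟨d, hd⟩ => by
        have := hkA (k + 1) ⟨d, by rw [hc, hd]; ring⟩
        omega
      rw [hc, mul_assoc, pow_add p k 2] at h3
      have h4 := Nat.dvd_of_mul_dvd_mul_left (pow_pos (Fact.out : p.Prime).pos k) h3
      exact he ((Nat.Coprime.pow_left 2
        (((Fact.out : p.Prime).coprime_iff_not_dvd).2 hpc)).dvd_of_dvd_mul_left h4)
    obtain ⟨g, hgR, hgN⟩ := SetLike.not_le_iff_exists.1 h2
    have h3 : Q.map (MulAut.conj g).toMonoidHom ≤ R := by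
      rintro _ ⟨u, hu, rfl⟩
      exact (Subgroup.mem_normalizer_iff.1 hgR u).1 (hQR hu)
    have h4 : Disjoint Q (Q.map (MulAut.conj g).toMonoidHom) := by
      rw [Subgroup.disjoint_def]
      rintro _ hQ' ⟨u, hu, rfl⟩
      by_contra h
      have hu1 : u ≠ 1 := by
        rintro rfl
        exact h (map_one _)
      exact hgN (Subgroup.mem_normalizer_conjCell hP.1 (hQA hu) hu1 (hQA hQ'))
    have h5 := Subgroup.card_mul_card_le_of_disjoint hQR h3 h4
    rw [hQc, Subgroup.card_map_of_injective (MulAut.conj g).injective, hQc, hRc, ← pow_add] at h5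
    have := (Nat.pow_le_pow_iff_right hp1).1 h5
    omega
  · obtain ⟨K, hK, hKx⟩ := hP.exists_forall_conj_notMem hx
    have hkK := hkdvd.trans hAK
    rw [hP.2 K₀ hK₀ K hK] at hkK
    obtain ⟨T, hT⟩ := Sylow.exists_subgroup_card_pow_prime p hkK
    obtain ⟨g, h3⟩ := ((IsPGroup.of_card hT).map K.subtype).exists_map_conj_le hRc hG
    have h4 : ¬ Disjoint Q ((T.map K.subtype).map (MulAut.conj g).toMonoidHom) := by
      intro h
      have h5 := Subgroup.card_mul_card_le_of_disjoint hQR h3 h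
      rw [hQc, Subgroup.card_map_of_injective (MulAut.conj g).injective,
        Subgroup.card_map_of_injective K.subtype_injective, hT, hRc, ← pow_add] at h5
      have := (Nat.pow_le_pow_iff_right hp1).1 h5
      omega
    rw [Subgroup.disjoint_def] at h4
    push Not at h4
    obtain ⟨_, hQ', ⟨u, hu, rfl⟩, hu1⟩ := h4
    have h5 := Subgroup.conjCell_eq hP.1 (hQA hQ') hu1
    have h6 : x ∈ Subgroup.conjCell P ((MulAut.conj g).toMonoidHom u) := by
      rw [h5]
      exact Subgroup.self_mem_conjCell
    refine hKx g⁻¹ (Subgroup.mem_conjCell.1 h6 g⁻¹ K hK ?_)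
    simpa [mul_assoc] using Subgroup.map_subtype_le T hu

/-- The order of `conjCell P x` has at most one prime divisor. -/
theorem eq_of_dvd_card_conjCell (hP : IsESPartition ⊥ P) {x : G} (hx : x ≠ 1) {p q : ℕ}
    [Fact p.Prime] [Fact q.Prime] (hp : p ∣ Nat.card (Subgroup.conjCell P x))
    (hq : q ∣ Nat.card (Subgroup.conjCell P x)) : p = q := by
  by_contra hpq
  have key : ∀ {p q : ℕ} [Fact p.Prime] [Fact q.Prime], p ≠ q →
      p ∣ Nat.card (Subgroup.conjCell P x) → q ∣ Nat.card (Subgroup.conjCell P x) →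
      p < q := by
    intro p q _ _ hpq hp hq
    obtain ⟨K, hK, hxK⟩ := hP.1.2.2.1 x
    have hAK := Subgroup.card_dvd_of_le (Subgroup.conjCell_le hK hxK)
    have hcard := Nat.card_congr (Subgroup.subgroupOfEquivOfLe
      (Subgroup.conjCell P x).le_normalizer).toEquiv
    have h1 := Subgroup.dvd_relIndex_normalizer
      (fun g u hu hu1 h => Subgroup.mem_normalizer_conjCell hP.1 hu hu1 h) hp
      (fun k hk => hP.pow_succ_dvd_card (hp.trans (Subgroup.card_subgroup_dvd_card _)) hK
        (hk.trans hAK))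
    have h2 := ((Subgroup.isIsolated_conjCell hP.1 x).subgroupOf _).modEq_one hpq
      (hcard.symm ▸ hp) (hcard.symm ▸ hq) h1
      (hcard.symm ▸ hP.not_sq_dvd_card_conjCell hx hpq.symm hq hp)
    have h3 := ((Nat.modEq_iff_dvd' (Fact.out : q.Prime).one_lt.le).1 h2.symm)
    have := Nat.le_of_dvd (Nat.sub_pos_of_lt (Fact.out : q.Prime).one_lt) h3
    have := (Fact.out : q.Prime).one_lt
    omega
  exact (key hpq hp hq).not_gt (key (Ne.symm hpq) hq hp)

/-- An element commuting with a nontrivial `q`-element is a `q`-element. -/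
theorem orderOf_eq_prime_pow_of_commute (hP : IsESPartition ⊥ P) {q : ℕ} [Fact q.Prime] {s y : G}
    (hs : s ≠ 1) {k : ℕ} (hk : orderOf s = q ^ k) (h : Commute s y) :
    ∃ j, orderOf y = q ^ j := by
  refine ⟨_, Nat.eq_prime_pow_of_unique_prime_dvd (orderOf_pos y).ne' fun {r} hr hry => ?_⟩
  have : Fact r.Prime := ⟨hr⟩
  by_contra hrq
  have hqs : q ∣ orderOf s := by
    rw [hk]
    refine dvd_pow_self q fun h0 => hs ?_
    rwa [h0, pow_zero, orderOf_eq_one_iff] at hk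
  obtain ⟨z, hz, hsz⟩ : ∃ z, orderOf z = r ∧ Commute s z :=
    ⟨y ^ (orderOf y / r), orderOf_pow_orderOf_div (orderOf_pos y).ne' hry, h.pow_right _⟩
  have hzmem : z ∈ Subgroup.conjCell P s := by
    refine Subgroup.isIsolated_conjCell hP.1 s s Subgroup.self_mem_conjCell hs z hsz ?_
    rw [hz]
    intro h
    rw [h] at hqs
    exact hrq ((Nat.prime_dvd_prime_iff_eq Fact.out hr).1 hqs).symm
  refine hrq (hP.eq_of_dvd_card_conjCell hs ?_ ?_)
  · rw [← hz]
    exact Subgroup.orderOf_dvd_natCard _ hzmem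
  · exact hqs.trans (Subgroup.orderOf_dvd_natCard _ Subgroup.self_mem_conjCell)

end IsESPartition

/-- If conjugation by a subgroup `K` preserves a set `Y` none of whose members commutes with a
nontrivial `q`-element, then every power of `q` dividing the order of `K` divides the size of
`Y`. -/
theorem Subgroup.pow_dvd_ncard_of_conj_mem {G : Type*} [Group G] [Finite G] (K : Subgroup G)
    {Y : Set G} {q k : ℕ} [Fact q.Prime] (hY : ∀ g ∈ K, ∀ y ∈ Y, g * y * g⁻¹ ∈ Y)
    (hcomm : ∀ y ∈ Y, ∀ s : G, s ≠ 1 → (∃ j, orderOf s = q ^ j) → ¬ Commute s y)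
    (hk : q ^ k ∣ Nat.card K) : q ^ k ∣ Y.ncard := by
  obtain ⟨Q, hQ⟩ := Sylow.exists_subgroup_card_pow_prime q hk
  let _ : MulAction Q Y :=
    { smul := fun g y => ⟨g * y * (g : G)⁻¹, hY _ (g : K).2 _ y.2⟩
      one_smul := fun y => Subtype.ext (by change ((1 : Q) : G) * y * ((1 : Q) : G)⁻¹ = y; simp)
      mul_smul := fun a b y => Subtype.ext (by
        change ((a * b : Q) : G) * y * ((a * b : Q) : G)⁻¹ = a * (b * y * (b : G)⁻¹) * (a : G)⁻¹
        simp [mul_assoc]) }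
  have hstab : ∀ y : Y, MulAction.stabilizer Q y = ⊥ := by
    intro y
    rw [eq_bot_iff]
    intro s hs
    rw [Subgroup.mem_bot]
    by_contra hs1
    obtain ⟨j, hj⟩ := IsPGroup.iff_orderOf.1 (IsPGroup.of_card hQ) s
    have h1 : (s : G) * y * (s : G)⁻¹ = y :=
      congrArg Subtype.val (MulAction.mem_stabilizer_iff.1 hs)
    refine hcomm y y.2 s (by simpa using hs1) ⟨j, ?_⟩ (mul_inv_eq_iff_eq_mul.1 h1)
    rw [Subgroup.orderOf_coe, Subgroup.orderOf_coe, hj]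
  rw [← Nat.card_coe_set_eq, Nat.card_congr (MulAction.selfEquivOrbitsQuotientProd hstab),
    Nat.card_prod, hQ]
  exact dvd_mul_left _ _

/-- The set of nontrivial elements of `p`-power order of a subgroup. -/
def Subgroup.primaryElements {G : Type*} [Group G] (p : ℕ) (K : Subgroup G) : Set G :=
  {x | x ∈ K ∧ x ≠ 1 ∧ ∃ j, orderOf x = p ^ j}

/-- The set of elements of a subgroup whose order is not a power of `p`. -/
def Subgroup.nonprimaryElements {G : Type*} [Group G] (p : ℕ) (K : Subgroup G) : Set G :=
  {x | x ∈ K ∧ ¬ ∃ j, orderOf x = p ^ j}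

namespace Subgroup

variable {G : Type*} [Group G]

theorem ncard_primaryElements_add [Finite G] (p : ℕ) (K : Subgroup G) :
    (K.primaryElements p).ncard + (K.nonprimaryElements p).ncard + 1 = Nat.card K := by
  have h1 : insert 1 (K.primaryElements p ∪ K.nonprimaryElements p) = (K : Set G) := by
    ext x
    simp only [primaryElements, nonprimaryElements, Set.mem_insert_iff, Set.mem_union,
      Set.mem_ofPred_eq, SetLike.mem_coe]
    constructor
    · rintro (rfl | h | h)
      exacts [K.one_mem, h.1, h.1]
    · intro h
      tauto
  have h2 : (1 : G) ∉ K.primaryElements p ∪ K.nonprimaryElements p := by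
    rintro (h | h)
    · exact h.2.1 rfl
    · exact h.2 ⟨0, by simp⟩
  have h3 : Disjoint (K.primaryElements p) (K.nonprimaryElements p) :=
    Set.disjoint_left.2 fun x hx hy => hy.2 hx.2.2
  rw [← Set.ncard_union_eq h3, ← Set.ncard_insert_of_notMem h2, h1]
  rfl

theorem orderOf_conj (g x : G) : orderOf (g * x * g⁻¹) = orderOf x :=
  (MulAut.conj g).orderOf_eq x

theorem conj_mem_primaryElements {p : ℕ} {K : Subgroup G} {g x : G} (hg : g ∈ K)
    (hx : x ∈ K.primaryElements p) : g * x * g⁻¹ ∈ K.primaryElements p :=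
  ⟨K.mul_mem (K.mul_mem hg hx.1) (K.inv_mem hg), by simpa [conj_eq_one_iff] using hx.2.1,
    by rw [orderOf_conj]; exact hx.2.2⟩

theorem conj_mem_nonprimaryElements {p : ℕ} {K : Subgroup G} {g x : G} (hg : g ∈ K)
    (hx : x ∈ K.nonprimaryElements p) : g * x * g⁻¹ ∈ K.nonprimaryElements p :=
  ⟨K.mul_mem (K.mul_mem hg hx.1) (K.inv_mem hg), by rw [orderOf_conj]; exact hx.2⟩

end Subgroup

namespace IsESPartition

open Subgroup

variable {G : Type*} [Group G] [Finite G] {P : Finset (Subgroup G)}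

theorem pow_dvd_ncard_primaryElements (hP : IsESPartition ⊥ P) {p q k : ℕ} [Fact p.Prime]
    [Fact q.Prime] (hpq : p ≠ q) {K : Subgroup G} (hk : q ^ k ∣ Nat.card K) :
    q ^ k ∣ (K.primaryElements p).ncard := by
  refine K.pow_dvd_ncard_of_conj_mem (fun g hg y hy => conj_mem_primaryElements hg hy) ?_ hk
  rintro y ⟨-, hy1, i, hi⟩ s hs ⟨j, hj⟩ hsy
  obtain ⟨l, hl⟩ := hP.orderOf_eq_prime_pow_of_commute hs hj hsy
  have h1 : (orderOf y).Coprime (orderOf y) := by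
    nth_rw 1 [hi]
    rw [hl]
    exact Nat.coprime_pow_primes _ _ Fact.out Fact.out hpq
  rw [Nat.coprime_self, orderOf_eq_one_iff] at h1
  exact hy1 h1

theorem pow_dvd_ncard_nonprimaryElements (hP : IsESPartition ⊥ P) {p k : ℕ} [Fact p.Prime]
    {K : Subgroup G} (hk : p ^ k ∣ Nat.card K) :
    p ^ k ∣ (K.nonprimaryElements p).ncard := by
  refine K.pow_dvd_ncard_of_conj_mem (fun g hg y hy => conj_mem_nonprimaryElements hg hy) ?_ hk
  rintro y ⟨-, hy⟩ s hs ⟨j, hj⟩ hsy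
  exact hy (hP.orderOf_eq_prime_pow_of_commute hs hj hsy)

theorem ncard_primaryElements_top (hP : IsESPartition ⊥ P) (p : ℕ) :
    ((⊤ : Subgroup G).primaryElements p).ncard = ∑ K ∈ P, (K.primaryElements p).ncard := by
  classical
  have := Fintype.ofFinite G
  rw [Set.ncard_eq_toFinset_card', hP.1.card_eq_sum _ id fun a ha => (Set.mem_toFinset.1 ha).2.1]
  refine Finset.sum_congr rfl fun K _ => ?_
  rw [Set.ncard_eq_toFinset_card']
  congr 1
  ext x
  rw [Finset.mem_filter, Set.mem_toFinset, Set.mem_toFinset]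
  simp [primaryElements, and_comm]

/-- All components contain the same number of nontrivial `p`-elements. -/
theorem ncard_primaryElements_eq (hP : IsESPartition ⊥ P) {p : ℕ} [Fact p.Prime]
    {H K : Subgroup G} (hH : H ∈ P) (hK : K ∈ P) :
    (H.primaryElements p).ncard = (K.primaryElements p).ncard := by
  wlog hle : (H.primaryElements p).ncard ≤ (K.primaryElements p).ncard generalizing H K
  · exact (this hK hH (le_of_not_ge hle)).symm
  have h1 := H.ncard_primaryElements_add p
  have h2 := K.ncard_primaryElements_add p
  rw [hP.2 K hK H hH] at h2
  have hdvd : Nat.card H ∣ (K.primaryElements p).ncard - (H.primaryElements p).ncard := by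
    rw [Nat.dvd_iff_prime_pow_dvd_dvd]
    intro q k hq hk
    have : Fact q.Prime := ⟨hq⟩
    by_cases hpq : p = q
    · subst hpq
      have h3 := Nat.dvd_sub (hP.pow_dvd_ncard_nonprimaryElements hk)
        (hP.pow_dvd_ncard_nonprimaryElements (hP.2 K hK H hH ▸ hk))
      convert h3 using 1
      omega
    · exact Nat.dvd_sub (hP.pow_dvd_ncard_primaryElements hpq (hP.2 K hK H hH ▸ hk))
        (hP.pow_dvd_ncard_primaryElements hpq hk)
  have := Nat.eq_zero_of_dvd_of_lt hdvd (by omega)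
  omega

theorem ordCompl_lt_card (hP : IsESPartition ⊥ P) {p : ℕ} [Fact p.Prime] (hp : p ∣ Nat.card G)
    {H : Subgroup G} (hH : H ∈ P) : ordCompl[p] (Nat.card G) < Nat.card H := by
  have h1 := hP.ncard_primaryElements_top p
  rw [Finset.sum_congr rfl fun K hK => hP.ncard_primaryElements_eq hK hH, Finset.sum_const,
    smul_eq_mul] at h1
  have hpos : 0 < ((⊤ : Subgroup G).primaryElements p).ncard := by
    rw [Set.ncard_pos]
    obtain ⟨g, hg⟩ := exists_prime_orderOf_dvd_card' p hp
    refine ⟨g, mem_top g, ?_, 1, by simpa using hg⟩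
    rintro rfl
    rw [orderOf_one] at hg
    exact (Fact.out : p.Prime).one_lt.ne hg
  have hdvd : ordCompl[p] (Nat.card G) ∣ (H.primaryElements p).ncard := by
    rw [Nat.dvd_iff_prime_pow_dvd_dvd]
    intro q k hq hk
    have : Fact q.Prime := ⟨hq⟩
    have hkG := hk.trans (Nat.ordCompl_dvd (Nat.card G) p)
    by_cases hpq : p = q
    · subst hpq
      have h2 := ((Nat.coprime_ordCompl hq Nat.card_pos.ne').pow_left k).eq_one_of_dvd hk
      rw [h2]
      exact one_dvd _
    · rw [← card_top (G := G)] at hkG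
      have h2 := hP.pow_dvd_ncard_primaryElements hpq hkG
      rw [h1] at h2
      rw [card_top] at hkG
      exact (hP.coprime_card.symm.coprime_dvd_left hkG).dvd_of_dvd_mul_left h2
  have h2 := H.ncard_primaryElements_add p
  have h3 := Nat.le_of_dvd (Nat.pos_of_mul_pos_left (h1 ▸ hpos)) hdvd
  omega

theorem prime_eq_of_dvd_card (hP : IsESPartition ⊥ P) {p r : ℕ} (hp : p.Prime) (hr : r.Prime)
    (hpG : p ∣ Nat.card G) (hrG : r ∣ Nat.card G) : p = r := by
  have : Fact p.Prime := ⟨hp⟩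
  have : Fact r.Prime := ⟨hr⟩
  by_contra hpr
  obtain ⟨H, hH⟩ := hP.nonempty
  have h1 := hP.ordCompl_lt_card hpG hH
  have h2 := hP.ordCompl_lt_card hrG hH
  have h3 : ordProj[p] (Nat.card G) ∣ ordCompl[r] (Nat.card G) := by
    refine (Nat.coprime_pow_primes _ ((Nat.card G).factorization r)
      hp hr hpr).dvd_of_dvd_mul_left ?_
    rw [Nat.ordProj_mul_ordCompl_eq_self]
    exact Nat.ordProj_dvd _ _
  have h4 := Nat.le_of_dvd (Nat.ordCompl_pos r Nat.card_pos.ne') h3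
  have h5 := Nat.ordProj_mul_ordCompl_eq_self (Nat.card G) p
  have h6 := hP.card_mul_card_le hH
  rw [← h5] at h6
  exact absurd (Nat.mul_lt_mul'' (h4.trans_lt h2) h1) (by omega)

theorem isNilpotent_of_bot_s1 (hP : IsESPartition ⊥ P) : Group.IsNilpotent G := by
  by_cases h : Nat.card G = 1
  · have := (Nat.card_eq_one_iff_unique.1 h).1
    infer_instance
  · have hp := Nat.minFac_prime h
    have : Fact (Nat.card G).minFac.Prime := ⟨hp⟩
    exact (IsPGroup.of_card (Nat.eq_prime_pow_of_unique_prime_dvd Nat.card_pos.ne' fun hr hrG =>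
      hP.prime_eq_of_dvd_card hr hp hrG (Nat.minFac_dvd _))).isNilpotent

open Classical in
/-- An `ES`-partition over a normal subgroup induces an `ES`-partition of the quotient. -/
theorem map_mk {S : Subgroup G} [S.Normal] (hP : IsESPartition S P) :
    IsESPartition ⊥ (P.image (map (QuotientGroup.mk' S))) := by
  have hS : ∀ H ∈ P, S ≤ H := by
    intro H hH
    obtain ⟨K, hK, hne⟩ := Finset.exists_mem_ne hP.1.1 H
    rw [← hP.1.2.2.2 H hH K hK hne.symm]
    exact inf_le_left
  have hcomap : ∀ H ∈ P, (H.map (QuotientGroup.mk' S)).comap (QuotientGroup.mk' S) = H := by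
    intro H hH
    rw [QuotientGroup.comap_map_mk', sup_eq_right.2 (hS H hH)]
  have hinj : Set.InjOn (map (QuotientGroup.mk' S)) P := by
    intro H hH K hK h
    rw [← hcomap H hH, h, hcomap K hK]
  refine ⟨⟨?_, ?_, ?_, ?_⟩, ?_⟩
  · rw [Finset.card_image_of_injOn hinj]
    exact hP.1.1
  · simp only [Finset.forall_mem_image]
    intro H hH h
    apply hP.1.2.1 H hH
    rw [← hcomap H hH, h, comap_top]
  · intro g
    obtain ⟨x, rfl⟩ := QuotientGroup.mk'_surjective S g
    obtain ⟨H, hH, hx⟩ := hP.1.2.2.1 x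
    exact ⟨_, Finset.mem_image_of_mem _ hH, mem_map_of_mem _ hx⟩
  · simp only [Finset.forall_mem_image]
    intro H hH K hK hne
    have hHK : H ≠ K := fun h => hne (h ▸ rfl)
    apply comap_injective (QuotientGroup.mk'_surjective S)
    rw [comap_inf, hcomap H hH, hcomap K hK, hP.1.2.2.2 H hH K hK hHK, MonoidHom.comap_bot,
      QuotientGroup.ker_mk']
  · simp only [Finset.forall_mem_image]
    intro H hH K hK
    have key : ∀ H ∈ P,
        Nat.card (H.map (QuotientGroup.mk' S)) * H.index = Nat.card (G ⧸ S) := by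
      intro H hH
      rw [← index_map_eq H (QuotientGroup.mk'_surjective S)
        (by rw [QuotientGroup.ker_mk']; exact hS H hH), card_mul_index]
    have hindex : H.index = K.index := by
      refine Nat.eq_of_mul_eq_mul_left (Nat.card_pos (α := H)) ?_
      rw [card_mul_index, hP.2 H hH K hK, card_mul_index]
    refine Nat.eq_of_mul_eq_mul_right (Nat.pos_of_ne_zero H.index_ne_zero_of_finite) ?_
    rw [key H hH, hindex, key K hK]

end IsESPartition

/-- A group with nilpotent quotient by a normal subgroup contained in a term of the upper central
series is nilpotent. -/
theorem Group.IsNilpotent.of_quotient_of_le_upperCentralSeries {G : Type*} [Group G]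
    {S : Subgroup G} [S.Normal] {i : ℕ} (hS : S ≤ Subgroup.upperCentralSeries G i)
    (h : Group.IsNilpotent (G ⧸ S)) : Group.IsNilpotent G := by
  have key : ∀ j, (Subgroup.upperCentralSeries (G ⧸ S) j).comap (QuotientGroup.mk' S) ≤
      Subgroup.upperCentralSeries G (i + j) := by
    intro j
    induction j with
    | zero =>
      rw [Subgroup.upperCentralSeries_zero, MonoidHom.comap_bot, QuotientGroup.ker_mk']
      exact hS
    | succ j ih =>
      intro x hx
      rw [← add_assoc, Subgroup.mem_upperCentralSeries_succ_iff]
      intro y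
      apply ih
      rw [Subgroup.mem_comap, Subgroup.mem_upperCentralSeries_succ_iff] at hx
      simpa using hx (QuotientGroup.mk' S y)
  obtain ⟨n, hn⟩ := h
  refine ⟨i + n, eq_top_iff.2 ?_⟩
  have := key n
  rwa [hn, Subgroup.comap_top] at this

theorem nilpotent_of_ESPartition_central {G : Type*} [Group G] [Finite G]
    (S : Subgroup G) (P : Finset (Subgroup G)) (hP : IsESPartition S P)
    (hSnormal : S.Normal) (hSZ : ∃ i : ℕ, S ≤ upperCentralSeries G i) :
    Group.IsNilpotent G := by
  obtain ⟨i, hi⟩ := hSZ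
  exact Group.IsNilpotent.of_quotient_of_le_upperCentralSeries hi hP.map_mk.isNilpotent_of_bot_s1
end
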